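/- arXiv:math/0110048 — 7 statements merged into one kernel-verified Lean document; each statement's English description precedes it below -/
import Mathlib

section
/- Let r ≥ 0 be an integer, x ∈ F^r, and y ∈ F^×. Let c be an integer with c·(1+p)^r ≡ (1+p) (mod p^n) (i.e., c represents (1+p)^{1−r} modulo p^n). Then γ(y)·y^{−c} is a norm from K = F(x^{1/p^n}) to F, where x^{1/p^n} is any p^n-th root of x in an algebraic closure of F. -/
/-- Membership in the group `F^r`: `x ∈ F^×` such that for every `σ ∈ Gal(F/E)`,
`σ(x)·x^{-c_σ^r} ∈ F^{×p^n}`, where `c_σ` is the cyclotomic character value of `σ`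
(encoded as a unit of `ZMod (p^n)`). -/
def memFr (p n : ℕ) (E : Type) {F : Type} [Field E] [Field F] [Algebra E F]
    (ζ : F) (r : ℤ) (x : F) : Prop :=
  x ≠ 0 ∧ ∀ (σ : F ≃ₐ[E] F) (u : (ZMod (p ^ n))ˣ),
    σ ζ = ζ ^ ((u : ZMod (p ^ n)).val) →
      ∃ w : F, σ x * (x ^ (((u ^ r : (ZMod (p ^ n))ˣ) : ZMod (p ^ n)).val))⁻¹ = w ^ (p ^ n)

/-- `b` is a norm from `F(y)` down to `F`. -/
def isNormFrom {F : Type} [Field F] (y : AlgebraicClosure F) (b : F) : Prop :=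
  ∃ z : IntermediateField.adjoin F {y}, Algebra.norm F z = b

/-- The set of integers `f ≥ 0` such that every unit `u` of `F` with `v(u-1) ≥ f`
is a norm from `F(y)`; its least element is the conductor of `F(y)/F`. -/
def condSet {F : Type} [Field F] (v : AddValuation F (WithTop ℤ))
    (y : AlgebraicClosure F) : Set ℕ :=
  {f : ℕ | ∀ u : F, v u = 0 → ((f : ℤ) : WithTop ℤ) ≤ v (u - 1) → isNormFrom y u}

/-- If `D` and `N` are endomorphisms of a commutative group `A` with `N ∘ D = 1 = D ∘ N` and
`ker N = range D`, and `W` is a stable subgroup of finite index, then the Tate group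
`ker D / range N` is no larger than its analogue for `W`. -/
theorem Subgroup.relIndex_range_ker_le {A : Type*} [CommGroup A] (D N : A →* A)
    (hDN : ∀ a, D (N a) = 1) (hND : N.ker = D.range) (W : Subgroup A)
    [W.FiniteIndex] (hWD : W.map D ≤ W) (hWN : W.map N ≤ W)
    (h0 : (W.map N).relIndex (W ⊓ D.ker) ≠ 0) :
    N.range.relIndex D.ker ≠ 0 ∧
      N.range.relIndex D.ker ≤ (W.map N).relIndex (W ⊓ D.ker) := by
  classical
  let π := QuotientGroup.mk' W
  have hπ : Function.Surjective π := QuotientGroup.mk'_surjective W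
  have kπ : π.ker = W := QuotientGroup.ker_mk' W
  let D' : (A ⧸ W) →* (A ⧸ W) := QuotientGroup.map W W D (Subgroup.map_le_iff_le_comap.1 hWD)
  let N' : (A ⧸ W) →* (A ⧸ W) := QuotientGroup.map W W N (Subgroup.map_le_iff_le_comap.1 hWN)
  have hD' : ∀ a, D' (π a) = π (D a) := fun a => rfl
  have hN' : ∀ a, N' (π a) = π (N a) := fun a => rfl
  have hNDa : ∀ a, N (D a) = 1 := fun a => by
    have : D a ∈ N.ker := hND ▸ ⟨a, rfl⟩
    exact this
  have i1 : N'.range ≤ D'.ker := by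
    rintro _ ⟨q, rfl⟩
    obtain ⟨a, rfl⟩ := hπ q
    rw [MonoidHom.mem_ker, hN', hD', hDN, map_one]
  have i2 : D'.range ≤ N'.ker := by
    rintro _ ⟨q, rfl⟩
    obtain ⟨a, rfl⟩ := hπ q
    rw [MonoidHom.mem_ker, hD', hN', hNDa, map_one]
  have : Finite (A ⧸ W) := inferInstance
  have key : N'.range.relIndex D'.ker = D'.range.relIndex N'.ker := by
    have e1 := Subgroup.relIndex_mul_relIndex _ _ _ (bot_le (a := N'.range)) i1
    have e2 := Subgroup.relIndex_mul_relIndex _ _ _ (bot_le (a := D'.range)) i2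
    simp only [Subgroup.relIndex_bot_left] at e1 e2
    have c1 : Nat.card D'.ker * Nat.card D'.range = Nat.card (A ⧸ W) := by
      rw [← Subgroup.index_ker, Subgroup.card_mul_index]
    have c2 : Nat.card N'.ker * Nat.card N'.range = Nat.card (A ⧸ W) := by
      rw [← Subgroup.index_ker, Subgroup.card_mul_index]
    have p1 : 0 < Nat.card N'.range := Nat.card_pos
    have p2 : 0 < Nat.card D'.range := Nat.card_pos
    rw [← e1] at c1
    rw [← e2, ← c1] at c2
    have : (Nat.card N'.range * Nat.card D'.range) * D'.range.relIndex N'.ker =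
      (Nat.card N'.range * Nat.card D'.range) * N'.range.relIndex D'.ker := by
      linarith
    exact (Nat.eq_of_mul_eq_mul_left (Nat.mul_pos p1 p2) this).symm
  have fin1 : N'.range.relIndex D'.ker ≠ 0 := by
    have := Subgroup.isFiniteRelIndex_of_finiteIndex (H := N'.range) (K := D'.ker)
    exact Subgroup.relIndex_ne_zero
  -- first inequality
  have hmapN : N'.range.comap π = N.range ⊔ W := by
    have : N'.range = N.range.map π := by
      ext q; constructor
      · rintro ⟨q, rfl⟩
        obtain ⟨a, rfl⟩ := hπ q
        exact ⟨N a, ⟨a, rfl⟩, rfl⟩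
      · rintro ⟨_, ⟨a, rfl⟩, rfl⟩
        exact ⟨π a, rfl⟩
    rw [this, Subgroup.comap_map_eq, kπ]
  have hmapD : D'.range.comap π = D.range ⊔ W := by
    have : D'.range = D.range.map π := by
      ext q; constructor
      · rintro ⟨q, rfl⟩
        obtain ⟨a, rfl⟩ := hπ q
        exact ⟨D a, ⟨a, rfl⟩, rfl⟩
      · rintro ⟨_, ⟨a, rfl⟩, rfl⟩
        exact ⟨π a, rfl⟩
    rw [this, Subgroup.comap_map_eq, kπ]
  have hrB : N.range ≤ D.ker := by
    rintro _ ⟨a, rfl⟩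
    exact hDN a
  have le1 : (N.range ⊔ W).relIndex D.ker ≤ N'.range.relIndex D'.ker := by
    rw [← hmapN, Subgroup.relIndex_comap]
    refine Subgroup.relIndex_le_of_le_right ?_ fin1
    rintro _ ⟨a, ha, rfl⟩
    rw [MonoidHom.mem_ker, hD', (show D a = 1 from ha), map_one]
  have ne1 : (N.range ⊔ W).relIndex D.ker ≠ 0 := by
    have : (N.range ⊔ W).FiniteIndex := Subgroup.finiteIndex_of_le (H := W) le_sup_right
    have := Subgroup.isFiniteRelIndex_of_finiteIndex (H := N.range ⊔ W) (K := D.ker)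
    exact Subgroup.relIndex_ne_zero
  have mod : (N.range ⊔ W) ⊓ D.ker = N.range ⊔ (W ⊓ D.ker) := sup_inf_assoc_of_le W hrB
  rw [← Subgroup.inf_relIndex_right, mod] at le1 ne1
  -- the index of `W.map N` in `W ⊓ N.range`
  have h2 : (W.map N).relIndex (W ⊓ N.range) = D'.range.relIndex N'.ker := by
    have t1 : (W.map N).comap N = D'.range.comap π := by
      rw [Subgroup.comap_map_eq, hND, hmapD, sup_comm]
    have t2 : (N'.ker.comap π).map N = W ⊓ N.range := by
      ext a; constructor
      · rintro ⟨b, hb, rfl⟩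
        have hb' : N' (π b) = 1 := hb
        refine ⟨?_, ⟨b, rfl⟩⟩
        rw [hN'] at hb'
        have : N b ∈ π.ker := hb'
        rwa [kπ] at this
      · rintro ⟨h1, ⟨b, rfl⟩⟩
        refine ⟨b, ?_, rfl⟩
        change N' (π b) = 1
        rw [hN']
        change N b ∈ π.ker
        rwa [kπ]
    rw [← t2, ← Subgroup.relIndex_comap, t1, Subgroup.relIndex_comap,
      Subgroup.map_comap_eq_self_of_surjective hπ]
  have hle : W.map N ≤ W ⊓ N.range := by
    rintro _ ⟨a, ha, rfl⟩
    exact ⟨hWN ⟨a, ha, rfl⟩, ⟨a, rfl⟩⟩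
  have m1 := Subgroup.relIndex_mul_relIndex (W.map N) (W ⊓ N.range) (W ⊓ D.ker) hle
    (inf_le_inf_left _ hrB)
  have m2 : N.range.relIndex (N.range ⊔ (W ⊓ D.ker)) = (W ⊓ N.range).relIndex (W ⊓ D.ker) := by
    rw [Subgroup.relIndex_sup_left, ← Subgroup.inf_relIndex_right]
    congr 1
    rw [inf_comm W N.range, ← inf_assoc]
    ext a
    simp only [Subgroup.mem_inf]
    constructor
    · rintro ⟨⟨a, b⟩, c⟩; exact ⟨a, b⟩
    · rintro ⟨a, b⟩; exact ⟨⟨a, b⟩, hrB a⟩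
  have m3 := Subgroup.relIndex_mul_relIndex N.range (N.range ⊔ (W ⊓ D.ker)) D.ker le_sup_left
    (sup_le hrB inf_le_right)
  rw [← m3, m2, ← m1, h2, ← key]
  rw [← m1, mul_ne_zero_iff] at h0
  refine ⟨mul_ne_zero h0.2 ne1, ?_⟩
  rw [mul_comm]
  exact Nat.mul_le_mul_right _ le1

section

open scoped Nat Topology

theorem NormedSpace.expSeries_padic_radius_pos (p : ℕ) [Fact p.Prime] (K : Type*) [NormedField K]
    [NormedAlgebra ℚ_[p] K] : 0 < (NormedSpace.expSeries ℚ_[p] K).radius := by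
  have hp : (1 : ℝ) < p := by exact_mod_cast (Fact.out : p.Prime).one_lt
  have hp0 : (0 : ℝ) < p := by linarith
  have hr : 0 < (p : ℝ)⁻¹ := inv_pos.2 hp0
  refine lt_of_lt_of_le ?_ (FormalMultilinearSeries.le_radius_of_bound (r := ⟨(p : ℝ)⁻¹, hr.le⟩)
    (NormedSpace.expSeries ℚ_[p] K) 1 fun n => ?_)
  · exact ENNReal.coe_pos.2 hr
  · change _ * ((p : ℝ)⁻¹) ^ n ≤ 1
    have h1 : ‖NormedSpace.expSeries ℚ_[p] K n‖ ≤ ‖((n ! : ℚ_[p])⁻¹)‖ := by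
      refine ContinuousMultilinearMap.opNorm_le_bound (norm_nonneg _) fun m => ?_
      rw [NormedSpace.expSeries, smul_apply, norm_smul]
      gcongr
      refine (ContinuousMultilinearMap.le_opNorm _ m).trans ?_
      simp
    have h2 : ‖((n ! : ℚ_[p])⁻¹)‖ ≤ (p : ℝ) ^ n := by
      rw [norm_inv, Padic.norm_eq_zpow_neg_valuation (by exact_mod_cast n.factorial_ne_zero),
        Padic.valuation_natCast, ← zpow_neg, neg_neg, zpow_natCast]
      refine pow_le_pow_right₀ hp.le ?_
      rcases eq_or_ne n 0 with rfl | hn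
      · simp
      · exact (padicValNat_factorial_lt_of_ne_zero p hn).le
    calc _ ≤ (p : ℝ) ^ n * ((p : ℝ)⁻¹) ^ n := by gcongr; exact h1.trans h2
      _ = 1 := by rw [← mul_pow, mul_inv_cancel₀ hp0.ne', one_pow]

/-- On a small ball of a complete field over `ℚ_[p]` the exponential is an injective homomorphism
commuting with continuous ring endomorphisms, and it maps neighbourhoods of `0` to
neighbourhoods of `1`. -/
theorem NormedSpace.exists_exp_radius (p : ℕ) [Fact p.Prime] (K : Type*) [NormedField K]
    [NormedAlgebra ℚ_[p] K] [CompleteSpace K] [CharZero K] :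
    ∃ δ : ℝ, 0 < δ ∧
      (∀ x y : K, ‖x‖ < δ → ‖y‖ < δ → exp (x + y) = exp x * exp y) ∧
      (∀ x y : K, ‖x‖ < δ → ‖y‖ < δ → exp x = exp y → x = y) ∧
      (∀ f : K →+* K, Continuous f → ∀ x : K, ‖x‖ < δ → f (exp x) = exp (f x)) ∧
      ∀ s ∈ 𝓝 (0 : K), exp '' s ∈ 𝓝 (1 : K) := by
  have hpos := NormedSpace.expSeries_padic_radius_pos p K
  have hs : HasStrictFDerivAt (exp : K → K) (1 : K →L[ℚ_[p]] K) 0 :=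
    hasStrictFDerivAt_exp_zero_of_radius_pos hpos
  have hs' : HasStrictFDerivAt (exp : K → K)
    ((ContinuousLinearEquiv.refl ℚ_[p] K : K ≃L[ℚ_[p]] K) : K →L[ℚ_[p]] K) 0 := hs
  obtain ⟨r, hr0, hr⟩ := ENNReal.lt_iff_exists_nnreal_btwn.1 hpos
  have hball : ∀ x : K, ‖x‖ < r → x ∈ Metric.eball (0 : K) (expSeries ℚ_[p] K).radius := by
    intro x hx
    rw [Metric.mem_eball, edist_zero_right]
    refine lt_trans ?_ hr
    rw [enorm_eq_nnnorm]
    exact_mod_cast hx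
  let e := hs'.toOpenPartialHomeomorph exp
  have he : (e : K → K) = exp := hs'.toOpenPartialHomeomorph_coe
  have h0 : (0 : K) ∈ e.source := hs'.mem_toOpenPartialHomeomorph_source
  obtain ⟨ε, hε, hsub⟩ := Metric.isOpen_iff.1 e.open_source 0 h0
  have hr0' : (0 : ℝ) < r := by exact_mod_cast hr0
  refine ⟨min r ε, lt_min hr0' hε, ?_, ?_, ?_, ?_⟩
  · intro x y hx hy
    exact exp_add_of_mem_ball (hball x (hx.trans_le (min_le_left _ _)))
      (hball y (hy.trans_le (min_le_left _ _)))
  · intro x y hx hy h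
    rw [← he] at h
    exact e.injOn (hsub (by simpa using hx.trans_le (min_le_right _ _)))
      (hsub (by simpa using hy.trans_le (min_le_right _ _))) h
  · intro f hf x hx
    exact map_exp_of_mem_ball (𝕂 := ℚ_[p]) f hf x (hball x (hx.trans_le (min_le_left _ _)))
  · intro s hs
    have := hs'.map_nhds_eq_of_equiv
    rw [NormedSpace.exp_zero] at this
    rw [← this]
    exact Filter.image_mem_map hs

end

theorem Subgroup.relIndex_sup_zpowers_dvd {A : Type*} [CommGroup A] (H : Subgroup A) {g : A} {d : ℕ}
    (hg : g ^ d ∈ H) : H.relIndex (H ⊔ Subgroup.zpowers g) ∣ d := by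
  rw [Subgroup.relIndex_sup_left]
  conv_lhs => rw [← QuotientGroup.ker_mk' H]
  rw [Subgroup.relIndex_ker, MonoidHom.map_zpowers, Nat.card_zpowers]
  refine orderOf_dvd_of_pow_eq_one ?_
  rw [← map_pow]
  exact (QuotientGroup.eq_one_iff _).2 hg

/-- A subgroup of `Kˣ` containing a neighbourhood of `1` and a nonzero element of norm `< 1` has
finite index, when `K` is proper. -/
theorem Subgroup.finiteIndex_units_of_mem_nhds {K : Type*} [NormedField K] [ProperSpace K]
    (W : Subgroup Kˣ) {s : Set K} (hs : s ∈ nhds (1 : K)) (hsW : ∀ u : Kˣ, (u : K) ∈ s → u ∈ W)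
    {q : Kˣ} (hq : ‖(q : K)‖ < 1) (hqW : q ∈ W) : W.FiniteIndex := by
  classical
  have hq0 : 0 < ‖(q : K)‖ := norm_pos_iff.2 q.ne_zero
  let C : Set K := Metric.closedBall 0 1 ∩ {x | ‖(q : K)‖ ≤ ‖x‖}
  have hC : IsCompact C := (isCompact_closedBall (0 : K) 1).inter_right
    (isClosed_le continuous_const continuous_norm)
  have hC0 : ∀ x ∈ C, x ≠ 0 := fun x hx h => by
    have : ‖(q : K)‖ ≤ ‖x‖ := hx.2
    rw [h, norm_zero] at this
    linarith
  obtain ⟨T, hTC, hT⟩ := hC.elim_nhds_subcover (fun a => {x | a⁻¹ * x ∈ s}) fun a ha => by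
    have : Filter.Tendsto (fun x => a⁻¹ * x) (nhds a) (nhds 1) := by
      have := (continuous_const_mul a⁻¹).tendsto a
      rwa [inv_mul_cancel₀ (hC0 a ha)] at this
    exact this hs
  have hfin : (((fun a : K => if h : a = 0 then (1 : Kˣ ⧸ W) else (Units.mk0 a h : Kˣ)) ''
    (T : Set K))).Finite := T.finite_toSet.image _
  have huniv : (Set.univ : Set (Kˣ ⧸ W)) ⊆
      (fun a : K => if h : a = 0 then (1 : Kˣ ⧸ W) else (Units.mk0 a h : Kˣ)) '' (T : Set K) := by
    intro x _
    obtain ⟨u, rfl⟩ := QuotientGroup.mk_surjective x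
    obtain ⟨k, hk1, hk2⟩ := exists_mem_Ico_zpow (x := ‖(u : K)‖) (y := ‖(q : K)‖⁻¹)
      (norm_pos_iff.2 u.ne_zero) ((one_lt_inv₀ hq0).2 hq)
    have hmem : ((u * q ^ (k + 1) : Kˣ) : K) ∈ C := by
      rw [inv_zpow] at hk1 hk2
      have e : ‖((u * q ^ (k + 1) : Kˣ) : K)‖ = ‖(u : K)‖ * ‖(q : K)‖ ^ (k + 1) := by
        simp [norm_mul, norm_zpow]
      have p0 : 0 < ‖(q : K)‖ ^ (k + 1) := zpow_pos hq0 _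
      have p1 : 0 < ‖(q : K)‖ ^ k := zpow_pos hq0 _
      refine ⟨?_, ?_⟩
      · rw [mem_closedBall_zero_iff, e]
        rw [lt_inv_comm₀ (norm_pos_iff.2 u.ne_zero) p0] at hk2
        calc _ ≤ ‖(u : K)‖ * ‖(u : K)‖⁻¹ := by gcongr
          _ = 1 := mul_inv_cancel₀ (norm_ne_zero_iff.2 u.ne_zero)
      · rw [Set.mem_ofPred_eq, e, zpow_add_one₀ hq0.ne', ← mul_assoc]
        refine le_mul_of_one_le_left hq0.le ?_
        calc 1 = (‖(q : K)‖ ^ k)⁻¹ * ‖(q : K)‖ ^ k := (inv_mul_cancel₀ p1.ne').symm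
          _ ≤ _ := by gcongr
    obtain ⟨a, haT, ha⟩ := Set.mem_iUnion₂.1 (hT hmem)
    have ha0 := hC0 a (hTC a haT)
    refine ⟨a, haT, ?_⟩
    simp only [dif_neg ha0]
    refine QuotientGroup.eq.2 ?_
    have h1 : (Units.mk0 a ha0)⁻¹ * (u * q ^ (k + 1)) ∈ W := hsW _ (by simpa using ha)
    have := W.mul_mem h1 (W.inv_mem (W.zpow_mem hqW (k + 1)))
    simpa [mul_assoc] using this
  have : Finite (Kˣ ⧸ W) := Set.finite_univ_iff.1 (hfin.subset huniv)
  exact Subgroup.finiteIndex_of_finite_quotient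

section

open scoped Topology

/-- A field of finite degree over `ℚ_[p]`, Galois over a subfield, has arbitrarily small open
Galois-stable additive subgroups whose invariants are all traces. -/
theorem exists_open_galois_lattice (p : ℕ) [Fact p.Prime] (F K : Type) [Field F] [NormedField K]
    [NormedAlgebra ℚ_[p] K] [FiniteDimensional ℚ_[p] K] [IsUltrametricDist K] [Algebra ℚ_[p] F]
    [Algebra F K] [IsScalarTower ℚ_[p] F K] [FiniteDimensional F K] [IsGalois F K] {δ : ℝ} (hδ : 0 < δ) :
    ∃ Λ : AddSubgroup K, (Λ : Set K) ∈ 𝓝 (0 : K) ∧ (∀ t ∈ Λ, ‖t‖ < δ) ∧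
      (∀ (τ : K ≃ₐ[F] K), ∀ t ∈ Λ, τ t ∈ Λ) ∧
      ∀ t ∈ Λ, (∀ τ : K ≃ₐ[F] K, τ t = t) → ∃ s ∈ Λ, t = ∑ τ : K ≃ₐ[F] K, τ s := by
  classical
  let b := IsGalois.normalBasis F K
  have hb : ∀ τ, b τ = τ (b 1) := IsGalois.normalBasis_apply
  have hrep : ∀ (σ τ : K ≃ₐ[F] K) (t : K), b.repr (σ t) (σ * τ) = b.repr t τ := by
    intro σ τ t
    have h1 : σ t = ∑ τ, b.repr t (σ⁻¹ * τ) • b τ := by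
      conv_lhs => rw [← b.sum_repr t]
      rw [map_sum]
      refine Fintype.sum_equiv (Equiv.mulLeft σ) _ _ fun τ => ?_
      rw [map_smul, Equiv.coe_mulLeft, inv_mul_cancel_left, hb (σ * τ), hb τ]
      rfl
    conv_lhs => rw [h1, b.repr_sum_self]
    rw [inv_mul_cancel_left]
  let S : ℝ := ∑ τ, ‖b τ‖
  have hS : 0 ≤ S := Finset.sum_nonneg fun _ _ => norm_nonneg _
  let ε : ℝ := δ / (S + 1)
  have hε : 0 < ε := by positivity
  let Λ : AddSubgroup K :=
    { carrier := {t | ∀ τ, ‖algebraMap F K (b.repr t τ)‖ < ε}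
      zero_mem' := fun τ => by simpa using hε
      add_mem' := fun {x y} hx hy τ => by
        rw [map_add, Finsupp.add_apply, map_add]
        exact (IsUltrametricDist.norm_add_le_max _ _).trans_lt (max_lt (hx τ) (hy τ))
      neg_mem' := fun {x} hx τ => by
        rw [map_neg, Finsupp.neg_apply, map_neg, norm_neg]
        exact hx τ }
  have hmem : ∀ t, t ∈ Λ ↔ ∀ τ, ‖algebraMap F K (b.repr t τ)‖ < ε := fun t => Iff.rfl
  refine ⟨Λ, ?_, fun t ht => ?_, fun σ t ht τ => ?_, fun t ht hfix => ?_⟩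
  · have : (Λ : Set K) = ⋂ τ, {t | ‖algebraMap F K (b.repr t τ)‖ < ε} := by
      ext t; simp [hmem]
    rw [this]
    refine (Filter.iInter_mem).2 fun τ => ?_
    let ℓ : K →ₗ[F] K := (Algebra.linearMap F K).comp (b.coord τ)
    have hc : Continuous ℓ := (ℓ.restrictScalars ℚ_[p]).continuous_of_finiteDimensional
    have : IsOpen {t | ‖ℓ t‖ < ε} := isOpen_lt hc.norm continuous_const
    exact this.mem_nhds (by simpa using hε)
  · rw [← b.sum_repr t]
    calc _ ≤ ∑ τ, ‖b.repr t τ • b τ‖ := norm_sum_le _ _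
      _ ≤ ∑ τ, ε * ‖b τ‖ := by
        gcongr with τ
        rw [Algebra.smul_def, norm_mul]
        gcongr
        exact (ht τ).le
      _ = ε * S := by rw [Finset.mul_sum]
      _ < δ := by
        rw [div_mul_eq_mul_div, div_lt_iff₀ (by positivity)]
        linarith
  · have := hrep σ (σ⁻¹ * τ) t
    rw [mul_inv_cancel_left] at this
    rw [this]
    exact ht _
  · refine ⟨b.repr t 1 • b 1, fun τ => ?_, ?_⟩
    · rw [map_smul, b.repr_self, Finsupp.smul_apply, Finsupp.single_apply]
      split_ifs
      · simpa using ht 1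
      · simpa using hε
    · conv_lhs => rw [← b.sum_repr t]
      refine Finset.sum_congr rfl fun τ _ => ?_
      rw [map_smul, ← hb]
      have := hrep τ 1 t
      rw [hfix, mul_one] at this
      rw [this]

theorem index_range_norm_le (p : ℕ) [Fact p.Prime] (F K : Type) [Field F] [NormedField K]
    [NormedAlgebra ℚ_[p] K] [FiniteDimensional ℚ_[p] K] [IsUltrametricDist K] [Algebra ℚ_[p] F]
    [Algebra F K] [IsScalarTower ℚ_[p] F K] [FiniteDimensional F K] [IsGalois F K]
    [IsCyclic (K ≃ₐ[F] K)] :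
    (Units.map (Algebra.norm F : K →* F)).range.index ≠ 0 ∧
      (Units.map (Algebra.norm F : K →* F)).range.index ≤ Module.finrank F K := by
  classical
  have : ProperSpace K := FiniteDimensional.proper ℚ_[p] K
  have : CharZero K := charZero_of_injective_algebraMap (algebraMap ℚ_[p] K).injective
  obtain ⟨σ, hσ⟩ := IsCyclic.exists_generator (α := K ≃ₐ[F] K)
  obtain ⟨δ, hδ, hadd, hinj, hcomm, hopen⟩ := NormedSpace.exists_exp_radius p K
  obtain ⟨Λ, hΛ0, hΛδ, hΛσ, hΛtr⟩ := exists_open_galois_lattice p F K hδ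
  have hcont : ∀ τ : K ≃ₐ[F] K, Continuous τ := fun τ =>
    (τ.toLinearMap.restrictScalars ℚ_[p]).continuous_of_finiteDimensional
  have hexpτ : ∀ τ : K ≃ₐ[F] K, ∀ t ∈ Λ, τ (NormedSpace.exp t) = NormedSpace.exp (τ t) :=
    fun τ t ht => hcomm (τ : K →+* K) (hcont τ) t (hΛδ t ht)
  have hexp0 : ∀ t ∈ Λ, NormedSpace.exp t * NormedSpace.exp (-t) = 1 := fun t ht => by
    rw [← hadd _ _ (hΛδ _ ht) (hΛδ _ (Λ.neg_mem ht)), add_neg_cancel, NormedSpace.exp_zero]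
  let ι : Fˣ →* Kˣ := Units.map (algebraMap F K : F →* K)
  have hι : Function.Injective ι := Units.map_injective (algebraMap F K).injective
  let act : (K ≃ₐ[F] K) → Kˣ →* Kˣ := fun τ => Units.map (τ : K →* K)
  let D : Kˣ →* Kˣ := MonoidHom.id Kˣ / act σ
  let N : Kˣ →* Kˣ := ι.comp (Units.map (Algebra.norm F : K →* F))
  have hD : ∀ a, D a = a / act σ a := fun a => rfl
  have hact : ∀ τ f, act τ (ι f) = ι f := fun τ f => Units.ext (τ.commutes _)
  have hNprod : ∀ a, N a = ∏ τ, act τ a := fun a => by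
    refine Units.ext ?_
    rw [Units.coe_prod]
    exact Algebra.norm_eq_prod_automorphisms F (a : K)
  have hDker : D.ker = ι.range := by
    ext a
    rw [MonoidHom.mem_ker, hD, div_eq_one]
    constructor
    · intro h
      have h' : (a : K) ∈ (⊥ : IntermediateField F K) := by
        rw [← IsGalois.fixedField_top, IntermediateField.mem_fixedField_iff]
        intro τ _
        have : Subgroup.zpowers σ ≤ MulAction.stabilizer (K ≃ₐ[F] K) (a : K) := by
          rw [Subgroup.zpowers_le]
          exact (congrArg Units.val h).symm
        exact this (hσ τ)
      obtain ⟨f, hf⟩ := IntermediateField.mem_bot.1 h'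
      have hf0 : f ≠ 0 := fun h0 => a.ne_zero (by rw [← hf, h0, map_zero])
      exact ⟨Units.mk0 f hf0, Units.ext hf⟩
    · rintro ⟨f, rfl⟩
      rw [hact]
  have hDN : ∀ a, D (N a) = 1 := fun a => by
    have : N a ∈ D.ker := hDker ▸ ⟨_, rfl⟩
    exact this
  have hND : N.ker = D.range := by
    ext a
    constructor
    · intro h
      have h1 : Algebra.norm F (a : K) = 1 := by
        have : ι (Units.map (Algebra.norm F : K →* F) a) = ι 1 := by rw [map_one]; exact h
        exact congrArg Units.val (hι this)
      obtain ⟨y, hy⟩ := groupCohomology.exists_div_of_norm_eq_one hσ h1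
      refine ⟨y, Units.ext ?_⟩
      rw [← hy, hD, Units.val_div_eq_div_val]
      rfl
    · rintro ⟨a, rfl⟩
      rw [MonoidHom.mem_ker, hD, map_div, div_eq_one, hNprod, hNprod]
      exact (Fintype.prod_equiv (Equiv.mulRight σ) _ _ fun τ => rfl).symm
  let V : Subgroup Kˣ :=
    { carrier := {u | ∃ t ∈ Λ, NormedSpace.exp t = (u : K)}
      one_mem' := ⟨0, Λ.zero_mem, by rw [NormedSpace.exp_zero, Units.val_one]⟩
      mul_mem' := by
        rintro a b ⟨s, hs, hs'⟩ ⟨t, ht, ht'⟩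
        exact ⟨s + t, Λ.add_mem hs ht, by
          rw [hadd _ _ (hΛδ _ hs) (hΛδ _ ht), hs', ht', Units.val_mul]⟩
      inv_mem' := by
        rintro a ⟨s, hs, hs'⟩
        refine ⟨-s, Λ.neg_mem hs, ?_⟩
        rw [Units.val_inv_eq_inv_val, ← hs']
        exact eq_inv_of_mul_eq_one_right (hexp0 s hs) }
  have hp0 : (p : F) ≠ 0 := by
    have : CharZero F := charZero_of_injective_algebraMap (algebraMap ℚ_[p] F).injective
    exact_mod_cast (Fact.out : p.Prime).ne_zero
  let q : Fˣ := Units.mk0 (p : F) hp0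
  let W : Subgroup Kˣ := V ⊔ Subgroup.zpowers (ι q)
  have hWact : ∀ τ, ∀ a ∈ W, act τ a ∈ W := by
    intro τ a ha
    obtain ⟨v, ⟨t, ht, ht'⟩, _, ⟨k, rfl⟩, rfl⟩ := Subgroup.mem_sup.1 ha
    rw [map_mul]
    refine Subgroup.mul_mem_sup ⟨τ t, hΛσ τ t ht, ?_⟩ ⟨k, ?_⟩
    · rw [← hexpτ τ t ht, ht']; rfl
    · simp only [map_zpow, hact]
  have hqn : ‖((ι q : Kˣ) : K)‖ < 1 := by
    have : ((ι q : Kˣ) : K) = algebraMap ℚ_[p] K (p : ℚ_[p]) := by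
      change algebraMap F K (p : F) = _
      rw [map_natCast, map_natCast]
    rw [this, norm_algebraMap']
    exact Padic.norm_p_lt_one
  have hWfin : W.FiniteIndex := W.finiteIndex_units_of_mem_nhds (hopen _ hΛ0)
    (fun u ⟨t, ht, hu⟩ => Subgroup.mem_sup_left ⟨t, ht, hu⟩) hqn
    (Subgroup.mem_sup_right (Subgroup.mem_zpowers _))
  have hWD : W.map D ≤ W := by
    rintro _ ⟨a, ha, rfl⟩
    exact W.div_mem ha (hWact σ a ha)
  have hWN : W.map N ≤ W := by
    rintro _ ⟨a, ha, rfl⟩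
    rw [hNprod]
    exact W.prod_mem fun τ _ => hWact τ a ha
  have hqd : ι q ^ Module.finrank F K ∈ W.map N := by
    refine ⟨ι q, Subgroup.mem_sup_right (Subgroup.mem_zpowers _), ?_⟩
    change ι (Units.map (Algebra.norm F : K →* F) (ι q)) = _
    rw [← map_pow]
    congr 1
    exact Units.ext (Algebra.norm_algebraMap _)
  have hle : W ⊓ D.ker ≤ W.map N ⊔ Subgroup.zpowers (ι q) := by
    rintro a ⟨ha, haD⟩
    obtain ⟨v, ⟨t, ht, ht'⟩, _, ⟨k, rfl⟩, rfl⟩ := Subgroup.mem_sup.1 ha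
    refine Subgroup.mul_mem_sup ?_ ⟨k, rfl⟩
    have hv : v ∈ ι.range := by
      rw [SetLike.mem_coe, hDker] at haD
      have hk : ι q ^ k ∈ ι.range := ⟨q ^ k, map_zpow ι q k⟩
      exact (Subgroup.mul_mem_cancel_right _ hk).1 haD
    obtain ⟨f, rfl⟩ := hv
    have htfix : ∀ τ : K ≃ₐ[F] K, τ t = t := fun τ => by
      refine hinj _ _ (hΛδ _ (hΛσ τ t ht)) (hΛδ _ ht) ?_
      rw [← hexpτ τ t ht, ht']
      exact τ.commutes f
    obtain ⟨s, hs, hst⟩ := hΛtr t ht htfix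
    have hexps : NormedSpace.exp s ≠ 0 := fun h => by
      have := hexp0 s hs
      rw [h, zero_mul] at this
      exact zero_ne_one this
    refine ⟨Units.mk0 _ hexps, Subgroup.mem_sup_left ⟨s, hs, rfl⟩, ?_⟩
    rw [hNprod]
    refine Units.ext ?_
    rw [← ht', hst, Units.coe_prod]
    have : ∀ T : Finset (K ≃ₐ[F] K), (∑ τ ∈ T, τ s ∈ Λ) ∧
        NormedSpace.exp (∑ τ ∈ T, τ s) = ∏ τ ∈ T, τ (NormedSpace.exp s) := by
      intro T
      induction T using Finset.induction_on with
      | empty => simp [Λ.zero_mem, NormedSpace.exp_zero]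
      | insert τ T hτ ih =>
        rw [Finset.sum_insert hτ, Finset.prod_insert hτ, ← ih.2, hexpτ τ s hs]
        exact ⟨Λ.add_mem (hΛσ τ s hs) ih.1, hadd _ _ (hΛδ _ (hΛσ τ s hs)) (hΛδ _ ih.1)⟩
    exact (this Finset.univ).2.symm
  have hdpos : 0 < Module.finrank F K := Module.finrank_pos
  have hdvd := Subgroup.relIndex_sup_zpowers_dvd (W.map N) hqd
  have hne : (W.map N).relIndex (W.map N ⊔ Subgroup.zpowers (ι q)) ≠ 0 := fun h => by
    rw [h, zero_dvd_iff] at hdvd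
    omega
  have hle2 := (Subgroup.relIndex_le_of_le_right hle hne).trans (Nat.le_of_dvd hdpos hdvd)
  have hne2 : (W.map N).relIndex (W ⊓ D.ker) ≠ 0 := fun h =>
    hne (Subgroup.relIndex_eq_zero_of_le_right hle h)
  have key := Subgroup.relIndex_range_ker_le D N hDN hND W hWD hWN hne2
  have hidx : N.range.relIndex D.ker = (Units.map (Algebra.norm F : K →* F)).range.index := by
    rw [hDker, MonoidHom.range_comp, MonoidHom.range_eq_map ι,
      Subgroup.relIndex_map_map_of_injective _ _ hι, Subgroup.relIndex_top_right]
  rw [hidx] at key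
  exact ⟨key.1, key.2.trans hle2⟩

end

section CochainClass

variable (G A : Type*) [Group G] [CommGroup A] [MulDistribMulAction G A]

/-- The coboundary map from 1-cochains to 2-cochains. -/
def twoCoboundary : (G → A) →* (G → G → A) where
  toFun b g h := b g * g • b h / b (g * h)
  map_one' := by
    funext g h
    simp
  map_mul' b b' := by
    funext g h
    simp only [Pi.mul_apply, smul_mul', div_eq_mul_inv, mul_inv]
    simp only [mul_assoc, mul_left_comm]

/-- 2-cochains modulo 2-coboundaries. -/
abbrev TwoCochainClass : Type _ := (G → G → A) ⧸ (twoCoboundary G A).range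

instance : CommGroup (TwoCochainClass G A) := QuotientGroup.Quotient.commGroup _

end CochainClass

section CharCarry

variable {G : Type*} [Group G] {M : ℕ}

/-- The representative in `[0, M)` of the value of a character. -/
def charVal (χ : G →* Multiplicative (ZMod M)) (g : G) : ℕ := (χ g).toAdd.val

/-- The 2-cocycle with values in `ℤ` attached to a lift `u` of a character to `ℤ`. -/
def liftCarry (M : ℕ) (u : G → ℤ) (g h : G) : ℤ := (u g + u h - u (g * h)) / M

theorem charVal_cast [NeZero M] (χ : G →* Multiplicative (ZMod M)) (g : G) :
    ((charVal χ g : ℕ) : ZMod M) = (χ g).toAdd := ZMod.natCast_zmod_val _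

theorem mul_liftCarry [NeZero M] (χ : G →* Multiplicative (ZMod M)) {u : G → ℤ}
    (hu : ∀ g, (u g : ZMod M) = (χ g).toAdd) (g h : G) :
    (M : ℤ) * liftCarry M u g h = u g + u h - u (g * h) := by
  refine Int.mul_ediv_cancel' ((ZMod.intCast_zmod_eq_zero_iff_dvd _ M).1 ?_)
  push_cast
  rw [hu, hu, hu, map_mul, toAdd_mul, sub_self]

/-- The cup product of the connecting image of a character with elements of the coefficients. -/
def charCup {A B : Type*} [CommGroup A] [CommGroup B] [MulDistribMulAction G A] (ι : B →* A)
    (χ : G →* Multiplicative (ZMod M)) : B →* TwoCochainClass G A :=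
  (QuotientGroup.mk' _).comp
    { toFun := fun y g h => ι y ^ liftCarry M (fun g => (charVal χ g : ℤ)) g h
      map_one' := by funext g h; simp
      map_mul' := fun y z => by funext g h; simp [mul_zpow] }

variable {A B : Type*} [CommGroup A] [CommGroup B] [MulDistribMulAction G A] (ι : B →* A)

theorem charCup_eq_of_lift [NeZero M] (hι : ∀ (g : G) b, g • ι b = ι b)
    (χ : G →* Multiplicative (ZMod M)) {u : G → ℤ} (hu : ∀ g, (u g : ZMod M) = (χ g).toAdd) (y : B) :
    charCup ι χ y = ((fun g h => ι y ^ liftCarry M u g h : G → G → A) : TwoCochainClass G A) := by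
  have hM : (M : ℤ) ≠ 0 := by exact_mod_cast NeZero.ne M
  have hv : ∀ g, (((charVal χ g : ℕ) : ℤ) : ZMod M) = (χ g).toAdd := fun g => by
    rw [Int.cast_natCast, charVal_cast]
  have hd : ∀ g, ∃ k : ℤ, u g - charVal χ g = M * k := fun g =>
    (ZMod.intCast_zmod_eq_zero_iff_dvd _ M).1 (by rw [Int.cast_sub, hu, hv, sub_self])
  choose k hk using hd
  refine QuotientGroup.eq.2 ⟨fun g => ι y ^ k g, ?_⟩
  funext g h
  change ι y ^ k g * g • ι y ^ k h / ι y ^ k (g * h) =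
    (ι y ^ liftCarry M (fun g => (charVal χ g : ℤ)) g h)⁻¹ * ι y ^ liftCarry M u g h
  rw [smul_zpow', hι, ← zpow_add, div_eq_mul_inv, ← zpow_sub, ← zpow_neg, ← zpow_add]
  congr 1
  refine mul_left_cancel₀ hM ?_
  have h1 := mul_liftCarry χ hu g h
  have h2 := mul_liftCarry χ hv g h
  have h3 := hk g
  have h4 := hk h
  have h5 := hk (g * h)
  linear_combination h2 - h1 - h3 - h4 + h5

theorem charCup_mul [NeZero M] (hι : ∀ (g : G) b, g • ι b = ι b)
    (χ χ' : G →* Multiplicative (ZMod M)) (y : B) :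
    charCup ι (χ * χ') y = charCup ι χ y * charCup ι χ' y := by
  have hv : ∀ (χ : G →* Multiplicative (ZMod M)) g,
      (((charVal χ g : ℕ) : ℤ) : ZMod M) = (χ g).toAdd := fun χ g => by
    rw [Int.cast_natCast, charVal_cast]
  have hM : (M : ℤ) ≠ 0 := by exact_mod_cast NeZero.ne M
  have hu : ∀ g, (((charVal χ g : ℤ) + charVal χ' g : ℤ) : ZMod M) = ((χ * χ') g).toAdd :=
    fun g => by
      rw [Int.cast_add, hv, hv]; rfl
  rw [charCup_eq_of_lift ι hι _ hu]
  refine congrArg (QuotientGroup.mk' _) ?_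
  funext g h
  change ι y ^ liftCarry M (fun g => (charVal χ g + charVal χ' g : ℤ)) g h =
    ι y ^ liftCarry M (fun g => (charVal χ g : ℤ)) g h * ι y ^ liftCarry M (fun g => (charVal χ' g : ℤ)) g h
  rw [← zpow_add]
  congr 1
  refine mul_left_cancel₀ hM ?_
  have h1 := mul_liftCarry _ hu g h
  have h2 := mul_liftCarry χ (hv χ) g h
  have h3 := mul_liftCarry χ' (hv χ') g h
  linear_combination h1 - h2 - h3

/-- The cup product as a bilinear map. -/
def charCupHom [NeZero M] (hι : ∀ (g : G) b, g • ι b = ι b) :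
    (G →* Multiplicative (ZMod M)) →* (B →* TwoCochainClass G A) :=
  MonoidHom.mk' (charCup ι) fun χ χ' => MonoidHom.ext (charCup_mul ι hι χ χ')

end CharCarry

theorem exists_charVal_step {G : Type*} [Group G] {M : ℕ} [NeZero M]
    (χ : G →* Multiplicative (ZMod M)) :
    ∃ (e d : ℕ) (σ : G) (j : G → ℕ), e * d = M ∧ 0 < d ∧ (∀ g, charVal χ g = e * j g) ∧
      (∀ g, j g < d) ∧ (χ σ).toAdd = (e : ZMod M) := by
  classical
  have hM : 0 < M := NeZero.pos M
  have hex : ∃ m : ℕ, 0 < m ∧ ∃ g, (χ g).toAdd = (m : ZMod M) :=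
    ⟨M, hM, 1, by simp⟩
  obtain ⟨he0, σ, hσ⟩ := Nat.find_spec hex
  set e := Nat.find hex with he
  have hdvd : ∀ m : ℕ, (∃ g, (χ g).toAdd = (m : ZMod M)) → e ∣ m := by
    rintro m ⟨g, hg⟩
    by_contra hm
    have h0 : 0 < m % e := Nat.pos_of_ne_zero fun h => hm (Nat.dvd_of_mod_eq_zero h)
    refine Nat.find_min hex (Nat.mod_lt m he0) ⟨h0, g * (σ ^ (m / e))⁻¹, ?_⟩
    rw [map_mul, map_inv, map_pow, toAdd_mul, toAdd_inv, toAdd_pow, hσ, hg]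
    have : (m : ZMod M) = ((m % e + e * (m / e) : ℕ) : ZMod M) := by rw [Nat.mod_add_div]
    rw [this]
    push_cast
    rw [nsmul_eq_mul]
    ring
  obtain ⟨d, hd⟩ := hdvd M ⟨1, by simp⟩
  have hj : ∀ g, ∃ k, charVal χ g = e * k := fun g => hdvd _ ⟨g, (charVal_cast χ g).symm⟩
  choose j hj using hj
  refine ⟨e, d, σ, j, hd.symm, ?_, hj, fun g => ?_, hσ⟩
  · refine Nat.pos_of_ne_zero fun h => ?_
    rw [h, mul_zero] at hd
    omega
  · refine lt_of_mul_lt_mul_left (a := e) ?_ (Nat.zero_le _)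
    rw [← hj, ← hd]
    exact ZMod.val_lt _

section NormLemma

variable {F Ω : Type} [Field F] [Field Ω] [Algebra F Ω] {M : ℕ}

/-- The field cut out by a character of a Galois group. -/
abbrev charField (χ : (Ω ≃ₐ[F] Ω) →* Multiplicative (ZMod M)) : IntermediateField F Ω :=
  IntermediateField.fixedField χ.ker

theorem mem_charField {χ : (Ω ≃ₐ[F] Ω) →* Multiplicative (ZMod M)} {x : Ω} :
    x ∈ charField χ ↔ ∀ g, χ g = 1 → g x = x :=
  IntermediateField.mem_fixedField_iff _ _

theorem apply_eq_of_mem_charField {χ : (Ω ≃ₐ[F] Ω) →* Multiplicative (ZMod M)} {x : Ω}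
    (hx : x ∈ charField χ) {g h : Ω ≃ₐ[F] Ω} (hgh : χ g = χ h) : g x = h x := by
  have h1 : (h⁻¹ * g) x = x := mem_charField.1 hx _ (by rw [map_mul, hgh, map_inv, inv_mul_cancel])
  calc g x = (h * (h⁻¹ * g)) x := by rw [mul_inv_cancel_left]
    _ = h ((h⁻¹ * g) x) := rfl
    _ = h x := by rw [h1]

variable [FiniteDimensional F Ω] [IsGalois F Ω]

theorem restrictNormalHom_charField_eq_one_iff {χ : (Ω ≃ₐ[F] Ω) →* Multiplicative (ZMod M)}
    (g : Ω ≃ₐ[F] Ω) : AlgEquiv.restrictNormalHom (charField χ) g = 1 ↔ χ g = 1 := by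
  rw [← MonoidHom.mem_ker, IntermediateField.restrictNormalHom_ker,
    IntermediateField.fixingSubgroup_fixedField, MonoidHom.mem_ker]

theorem bijective_restrict_pow [NeZero M] {χ : (Ω ≃ₐ[F] Ω) →* Multiplicative (ZMod M)}
    {e d : ℕ} {σ : Ω ≃ₐ[F] Ω} {j : (Ω ≃ₐ[F] Ω) → ℕ} (hed : e * d = M)
    (hj : ∀ g, charVal χ g = e * j g) (hjd : ∀ g, j g < d) (hσ : (χ σ).toAdd = (e : ZMod M)) :
    Function.Bijective fun i : Fin d => AlgEquiv.restrictNormalHom (charField χ) σ ^ (i : ℕ) := by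
  have hpow : ∀ i : ℕ, (χ (σ ^ i)).toAdd = ((e * i : ℕ) : ZMod M) := fun i => by
    rw [map_pow, toAdd_pow, hσ, nsmul_eq_mul]
    push_cast
    ring
  have he0 : 0 < e := Nat.pos_of_ne_zero fun h => NeZero.ne M (by rw [← hed, h, zero_mul])
  refine ⟨fun a b hab => ?_, fun τ => ?_⟩
  · have h1 : AlgEquiv.restrictNormalHom (charField χ) (σ ^ (a : ℕ) * (σ ^ (b : ℕ))⁻¹) = 1 := by
      rw [map_mul, map_inv, map_pow, map_pow]
      exact mul_inv_eq_one.2 hab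
    rw [restrictNormalHom_charField_eq_one_iff, map_mul, map_inv, mul_inv_eq_one] at h1
    have h2 : ((e * a : ℕ) : ZMod M) = ((e * b : ℕ) : ZMod M) := by
      rw [← hpow, ← hpow, h1]
    rw [ZMod.natCast_eq_natCast_iff] at h2
    have lt : ∀ i : Fin d, e * (i : ℕ) < M := fun i => by
      rw [← hed]; exact Nat.mul_lt_mul_of_pos_left i.2 he0
    have := h2.eq_of_lt_of_lt (lt a) (lt b)
    exact Fin.ext (Nat.eq_of_mul_eq_mul_left he0 this)
  · obtain ⟨g, rfl⟩ := AlgEquiv.restrictNormalHom_surjective Ω τ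
    refine ⟨⟨j g, hjd g⟩, ?_⟩
    have h1 : χ (σ ^ j g * g⁻¹) = 1 := by
      rw [map_mul, map_inv, mul_inv_eq_one]
      refine Multiplicative.toAdd.injective ?_
      rw [hpow, ← hj, charVal_cast]
    rw [← restrictNormalHom_charField_eq_one_iff, map_mul, map_inv, map_pow] at h1
    exact mul_inv_eq_one.1 h1

theorem algebraMap_norm_charField [NeZero M] {χ : (Ω ≃ₐ[F] Ω) →* Multiplicative (ZMod M)}
    {e d : ℕ} {σ : Ω ≃ₐ[F] Ω} {j : (Ω ≃ₐ[F] Ω) → ℕ} (hed : e * d = M)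
    (hj : ∀ g, charVal χ g = e * j g) (hjd : ∀ g, j g < d) (hσ : (χ σ).toAdd = (e : ZMod M))
    (t : charField χ) :
    algebraMap F Ω (Algebra.norm F t) = ∏ i ∈ Finset.range d, (σ ^ i) (t : Ω) := by
  have hbij := bijective_restrict_pow hed hj hjd hσ
  have h1 := congrArg (algebraMap (charField χ) Ω) (Algebra.norm_eq_prod_automorphisms F t)
  rw [← IsScalarTower.algebraMap_apply] at h1
  rw [h1, ← hbij.prod_comp, map_prod, Finset.prod_range]
  refine Finset.prod_congr rfl fun i _ => ?_
  rw [← map_pow]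
  exact AlgEquiv.restrictNormal_commutes _ _ _

theorem isCyclic_aut_charField [NeZero M] (χ : (Ω ≃ₐ[F] Ω) →* Multiplicative (ZMod M)) :
    IsCyclic (charField χ ≃ₐ[F] charField χ) := by
  obtain ⟨e, d, σ, j, hed, hd, hj, hjd, hσ⟩ := exists_charVal_step χ
  refine ⟨AlgEquiv.restrictNormalHom (charField χ) σ, fun τ => ?_⟩
  obtain ⟨i, hi⟩ := (bijective_restrict_pow hed hj hjd hσ).2 τ
  exact ⟨(i : ℕ), by rw [← hi]; simp⟩

end NormLemma

section NormLemma

variable {F Ω : Type} [Field F] [Field Ω] [Algebra F Ω] {M : ℕ}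

theorem smul_units_map_algebraMap (g : Ω ≃ₐ[F] Ω) (b : Fˣ) :
    g • Units.map (algebraMap F Ω : F →* Ω) b = Units.map (algebraMap F Ω : F →* Ω) b :=
  Units.ext (g.commutes b)

theorem mul_charCarry_eq [NeZero M] {χ : (Ω ≃ₐ[F] Ω) →* Multiplicative (ZMod M)}
    {e d : ℕ} {j : (Ω ≃ₐ[F] Ω) → ℕ} (hed : e * d = M) (hj : ∀ g, charVal χ g = e * j g)
    (g h : Ω ≃ₐ[F] Ω) :
    (d : ℤ) * liftCarry M (fun g => (charVal χ g : ℤ)) g h = j g + j h - j (g * h) := by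
  have he0 : (e : ℤ) ≠ 0 := by
    rintro h
    refine NeZero.ne M ?_
    rw [← hed, Int.natCast_eq_zero.1 h, zero_mul]
  have := mul_liftCarry χ (u := fun g => (charVal χ g : ℤ))
    (fun g => by rw [Int.cast_natCast, charVal_cast]) g h
  refine mul_left_cancel₀ he0 ?_
  rw [← mul_assoc, show (e : ℤ) * d = M by exact_mod_cast hed, this]
  simp only [hj]
  push_cast
  ring

variable [FiniteDimensional F Ω] [IsGalois F Ω]

theorem charCup_eq_one_of_norm [NeZero M] (χ : (Ω ≃ₐ[F] Ω) →* Multiplicative (ZMod M)) (y : Fˣ)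
    (t : charField χ) (ht : Algebra.norm F t = y) :
    charCup (Units.map (algebraMap F Ω : F →* Ω)) χ y = 1 := by
  obtain ⟨e, d, σ, j, hed, hd, hj, hjd, hσ⟩ := exists_charVal_step χ
  have ht0 : (t : Ω) ≠ 0 := fun h => by
    have : t = 0 := Subtype.ext h
    rw [this, Algebra.norm_zero] at ht
    exact y.ne_zero ht.symm
  have hχσ : ∀ i : ℕ, (χ (σ ^ i)).toAdd = ((e * i : ℕ) : ZMod M) := fun i => by
    rw [map_pow, toAdd_pow, hσ, nsmul_eq_mul]
    push_cast
    ring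
  let T : Ωˣ := Units.mk0 (t : Ω) ht0
  have hT : ∀ g h : Ω ≃ₐ[F] Ω, χ g = χ h → g • T = h • T := fun g h hgh =>
    Units.ext (apply_eq_of_mem_charField t.2 hgh)
  let P : ℕ → Ωˣ := fun i => ∏ k ∈ Finset.range i, σ ^ k • T
  have hPd : P d = Units.map (algebraMap F Ω : F →* Ω) y := by
    refine Units.ext ?_
    rw [Units.coe_prod]
    change _ = algebraMap F Ω y
    rw [← ht, algebraMap_norm_charField hed hj hjd hσ]
    rfl
  have hPadd : ∀ (g : Ω ≃ₐ[F] Ω) (m i : ℕ), (χ g).toAdd = ((e * m : ℕ) : ZMod M) →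
      P m * g • P i = P (m + i) := by
    intro g m i hg
    change _ = ∏ k ∈ Finset.range (m + i), σ ^ k • T
    rw [Finset.prod_range_add]
    change P m * g • (∏ k ∈ Finset.range i, σ ^ k • T) = P m * _
    rw [Finset.smul_prod']
    congr 1
    refine Finset.prod_congr rfl fun k _ => ?_
    rw [smul_smul]
    refine hT _ _ (Multiplicative.toAdd.injective ?_)
    rw [map_mul, toAdd_mul, hg, hχσ, hχσ]
    push_cast
    ring
  refine (QuotientGroup.eq_one_iff _).2 ⟨fun g => P (j g), ?_⟩
  funext g h
  change P (j g) * g • P (j h) / P (j (g * h)) =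
    Units.map (algebraMap F Ω : F →* Ω) y ^ liftCarry M (fun g => (charVal χ g : ℤ)) g h
  rw [hPadd g _ _ (by rw [← hj, charVal_cast]), ← hPd]
  have hc := mul_charCarry_eq hed hj g h
  set c := liftCarry M (fun g => (charVal χ g : ℤ)) g h
  have b1 := hjd g
  have b2 := hjd h
  have b3 := hjd (g * h)
  have c0 : -1 < c := by
    by_contra hcon
    have : (d : ℤ) * c ≤ d * (-1) := by gcongr; omega
    omega
  have c1 : c < 2 := by
    by_contra hcon
    have : (d : ℤ) * 2 ≤ d * c := by gcongr; omega
    omega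
  obtain hc' | hc' : c = 0 ∨ c = 1 := by omega
  · rw [hc', zpow_zero, div_eq_one]
    congr 1
    rw [hc'] at hc
    omega
  · rw [hc', zpow_one]
    rw [hc'] at hc
    have : j g + j h = d + j (g * h) := by omega
    rw [this, ← hPadd 1 d _ (by rw [hed]; simp), one_smul, mul_div_cancel_right]

theorem exists_norm_of_charCup_eq_one [NeZero M] (χ : (Ω ≃ₐ[F] Ω) →* Multiplicative (ZMod M))
    (y : Fˣ) (hy : charCup (Units.map (algebraMap F Ω : F →* Ω)) χ y = 1) :
    ∃ t : charField χ, Algebra.norm F t = y := by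
  obtain ⟨e, d, σ, j, hed, hd, hj, hjd, hσ⟩ := exists_charVal_step χ
  obtain ⟨b, hb⟩ := (QuotientGroup.eq_one_iff _).1 hy
  have he0 : 0 < e := Nat.pos_of_ne_zero fun h => NeZero.ne M (by rw [← hed, h, zero_mul])
  have hχσ : ∀ i : ℕ, (χ (σ ^ i)).toAdd = ((e * i : ℕ) : ZMod M) := fun i => by
    rw [map_pow, toAdd_pow, hσ, nsmul_eq_mul]
    push_cast
    ring
  let ι := Units.map (algebraMap F Ω : F →* Ω)
  have hb' : ∀ g h, b g * g • b h / b (g * h) =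
      ι y ^ liftCarry M (fun g => (charVal χ g : ℤ)) g h := fun g h => congrFun (congrFun hb g) h
  have hdc := mul_charCarry_eq hed hj
  have hd0 : (d : ℤ) ≠ 0 := by omega
  have hjker : ∀ g, χ g = 1 → j g = 0 := fun g hg => by
    have := hj g
    rw [charVal, hg, toAdd_one, ZMod.val_zero] at this
    exact (Nat.mul_eq_zero.1 this.symm).resolve_left he0.ne'
  have hjeq : ∀ g h, χ g = χ h → j g = j h := fun g h hgh => by
    refine Nat.eq_of_mul_eq_mul_left he0 ?_
    rw [← hj, ← hj, charVal, charVal, hgh]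
  have hjσ : ∀ i, i < d → j (σ ^ i) = i := fun i hi => by
    refine Nat.eq_of_mul_eq_mul_left he0 ?_
    rw [← hj, charVal, hχσ, ZMod.val_cast_of_lt]
    rw [← hed]
    exact Nat.mul_lt_mul_of_pos_left hi he0
  have hχσd : χ (σ ^ d) = 1 := Multiplicative.toAdd.injective (by rw [hχσ, hed]; simp)
  -- kill the restriction of `b` to the kernel
  obtain ⟨β, hβ⟩ : ∃ β : Ωˣ, ∀ g, χ g = 1 → g • β / β = b g := by
    have hker : ∀ h : Ω ≃ₐ[charField χ] Ω, χ (h.restrictScalars F) = 1 := fun h => by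
      rw [← MonoidHom.mem_ker, ← IntermediateField.fixingSubgroup_fixedField χ.ker]
      exact fun x => h.commutes x
    obtain ⟨β, hβ⟩ := groupCohomology.isMulCoboundary₁_of_isMulCocycle₁_of_aut_to_units
      (K := charField χ) (L := Ω) (fun h => b (h.restrictScalars F)) fun g h => by
        have h1 := hb' (g.restrictScalars F) (h.restrictScalars F)
        have h2 : liftCarry M (fun g => (charVal χ g : ℤ)) (g.restrictScalars F)
            (h.restrictScalars F) = 0 := by
          refine mul_left_cancel₀ hd0 ?_
          rw [hdc, hjker _ (hker g), hjker _ (hker h), hjker _ (by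
            rw [map_mul, hker, hker, one_mul])]
          simp
        rw [h2, zpow_zero, div_eq_one, mul_comm] at h1
        exact h1.symm
    refine ⟨β, fun g hg => ?_⟩
    have hg' : g ∈ (charField χ).fixingSubgroup := by
      rw [IntermediateField.fixingSubgroup_fixedField]; exact hg
    exact hβ (IntermediateField.fixingSubgroupEquiv _ ⟨g, hg'⟩)
  let a : (Ω ≃ₐ[F] Ω) → Ωˣ := fun g => b g * β / g • β
  have ha : ∀ g h, a g * g • a h =
      ι y ^ liftCarry M (fun g => (charVal χ g : ℤ)) g h * a (g * h) := by
    intro g h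
    rw [← hb' g h]
    change b g * β / g • β * g • (b h * β / h • β) = _ * (b (g * h) * β / (g * h) • β)
    rw [smul_div', smul_mul', smul_smul, div_mul_div_comm, div_mul_div_comm, div_eq_div_iff_mul_eq_mul]
    simp only [mul_comm, mul_left_comm, mul_assoc]
  have haker : ∀ g, χ g = 1 → a g = 1 := fun g hg => by
    change b g * β / g • β = 1
    rw [← hβ g hg, div_mul_cancel, div_self']
  have hcarry0 : ∀ g h, χ g = 1 ∨ χ h = 1 →
      liftCarry M (fun g => (charVal χ g : ℤ)) g h = 0 := by
    intro g h hgh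
    refine mul_left_cancel₀ hd0 ?_
    rw [hdc]
    rcases hgh with hg | hh
    · rw [hjker g hg, hjeq (g * h) h (by rw [map_mul, hg, one_mul])]; simp
    · rw [hjker h hh, hjeq (g * h) g (by rw [map_mul, hh, mul_one])]; simp
  have hamem : ∀ g h, χ h = 1 → h • a g = a g := by
    intro g h hh
    have h1 := ha h g
    rw [haker h hh, one_mul, hcarry0 h g (Or.inl hh), zpow_zero, one_mul] at h1
    have hh' : χ (g⁻¹ * h * g) = 1 := by
      rw [map_mul, map_mul, hh, mul_one, map_inv, inv_mul_cancel]
    have h2 := ha g (g⁻¹ * h * g)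
    rw [haker _ hh', smul_one, mul_one, hcarry0 _ _ (Or.inr hh'), zpow_zero, one_mul,
      ← mul_assoc, mul_inv_cancel_left] at h2
    rw [h1, ← h2]
  rcases (Nat.lt_or_ge 1 d) with hd1 | hd1
  · refine ⟨⟨(a σ : Ω), mem_charField.2 fun h hh => congrArg Units.val (hamem σ h hh)⟩, ?_⟩
    refine (algebraMap F Ω).injective ?_
    rw [algebraMap_norm_charField hed hj hjd hσ]
    have hprod : ∀ i, i < d → ∏ k ∈ Finset.range i, σ ^ k • a σ = a (σ ^ i) := by
      intro i
      induction i with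
      | zero => intro _; rw [pow_zero, haker 1 (map_one χ)]; simp
      | succ i ih =>
        intro hi
        rw [Finset.prod_range_succ, ih (by omega), ha, ← pow_succ]
        have : liftCarry M (fun g => (charVal χ g : ℤ)) (σ ^ i) σ = 0 := by
          refine mul_left_cancel₀ hd0 ?_
          have h1 := hjσ 1 hd1
          rw [pow_one] at h1
          rw [hdc, ← pow_succ, hjσ i (by omega), h1, hjσ _ hi]
          push_cast
          ring
        rw [this, zpow_zero, one_mul]
    have hfull : ∏ k ∈ Finset.range d, σ ^ k • a σ = ι y := by
      obtain ⟨m, rfl⟩ : ∃ m, d = m + 1 := ⟨d - 1, by omega⟩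
      rw [Finset.prod_range_succ, hprod m (by omega), ha, ← pow_succ, haker _ hχσd, mul_one]
      have : liftCarry M (fun g => (charVal χ g : ℤ)) (σ ^ m) σ = 1 := by
        refine mul_left_cancel₀ hd0 ?_
        have h1 := hjσ 1 hd1
        rw [pow_one] at h1
        rw [hdc, ← pow_succ, hjσ m (by omega), h1, hjker _ hχσd]
        push_cast
        ring
      rw [this, zpow_one]
    have := congrArg Units.val hfull
    rw [Units.coe_prod] at this
    exact this
  · obtain rfl : d = 1 := by omega
    refine ⟨algebraMap F _ y, ?_⟩
    refine (algebraMap F Ω).injective ?_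
    rw [algebraMap_norm_charField hed hj hjd hσ]
    simp

theorem charCup_eq_one_iff [NeZero M] (χ : (Ω ≃ₐ[F] Ω) →* Multiplicative (ZMod M)) (y : Fˣ) :
    charCup (Units.map (algebraMap F Ω : F →* Ω)) χ y = 1 ↔
      ∃ t : charField χ, Algebra.norm F t = y :=
  ⟨exists_norm_of_charCup_eq_one χ y, fun ⟨t, ht⟩ => charCup_eq_one_of_norm χ y t ht⟩

end NormLemma

theorem card_range_charCup_le (p : ℕ) [Fact p.Prime] {F Ω : Type} [Field F] [NormedField Ω]
    [Algebra ℚ_[p] F] [NormedAlgebra ℚ_[p] Ω] [Algebra F Ω] [IsScalarTower ℚ_[p] F Ω]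
    [FiniteDimensional ℚ_[p] Ω] [FiniteDimensional F Ω] [IsGalois F Ω] [IsUltrametricDist Ω]
    {M : ℕ} [NeZero M] (χ : (Ω ≃ₐ[F] Ω) →* Multiplicative (ZMod M)) :
    Nat.card (charCup (Units.map (algebraMap F Ω : F →* Ω)) χ).range ≠ 0 ∧
      Nat.card (charCup (Units.map (algebraMap F Ω : F →* Ω)) χ).range ≤ M := by
  let K := charField χ
  let _ : NormedAlgebra ℚ_[p] K :=
    { norm_smul_le := fun r x => norm_smul_le r (x : Ω) }
  have : FiniteDimensional ℚ_[p] K := FiniteDimensional.of_injective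
    ((K.val.restrictScalars ℚ_[p]).toLinearMap) K.val.injective
  have : IsUltrametricDist K := ⟨fun x y z => dist_triangle_max (x : Ω) y z⟩
  have := isCyclic_aut_charField χ
  have key := index_range_norm_le p F K
  have hker : (charCup (Units.map (algebraMap F Ω : F →* Ω)) χ).ker =
      (Units.map (Algebra.norm F : K →* F)).range := by
    ext y
    rw [MonoidHom.mem_ker, charCup_eq_one_iff]
    constructor
    · rintro ⟨t, ht⟩
      have ht0 : t ≠ 0 := fun h => by
        rw [h, Algebra.norm_zero] at ht
        exact y.ne_zero ht.symm
      exact ⟨Units.mk0 t ht0, Units.ext ht⟩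
    · rintro ⟨t, rfl⟩
      exact ⟨t, rfl⟩
  rw [← hker, Subgroup.index_ker] at key
  refine ⟨key.1, key.2.trans ?_⟩
  obtain ⟨e, d, σ, j, hed, hd, hj, hjd, hσ⟩ := exists_charVal_step χ
  rw [← IsGalois.card_aut_eq_finrank, ← Nat.card_eq_of_bijective _
    (bijective_restrict_pow hed hj hjd hσ), Nat.card_fin]
  exact Nat.le_of_dvd (NeZero.pos M) ⟨e, by rw [mul_comm, hed]⟩

section Residue

variable (L : Type*) [NormedField L] [IsUltrametricDist L]

/-- The closed unit ball of an ultrametric normed field. -/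
noncomputable def ballRing : ValuationSubring L := (NormedField.valuation (K := L)).valuationSubring

variable {L}

theorem mem_ballRing {x : L} : x ∈ ballRing L ↔ ‖x‖ ≤ 1 := by
  rw [ballRing, Valuation.mem_valuationSubring_iff, NormedField.valuation_apply]
  exact Iff.rfl

variable (L)

/-- The residue field of an ultrametric normed field. -/
abbrev ResField : Type _ := IsLocalRing.ResidueField (ballRing L)

variable {L}

theorem residue_eq_zero_iff_norm_lt (x : ballRing L) :
    IsLocalRing.residue (ballRing L) x = 0 ↔ ‖(x : L)‖ < 1 := by
  rw [IsLocalRing.residue_eq_zero_iff, IsLocalRing.mem_maximalIdeal, mem_nonunits_iff]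
  have hx : ‖(x : L)‖ ≤ 1 := mem_ballRing.1 x.2
  constructor
  · intro h
    refine hx.lt_of_ne fun h1 => h ?_
    have h0 : (x : L) ≠ 0 := fun h => by rw [h, norm_zero] at h1; exact zero_ne_one h1
    refine IsUnit.of_mul_eq_one (⟨(x : L)⁻¹, mem_ballRing.2 (by rw [norm_inv, h1, inv_one])⟩ :
      ballRing L) (Subtype.ext (mul_inv_cancel₀ h0))
  · rintro h ⟨u, rfl⟩
    have h1 : ((u : ballRing L) : L) * ((u⁻¹ : (ballRing L)ˣ) : ballRing L) = 1 :=
      congrArg Subtype.val u.mul_inv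
    have h2 := congrArg norm h1
    rw [norm_mul, norm_one] at h2
    have h3 : ‖(((u⁻¹ : (ballRing L)ˣ) : ballRing L) : L)‖ ≤ 1 :=
      mem_ballRing.1 ((u⁻¹ : (ballRing L)ˣ) : ballRing L).2
    have : ‖((u : ballRing L) : L)‖ * ‖(((u⁻¹ : (ballRing L)ˣ) : ballRing L) : L)‖ < 1 :=
      mul_lt_one_of_nonneg_of_lt_one_left (norm_nonneg _) h h3
    linarith

theorem residue_eq_iff_norm_sub_lt (x y : ballRing L) :
    IsLocalRing.residue (ballRing L) x = IsLocalRing.residue (ballRing L) y ↔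
      ‖(x : L) - y‖ < 1 := by
  rw [← sub_eq_zero, ← map_sub, residue_eq_zero_iff_norm_lt]
  rfl

instance finite_resField [ProperSpace L] : Finite (ResField L) := by
  classical
  obtain ⟨T, hT1, hT⟩ := (isCompact_closedBall (0 : L) 1).elim_nhds_subcover
    (fun a => Metric.ball a 1) fun a _ => Metric.ball_mem_nhds a one_pos
  have hfin := T.finite_toSet.image
    (fun a : L => if h : a ∈ ballRing L then IsLocalRing.residue (ballRing L) ⟨a, h⟩ else 0)
  refine Set.finite_univ_iff.1 (hfin.subset fun z _ => ?_)
  obtain ⟨x, rfl⟩ := IsLocalRing.residue_surjective z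
  obtain ⟨a, ha, hxa⟩ := Set.mem_iUnion₂.1
    (hT (show (x : L) ∈ Metric.closedBall 0 1 by simpa using mem_ballRing.1 x.2))
  have haB : a ∈ ballRing L := mem_ballRing.2 (by simpa using hT1 a ha)
  refine ⟨a, ha, ?_⟩
  simp only [dif_pos haB]
  rw [residue_eq_iff_norm_sub_lt, norm_sub_rev]
  simpa [dist_eq_norm] using hxa

theorem eq_of_residue_eq_of_pow_eq_one {m : ℕ} (hm : (m : ResField L) ≠ 0) {a b : ballRing L}
    (ha : a ^ m = 1) (hb : b ^ m = 1)
    (h : IsLocalRing.residue (ballRing L) a = IsLocalRing.residue (ballRing L) b) : a = b := by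
  by_contra hne
  have hu : IsUnit b := IsUnit.of_pow_eq_one hb fun h0 => hm (by rw [h0, Nat.cast_zero])
  obtain ⟨c, hc⟩ := hu.exists_right_inv
  have hsum : (∑ i ∈ Finset.range m, (a * c) ^ i) * (a * c - 1) = 0 := by
    rw [geom_sum_mul, mul_pow, ha, one_mul, sub_eq_zero]
    have := congrArg (· ^ m) hc
    simp only [mul_pow, hb, one_mul, one_pow] at this
    exact this
  have hsub : a * c - 1 ≠ 0 := fun h0 => hne (by
    have h1 : a * c = 1 := sub_eq_zero.1 h0
    calc a = a * (b * c) := by rw [hc, mul_one]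
      _ = b * (a * c) := by ring
      _ = b := by rw [h1, mul_one])
  have hz := (mul_eq_zero.1 hsum).resolve_right hsub
  have hr : IsLocalRing.residue (ballRing L) (a * c) = 1 := by
    rw [map_mul, h, ← map_mul, hc, map_one]
  have := congrArg (IsLocalRing.residue (ballRing L)) hz
  rw [map_sum, map_zero] at this
  simp only [map_pow, hr, one_pow, Finset.sum_const, Finset.card_range, nsmul_eq_mul,
    mul_one] at this
  exact hm this

variable {L₂ : Type*} [NormedField L₂] [IsUltrametricDist L₂]

/-- The map of unit balls induced by an isometric field embedding. -/
def ballMap (f : L →+* L₂) (hf : ∀ x, ‖f x‖ = ‖x‖) : ballRing L →+* ballRing L₂ where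
  toFun x := ⟨f x, mem_ballRing.2 (by rw [hf]; exact mem_ballRing.1 x.2)⟩
  map_one' := Subtype.ext (map_one f)
  map_mul' x y := Subtype.ext (map_mul f _ _)
  map_zero' := Subtype.ext (map_zero f)
  map_add' x y := Subtype.ext (map_add f _ _)

theorem isLocalHom_ballMap (f : L →+* L₂) (hf : ∀ x, ‖f x‖ = ‖x‖) : IsLocalHom (ballMap f hf) := by
  refine ⟨fun x hx => ?_⟩
  by_contra h
  have h1 : ‖(x : L)‖ < 1 := by
    rw [← residue_eq_zero_iff_norm_lt, IsLocalRing.residue_eq_zero_iff]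
    exact h
  have h2 : ‖((ballMap f hf x : ballRing L₂) : L₂)‖ < 1 := (hf _).trans_lt h1
  rw [← residue_eq_zero_iff_norm_lt, IsLocalRing.residue_eq_zero_iff] at h2
  exact h2 hx

/-- The map of residue fields induced by an isometric field embedding. -/
noncomputable def resMap (f : L →+* L₂) (hf : ∀ x, ‖f x‖ = ‖x‖) : ResField L →+* ResField L₂ :=
  haveI := isLocalHom_ballMap f hf
  IsLocalRing.ResidueField.map (ballMap f hf)

theorem resMap_residue (f : L →+* L₂) (hf : ∀ x, ‖f x‖ = ‖x‖) (x : ballRing L) :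
    resMap f hf (IsLocalRing.residue _ x) = IsLocalRing.residue _ (ballMap f hf x) := rfl

end Residue

section Frobenius

variable {F Ω : Type} [NormedField F] [IsUltrametricDist F] [NormedField Ω] [IsUltrametricDist Ω]
  [NormedAlgebra F Ω]

theorem natCard_resField_cast (F Ω : Type) [NormedField F] [IsUltrametricDist F] [NormedField Ω]
    [IsUltrametricDist Ω] [NormedAlgebra F Ω] :
    ((Nat.card (ResField F) : ℕ) : ResField Ω) = 0 := by
  have h : ((Nat.card (ResField F) : ℕ) : ResField F) = 0 := by
    rcases finite_or_infinite (ResField F) with _ | _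
    · have := Fintype.ofFinite (ResField F)
      rw [Nat.card_eq_fintype_card, FiniteField.cast_card_eq_zero]
    · simp
  have := congrArg (resMap (algebraMap F Ω) (norm_algebraMap' Ω)) h
  rwa [map_natCast, map_zero] at this

theorem exists_residue_frobenius [ProperSpace Ω] [Finite (ResField F)] (g : Ω ≃ₐ[F] Ω)
    (hg : ∀ x, ‖g x‖ = ‖x‖) :
    ∃ i : ℕ, ∀ x : ResField Ω,
      resMap (g : Ω →+* Ω) hg x = x ^ Nat.card (ResField F) ^ i := by
  let _ : Algebra (ResField F) (ResField Ω) := (resMap (algebraMap F Ω) (norm_algebraMap' Ω)).toAlgebra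
  let _ := Fintype.ofFinite (ResField F)
  let g' : ResField Ω →ₐ[ResField F] ResField Ω :=
    { resMap (g : Ω →+* Ω) hg with
      commutes' := fun x => by
        obtain ⟨x, rfl⟩ := IsLocalRing.residue_surjective x
        refine congrArg (IsLocalRing.residue (ballRing Ω)) (Subtype.ext ?_)
        exact g.commutes x }
  obtain ⟨i, hi⟩ := (FiniteField.bijective_frobeniusAlgHom_pow (ResField F) (ResField Ω)).2 g'
  refine ⟨i, fun x => ?_⟩
  change g' x = _
  rw [← hi]
  have key : ∀ k : ℕ, (FiniteField.frobeniusAlgHom (ResField F) (ResField Ω) ^ k) x =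
      x ^ Nat.card (ResField F) ^ k := by
    intro k
    induction k with
    | zero => simp
    | succ k ih =>
      rw [pow_succ', AlgHom.mul_apply, ih, FiniteField.coe_frobeniusAlgHom,
        Nat.card_eq_fintype_card]
      change (x ^ _) ^ _ = _
      rw [← pow_mul, pow_succ]
  exact key i

end Frobenius

section FrobeniusExponent

variable {F Ω : Type} [NormedField F] [IsUltrametricDist F] [NormedField Ω] [IsUltrametricDist Ω]
  [NormedAlgebra F Ω]

/-- `g` acts on the residue field of `Ω` as the `i`-th power of the Frobenius over `F`. -/
def FrobExponent (g : Ω ≃ₐ[F] Ω) (i : ℕ) : Prop :=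
  ∀ x : Ω, ‖x‖ ≤ 1 → ‖g x - x ^ Nat.card (ResField F) ^ i‖ < 1

theorem exists_frobExponent [ProperSpace Ω] [Finite (ResField F)] (g : Ω ≃ₐ[F] Ω)
    (hg : ∀ x, ‖g x‖ = ‖x‖) : ∃ i, FrobExponent g i := by
  obtain ⟨i, hi⟩ := exists_residue_frobenius g hg
  refine ⟨i, fun x hx => ?_⟩
  have h := hi (IsLocalRing.residue _ ⟨x, mem_ballRing.2 hx⟩)
  exact (residue_eq_iff_norm_sub_lt (ballMap (g : Ω →+* Ω) hg ⟨x, mem_ballRing.2 hx⟩) _).1 h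

omit [IsUltrametricDist Ω] in
theorem FrobExponent.one : FrobExponent (1 : Ω ≃ₐ[F] Ω) 0 := fun x _ => by simp

theorem FrobExponent.mul {g h : Ω ≃ₐ[F] Ω} {i j : ℕ} (hg : ∀ x, ‖g x‖ = ‖x‖)
    (hgi : FrobExponent g i) (hhj : FrobExponent h j) : FrobExponent (g * h) (i + j) := by
  intro x hx
  have h1 := hhj x hx
  rw [← hg, map_sub] at h1
  have h2 := hgi (x ^ Nat.card (ResField F) ^ j) (by
    rw [norm_pow]; exact pow_le_one₀ (norm_nonneg _) hx)
  rw [← pow_mul, ← pow_add, add_comm j i] at h2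
  have h3 := (IsUltrametricDist.norm_add_le_max _ _).trans_lt (max_lt h1 h2)
  rwa [sub_add_sub_cancel] at h3

theorem exists_residue_generator [ProperSpace Ω] :
    ∃ θ : ballRing Ω, ∀ x : ResField Ω, x ≠ 0 → ∃ k : ℕ, x = IsLocalRing.residue _ θ ^ k := by
  obtain ⟨t, ht⟩ := IsCyclic.exists_generator (α := (ResField Ω)ˣ)
  obtain ⟨θ, hθ⟩ := IsLocalRing.residue_surjective (t : ResField Ω)
  refine ⟨θ, fun x hx => ?_⟩
  obtain ⟨k, hk⟩ := mem_powers_iff_mem_zpowers.2 (ht (Units.mk0 x hx))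
  refine ⟨k, ?_⟩
  rw [hθ]
  exact (congrArg Units.val hk).symm

theorem exists_frobExponent_one [ProperSpace Ω] [Finite (ResField F)] [FiniteDimensional F Ω]
    [IsGalois F Ω] (hiso : ∀ (g : Ω ≃ₐ[F] Ω) (x : Ω), ‖g x‖ = ‖x‖) :
    ∃ g : Ω ≃ₐ[F] Ω, FrobExponent g 1 := by
  classical
  obtain ⟨θ, hθ⟩ := exists_residue_generator (Ω := Ω)
  let q := Nat.card (ResField F)
  let res := IsLocalRing.residue (ballRing Ω)
  let B : (Ω ≃ₐ[F] Ω) → (ballRing Ω →+* ballRing Ω) := fun g => ballMap (g : Ω →+* Ω) (hiso g)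
  let P : Polynomial (ballRing Ω) := ∏ g : Ω ≃ₐ[F] Ω, (Polynomial.X - Polynomial.C (B g θ))
  have hPB : ∀ g, P.map (B g) = P := fun g => by
    simp only [P, Polynomial.map_prod, Polynomial.map_sub, Polynomial.map_X, Polynomial.map_C]
    exact Fintype.prod_equiv (Equiv.mulLeft g) _ _ fun h => rfl
  have hfrob : ∃ φ : ResField Ω →+* ResField Ω, ∀ x, φ x = x ^ q := by
    let _ : Algebra (ResField F) (ResField Ω) :=
      (resMap (algebraMap F Ω) (norm_algebraMap' Ω)).toAlgebra
    let _ := Fintype.ofFinite (ResField F)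
    exact ⟨(FiniteField.frobeniusAlgHom (ResField F) (ResField Ω) : _ →+* _), fun x => by
      simp [q]⟩
  obtain ⟨φ, hφ⟩ := hfrob
  have hcoeff : (P.map res).map φ = P.map res := by
    ext k
    rw [Polynomial.coeff_map, Polynomial.coeff_map, hφ]
    have hfix : ∀ g : Ω ≃ₐ[F] Ω, g ((P.coeff k : ballRing Ω) : Ω) = (P.coeff k : ballRing Ω) :=
      fun g => by
        have := congrArg (fun Q => ((Polynomial.coeff Q k : ballRing Ω) : Ω)) (hPB g)
        simp only [Polynomial.coeff_map] at this
        exact this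
    obtain ⟨a, ha⟩ := (IsGalois.mem_range_algebraMap_iff_fixed (F := F) _).2 hfix
    have haB : ‖a‖ ≤ 1 := by
      rw [← norm_algebraMap' Ω, ha]; exact mem_ballRing.1 (P.coeff k).2
    have h1 : res (P.coeff k) = resMap (algebraMap F Ω) (norm_algebraMap' Ω)
        (IsLocalRing.residue _ ⟨a, mem_ballRing.2 haB⟩) := by
      rw [resMap_residue]
      exact congrArg res (Subtype.ext ha.symm)
    let _ := Fintype.ofFinite (ResField F)
    rw [h1, ← map_pow]
    congr 1
    simp only [q, Nat.card_eq_fintype_card]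
    exact FiniteField.pow_card _
  have h0 : (P.map res).eval (res θ) = 0 := by
    rw [Polynomial.eval_map, Polynomial.eval₂_hom, Polynomial.eval_prod,
      Finset.prod_eq_zero (Finset.mem_univ 1), map_zero]
    rw [Polynomial.eval_sub, Polynomial.eval_X, Polynomial.eval_C]
    exact sub_eq_zero.2 (Subtype.ext rfl)
  have h1 : (P.map res).eval (φ (res θ)) = 0 := by
    conv_lhs => rw [← hcoeff]
    rw [Polynomial.eval_map_apply, h0, map_zero]
  simp only [P, Polynomial.map_prod, Polynomial.map_sub, Polynomial.map_X, Polynomial.map_C,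
    Polynomial.eval_prod, Polynomial.eval_sub, Polynomial.eval_X, Polynomial.eval_C] at h1
  obtain ⟨g, -, hg⟩ := Finset.prod_eq_zero_iff.1 h1
  refine ⟨g, fun x hx => ?_⟩
  have h2 : ∀ y : ResField Ω, resMap (g : Ω →+* Ω) (hiso g) y = y ^ q := fun y => by
    by_cases hy : y = 0
    · rw [hy, map_zero, ← hφ, map_zero]
    · obtain ⟨k, rfl⟩ := hθ y hy
      rw [map_pow, ← hφ, map_pow]
      exact congrArg (· ^ k) (sub_eq_zero.1 hg).symm
  rw [pow_one]
  exact (residue_eq_iff_norm_sub_lt (ballMap (g : Ω →+* Ω) (hiso g) ⟨x, mem_ballRing.2 hx⟩) _).1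
    (h2 (res ⟨x, mem_ballRing.2 hx⟩))

end FrobeniusExponent

section RootsOfUnity

variable {F Ω : Type} [NormedField F] [IsUltrametricDist F] [NormedField Ω] [IsUltrametricDist Ω]
  [NormedAlgebra F Ω] {M : ℕ} [NeZero M] {ζ : Ω}

theorem natCast_card_pow_sub_one_ne_zero [Finite (ResField F)] :
    ((Nat.card (ResField F) ^ M - 1 : ℕ) : ResField Ω) ≠ 0 := by
  rw [Nat.cast_sub (Nat.one_le_pow _ _ Nat.card_pos), Nat.cast_pow, natCard_resField_cast F Ω,
    zero_pow (NeZero.ne M), Nat.cast_one, zero_sub]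
  exact neg_ne_zero.2 one_ne_zero

theorem eq_of_norm_sub_lt_of_pow_eq_one {m : ℕ} (hm : (m : ResField Ω) ≠ 0) {a b : Ω}
    (ha : a ^ m = 1) (hb : b ^ m = 1) (h : ‖a - b‖ < 1) : a = b := by
  have hm0 : m ≠ 0 := fun h0 => hm (by rw [h0, Nat.cast_zero])
  have hn : ∀ c : Ω, c ^ m = 1 → ‖c‖ ≤ 1 := fun c hc => by
    refine (pow_le_one_iff_of_nonneg (norm_nonneg c) hm0).1 ?_
    rw [← norm_pow, hc, norm_one]
  have := eq_of_residue_eq_of_pow_eq_one hm (a := ⟨a, mem_ballRing.2 (hn a ha)⟩)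
    (b := ⟨b, mem_ballRing.2 (hn b hb)⟩) (Subtype.ext ha) (Subtype.ext hb)
    ((residue_eq_iff_norm_sub_lt _ _).2 h)
  exact congrArg Subtype.val this

variable (hζ : IsPrimitiveRoot ζ (Nat.card (ResField F) ^ M - 1))
include hζ

omit [IsUltrametricDist Ω] [NormedAlgebra F Ω] [NeZero M] in
theorem IsPrimitiveRoot.pow_card_pow_injective [Finite (ResField F)] {i j : ℕ} (hi : i < M)
    (hj : j < M)
    (h : ζ ^ Nat.card (ResField F) ^ i = ζ ^ Nat.card (ResField F) ^ j) : i = j := by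
  have hq : 1 < Nat.card (ResField F) := Finite.one_lt_card
  wlog hij : i ≤ j generalizing i j
  · exact (this hj hi h.symm (le_of_not_ge hij)).symm
  rcases hij.eq_or_lt with rfl | hlt
  · rfl
  exfalso
  have hM : M = (M - 1) + 1 := by omega
  have h1 : Nat.card (ResField F) ^ j ≤ Nat.card (ResField F) ^ (M - 1) :=
    Nat.pow_le_pow_right hq.le (by omega)
  have h2 : 2 * Nat.card (ResField F) ^ (M - 1) ≤ Nat.card (ResField F) ^ M := by
    conv_rhs => rw [hM, pow_succ, mul_comm]
    exact Nat.mul_le_mul_right _ hq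
  have h3 : 1 < Nat.card (ResField F) ^ (M - 1) := Nat.one_lt_pow (by omega) hq
  have h4 : Nat.card (ResField F) ^ i < Nat.card (ResField F) ^ j := Nat.pow_lt_pow_right hq hlt
  exact h4.ne (hζ.pow_inj (by omega) (by omega) h)

omit [IsUltrametricDist Ω] [NormedAlgebra F Ω] [NeZero M] in
theorem IsPrimitiveRoot.pow_card_pow_mod [Finite (ResField F)] (i : ℕ) :
    ζ ^ Nat.card (ResField F) ^ i = ζ ^ Nat.card (ResField F) ^ (i % M) := by
  have h1 : ζ ^ Nat.card (ResField F) ^ M = ζ := by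
    have h0 : 1 ≤ Nat.card (ResField F) ^ M := Nat.one_le_pow _ _ Nat.card_pos
    have : Nat.card (ResField F) ^ M = (Nat.card (ResField F) ^ M - 1) + 1 := by omega
    rw [this, pow_succ, hζ.pow_eq_one, one_mul]
  have h2 : ∀ k : ℕ, ζ ^ Nat.card (ResField F) ^ (M * k) = ζ := by
    intro k
    induction k with
    | zero => simp
    | succ k ih => rw [Nat.mul_succ, pow_add, pow_mul, ih, h1]
  conv_lhs => rw [← Nat.mod_add_div i M, add_comm, pow_add, pow_mul, h2]

omit [IsUltrametricDist Ω] [NormedAlgebra F Ω] in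
theorem IsPrimitiveRoot.natCast_eq_of_pow_card_pow_eq [Finite (ResField F)] {i j : ℕ}
    (h : ζ ^ Nat.card (ResField F) ^ i = ζ ^ Nat.card (ResField F) ^ j) :
    (i : ZMod M) = j := by
  rw [hζ.pow_card_pow_mod i, hζ.pow_card_pow_mod j] at h
  rw [ZMod.natCast_eq_natCast_iff]
  exact hζ.pow_card_pow_injective (Nat.mod_lt _ (NeZero.pos M)) (Nat.mod_lt _ (NeZero.pos M)) h

theorem FrobExponent.apply_eq [Finite (ResField F)] {g : Ω ≃ₐ[F] Ω} {i : ℕ}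
    (hg : FrobExponent g i) : g ζ = ζ ^ Nat.card (ResField F) ^ i := by
  have hm := natCast_card_pow_sub_one_ne_zero (F := F) (Ω := Ω) (M := M)
  refine eq_of_norm_sub_lt_of_pow_eq_one hm ?_ ?_ (hg ζ ?_)
  · rw [← map_pow, hζ.pow_eq_one, map_one]
  · rw [← pow_mul, mul_comm, pow_mul, hζ.pow_eq_one, one_pow]
  · refine (pow_le_one_iff_of_nonneg (norm_nonneg ζ)
      (show Nat.card (ResField F) ^ M - 1 ≠ 0 from fun h0 => hm (by rw [h0, Nat.cast_zero]))).1 ?_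
    rw [← norm_pow, hζ.pow_eq_one, norm_one]

theorem exists_unramified_character [ProperSpace Ω] [Finite (ResField F)]
    (hiso : ∀ (g : Ω ≃ₐ[F] Ω) (x : Ω), ‖g x‖ = ‖x‖) :
    ∃ ψ : (Ω ≃ₐ[F] Ω) →* Multiplicative (ZMod M),
      ∀ g i, FrobExponent g i → ψ g = Multiplicative.ofAdd (i : ZMod M) := by
  choose e he using fun g : Ω ≃ₐ[F] Ω => exists_frobExponent g (hiso g)
  have huniq : ∀ g i, FrobExponent g i → (e g : ZMod M) = i := fun g i hi =>
    hζ.natCast_eq_of_pow_card_pow_eq (by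
      rw [← FrobExponent.apply_eq hζ hi, ← FrobExponent.apply_eq hζ (he g)])
  refine ⟨⟨⟨fun g => Multiplicative.ofAdd (e g : ZMod M), ?_⟩, fun g h => ?_⟩, fun g i hi => ?_⟩
  · rw [huniq 1 0 FrobExponent.one, Nat.cast_zero, ofAdd_zero]
  · change Multiplicative.ofAdd (e (g * h) : ZMod M) = _
    rw [huniq (g * h) (e g + e h) ((he g).mul (hiso g) (he h)), Nat.cast_add, ofAdd_add]
  · exact congrArg Multiplicative.ofAdd (huniq g i hi)

end RootsOfUnity

theorem algebraMap_trace_charField {F Ω : Type} [Field F] [Field Ω] [Algebra F Ω] {M : ℕ}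
    [FiniteDimensional F Ω] [IsGalois F Ω] [NeZero M] {χ : (Ω ≃ₐ[F] Ω) →* Multiplicative (ZMod M)}
    {e d : ℕ} {σ : Ω ≃ₐ[F] Ω} {j : (Ω ≃ₐ[F] Ω) → ℕ} (hed : e * d = M)
    (hj : ∀ g, charVal χ g = e * j g) (hjd : ∀ g, j g < d) (hσ : (χ σ).toAdd = (e : ZMod M))
    (t : charField χ) :
    algebraMap F Ω (Algebra.trace F _ t) = ∑ i ∈ Finset.range d, (σ ^ i) (t : Ω) := by
  have hbij := bijective_restrict_pow hed hj hjd hσ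
  have h1 := congrArg (algebraMap (charField χ) Ω) (trace_eq_sum_automorphisms (K := F) t)
  rw [← IsScalarTower.algebraMap_apply] at h1
  rw [h1, ← hbij.sum_comp, map_sum, Finset.sum_range]
  refine Finset.sum_congr rfl fun i _ => ?_
  rw [← map_pow]
  exact AlgEquiv.restrictNormal_commutes _ _ _

section NormValue

variable {F Ω : Type} [NormedField F] [IsUltrametricDist F] [NormedField Ω] [IsUltrametricDist Ω]
  [NormedAlgebra F Ω] [FiniteDimensional F Ω] [IsGalois F Ω] {M : ℕ} [NeZero M]

omit [IsUltrametricDist F] [IsUltrametricDist Ω] in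
theorem norm_algebraNorm_charField (hiso : ∀ (g : Ω ≃ₐ[F] Ω) (x : Ω), ‖g x‖ = ‖x‖)
    (χ : (Ω ≃ₐ[F] Ω) →* Multiplicative (ZMod M)) (t : charField χ) :
    ‖Algebra.norm F t‖ = ‖(t : Ω)‖ ^ Module.finrank F (charField χ) := by
  obtain ⟨e, d, σ, j, hed, hd, hj, hjd, hσ⟩ := exists_charVal_step χ
  rw [← IsGalois.card_aut_eq_finrank, ← Nat.card_eq_of_bijective _
    (bijective_restrict_pow hed hj hjd hσ), Nat.card_fin, ← norm_algebraMap' Ω,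
    algebraMap_norm_charField hed hj hjd hσ, norm_prod,
    Finset.prod_congr rfl fun i _ => hiso (σ ^ i) (t : Ω), Finset.prod_const, Finset.card_range]

omit [IsUltrametricDist F] in
theorem exists_norm_eq_of_mem_unramified
    (hiso : ∀ (g : Ω ≃ₐ[F] Ω) (x : Ω), ‖g x‖ = ‖x‖)
    {ψ : (Ω ≃ₐ[F] Ω) →* Multiplicative (ZMod M)} {σ : Ω ≃ₐ[F] Ω}
    (hσ : ψ σ = Multiplicative.ofAdd (1 : ZMod M)) {ζ : Ω} (hζ : ζ ∈ charField ψ)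
    (hdist : ∀ i < M, ∀ j < M, ‖(σ ^ i) ζ - (σ ^ j) ζ‖ < 1 → i = j) (hζ1 : ‖ζ‖ ≤ 1)
    {x : Ω} (hx : x ∈ charField ψ) : ∃ a : F, ‖a‖ = ‖x‖ := by
  by_contra! hne
  have hx0 : x ≠ 0 := fun h => hne 0 (by rw [h, norm_zero, norm_zero])
  have hxn : 0 < ‖x‖ := norm_pos_iff.2 hx0
  let res := IsLocalRing.residue (ballRing Ω)
  let y : Fin M → ballRing Ω := fun i => ⟨(σ ^ (i : ℕ)) x / x, mem_ballRing.2 (by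
    rw [norm_div, hiso, div_self hxn.ne'])⟩
  let z : Fin M → ballRing Ω := fun i => ⟨(σ ^ (i : ℕ)) ζ, mem_ballRing.2 (by rwa [hiso])⟩
  have hinj : Function.Injective fun i => res (z i) := fun i j hij =>
    Fin.ext (hdist i i.2 j j.2 ((residue_eq_iff_norm_sub_lt _ _).1 hij))
  have hsum : ∀ k : Fin M, ∑ i, res (y i) * res (z i) ^ (k : ℕ) = 0 := fun k => by
    have h1 : res (∑ i, y i * z i ^ (k : ℕ)) = 0 := by
      rw [residue_eq_zero_iff_norm_lt]
      refine (mem_ballRing.1 (∑ i, y i * z i ^ (k : ℕ)).2).lt_of_ne fun h2 => ?_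
      have ht := algebraMap_trace_charField (χ := ψ) (e := 1) (d := M) (σ := σ) (j := charVal ψ)
        (one_mul M) (fun g => (one_mul _).symm) (fun g => ZMod.val_lt _)
        (by rw [hσ, Nat.cast_one]; rfl) ⟨x * ζ ^ (k : ℕ), mul_mem hx (pow_mem hζ _)⟩
      refine hne (Algebra.trace F _ (⟨x * ζ ^ (k : ℕ), mul_mem hx (pow_mem hζ _)⟩ :
        charField ψ)) ?_
      rw [← norm_algebraMap' Ω, ht, Finset.sum_range]
      have h3 : ∑ i : Fin M, (σ ^ (i : ℕ)) (x * ζ ^ (k : ℕ)) =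
          x * ((∑ i, y i * z i ^ (k : ℕ) : ballRing Ω) : Ω) := by
        rw [← ValuationSubring.subtype_apply, map_sum, Finset.mul_sum]
        refine Finset.sum_congr rfl fun i _ => ?_
        rw [map_mul, map_mul, map_pow, map_pow, ValuationSubring.subtype_apply,
          ValuationSubring.subtype_apply, ← mul_assoc, mul_div_cancel₀ _ hx0]
      rw [h3, norm_mul, h2, mul_one]
    rw [map_sum] at h1
    simpa only [map_mul, map_pow] using h1
  have h0 := congrFun (Matrix.eq_zero_of_forall_pow_sum_mul_pow_eq_zero hinj hsum)
    ⟨0, NeZero.pos M⟩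
  have hy0 : y ⟨0, NeZero.pos M⟩ = 1 := Subtype.ext (by
    change (σ ^ 0) x / x = 1
    rw [pow_zero]
    exact div_self hx0)
  simp only [hy0, map_one, Pi.zero_apply] at h0
  exact one_ne_zero h0

end NormValue

/-- `π` has norm generating the value group of `L`. -/
structure IsNormUniformizer {L : Type*} [NormedField L] (π : L) : Prop where
  pos : 0 < ‖π‖
  lt_one : ‖π‖ < 1
  exists_zpow : ∀ a : L, a ≠ 0 → ∃ k : ℤ, ‖a‖ = ‖π‖ ^ k

theorem exists_isNormUniformizer (L : Type*) [NormedField L] [IsUltrametricDist L] [ProperSpace L]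
    {c : L} (hc0 : c ≠ 0) (hc1 : ‖c‖ < 1) : ∃ π : L, IsNormUniformizer π := by
  have hball : IsCompact (Metric.ball (0 : L) 1) :=
    (isCompact_closedBall (0 : L) 1).of_isClosed_subset
      (IsUltrametricDist.isClosed_ball _ _) Metric.ball_subset_closedBall
  obtain ⟨π, hπ, hmax⟩ := hball.exists_isMaxOn ⟨c, by simpa using hc1⟩ continuous_norm.continuousOn
  have hmax' : ∀ a : L, ‖a‖ < 1 → ‖a‖ ≤ ‖π‖ := fun a ha => hmax (by simpa using ha)
  have h0 : 0 < ‖π‖ := (norm_pos_iff.2 hc0).trans_le (hmax' c hc1)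
  have h1 : ‖π‖ < 1 := by simpa using hπ
  refine ⟨π, h0, h1, fun a ha => ?_⟩
  obtain ⟨n, hn1, hn2⟩ := exists_mem_Ioc_zpow (norm_pos_iff.2 ha) ((one_lt_inv₀ h0).2 h1)
  have hπ0 : π ≠ 0 := norm_pos_iff.1 h0
  have h2 : ‖a * π ^ (n + 1)‖ ≤ 1 := by
    rw [norm_mul, norm_zpow]
    calc ‖a‖ * ‖π‖ ^ (n + 1) ≤ ‖π‖⁻¹ ^ (n + 1) * ‖π‖ ^ (n + 1) := by gcongr
      _ = 1 := by rw [← mul_zpow, inv_mul_cancel₀ h0.ne', one_zpow]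
  have h3 : ‖π‖ < ‖a * π ^ (n + 1)‖ := by
    rw [norm_mul, norm_zpow]
    calc ‖π‖ = ‖π‖⁻¹ ^ n * ‖π‖ ^ (n + 1) := by
          rw [zpow_add_one₀ h0.ne', ← mul_assoc, ← mul_zpow, inv_mul_cancel₀ h0.ne', one_zpow,
            one_mul]
      _ < ‖a‖ * ‖π‖ ^ (n + 1) := by gcongr
  have h4 : ‖a * π ^ (n + 1)‖ = 1 := by
    refine h2.antisymm (not_lt.1 fun h => ?_)
    exact absurd (hmax' _ h) (not_le.2 h3)
  refine ⟨-(n + 1), ?_⟩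
  rw [norm_mul, norm_zpow] at h4
  rw [zpow_neg]
  exact eq_inv_of_mul_eq_one_left h4

theorem MonoidHom.range_eq_zpowers_of_card_le {A B : Type*} [CommGroup A] [Group B] (h : B →* A)
    {M : ℕ} (h0 : Nat.card h.range ≠ 0) (hM : Nat.card h.range ≤ M) (z : B)
    (hz : ∀ k : ℕ, h z ^ k = 1 → M ∣ k) : h.range = Subgroup.zpowers (h z) := by
  have hfin : Finite h.range := Nat.finite_of_card_ne_zero h0
  have hle : Subgroup.zpowers (h z) ≤ h.range :=
    (Subgroup.zpowers_le).2 ⟨z, rfl⟩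
  refine (Subgroup.eq_of_le_of_card_ge hle (hM.trans ?_)).symm
  rw [Nat.card_zpowers]
  have hfz : Finite (Subgroup.zpowers (h z)) := Finite.Set.subset (h.range : Set A) hle
  refine Nat.le_of_dvd ?_ (hz _ (pow_orderOf_eq_one _))
  rw [← Nat.card_zpowers]
  exact Nat.card_pos

theorem exists_norm_sub_algebraMap_lt {F Ω : Type} [NormedField F] [IsUltrametricDist F]
    [NormedField Ω] [IsUltrametricDist Ω] [NormedAlgebra F Ω] [Finite (ResField F)] {x : Ω}
    (hx : ‖x‖ ≤ 1) (hxq : ‖x - x ^ Nat.card (ResField F)‖ < 1) :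
    ∃ b : F, ‖x - algebraMap F Ω b‖ < 1 := by
  classical
  let _ := Fintype.ofFinite (ResField F)
  let f := resMap (algebraMap F Ω) (norm_algebraMap' Ω)
  let y := IsLocalRing.residue (ballRing Ω) ⟨x, mem_ballRing.2 hx⟩
  have hy : y ^ Fintype.card (ResField F) - y = 0 := by
    rw [sub_eq_zero, ← Nat.card_eq_fintype_card, ← map_pow, eq_comm, residue_eq_iff_norm_sub_lt]
    exact hxq
  have hne := FiniteField.X_pow_card_sub_X_ne_zero (ResField Ω)
    (Fintype.one_lt_card (α := ResField F))
  have hdeg := FiniteField.X_pow_card_sub_X_natDegree_eq (ResField Ω)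
    (Fintype.one_lt_card (α := ResField F))
  have hsub : Finset.univ.image f ⊆
      (Polynomial.X ^ Fintype.card (ResField F) - Polynomial.X :
        Polynomial (ResField Ω)).roots.toFinset := by
    intro a ha
    obtain ⟨b, -, rfl⟩ := Finset.mem_image.1 ha
    rw [Multiset.mem_toFinset, Polynomial.mem_roots hne, Polynomial.IsRoot.def]
    simp only [Polynomial.eval_sub, Polynomial.eval_pow, Polynomial.eval_X]
    rw [← map_pow, FiniteField.pow_card, sub_self]
  have heq := Finset.eq_of_subset_of_card_le hsub (by
    rw [Finset.card_image_of_injective _ f.injective, Finset.card_univ]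
    exact (Multiset.toFinset_card_le _).trans ((Polynomial.card_roots' _).trans hdeg.le))
  have hmem : y ∈ Finset.univ.image f := by
    rw [heq, Multiset.mem_toFinset, Polynomial.mem_roots hne, Polynomial.IsRoot.def]
    simpa only [Polynomial.eval_sub, Polynomial.eval_pow, Polynomial.eval_X] using hy
  obtain ⟨b, -, hb⟩ := Finset.mem_image.1 hmem
  obtain ⟨b, rfl⟩ := IsLocalRing.residue_surjective b
  exact ⟨b, (residue_eq_iff_norm_sub_lt _ _).1 hb.symm⟩

theorem span_pow_eq_top (p : ℕ) [Fact p.Prime] {F K : Type} [NormedField F] [NormedField K]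
    [IsUltrametricDist K] [NormedAlgebra ℚ_[p] F] [NormedAlgebra ℚ_[p] K] [NormedAlgebra F K]
    [IsScalarTower ℚ_[p] F K] [FiniteDimensional ℚ_[p] K] {a : F} {π : K}
    (hπ : IsNormUniformizer π) {e : ℕ} (he : 0 < e) (ha : ‖a‖ = ‖π‖ ^ e)
    (hres : ∀ x : K, ‖x‖ = 1 → ∃ b : F, ‖x - algebraMap F K b‖ < 1) :
    Submodule.span F (Set.range fun i : Fin e => π ^ (i : ℕ)) = ⊤ := by
  have : ProperSpace K := FiniteDimensional.proper ℚ_[p] K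
  let V := Submodule.span F (Set.range fun i : Fin e => π ^ (i : ℕ))
  have hclosed : IsClosed (V : Set K) := (V.restrictScalars ℚ_[p]).closed_of_finiteDimensional
  rw [eq_top_iff]
  intro x _
  by_contra hx
  obtain ⟨v, hv, hdist⟩ := hclosed.exists_infDist_eq_dist ⟨0, V.zero_mem⟩ x
  have hxv : x - v ≠ 0 := fun h => hx (by rw [sub_eq_zero.1 h]; exact hv)
  obtain ⟨k, hk⟩ := hπ.exists_zpow _ hxv
  have hπ0 : π ≠ 0 := norm_pos_iff.1 hπ.pos
  have he' : (0 : ℤ) < e := by exact_mod_cast he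
  have ha0 : a ≠ 0 := norm_pos_iff.1 (by rw [ha]; exact pow_pos hπ.pos e)
  obtain ⟨i, hi⟩ := Int.eq_ofNat_of_zero_le (Int.emod_nonneg k he'.ne')
  have hie : i < e := by
    have := Int.emod_lt_of_pos k he'
    rw [hi] at this
    exact_mod_cast this
  let s : K := algebraMap F K (a ^ (k / e)) * π ^ i
  have hs : ‖s‖ = ‖x - v‖ := by
    rw [hk, norm_mul, norm_algebraMap', norm_zpow, ha, norm_pow, ← zpow_natCast, ← zpow_natCast,
      ← zpow_mul, ← zpow_add₀ hπ.pos.ne', ← hi]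
    congr 1
    exact Int.mul_ediv_add_emod k e
  have hs0 : s ≠ 0 := norm_pos_iff.1 (by rw [hs]; exact norm_pos_iff.2 hxv)
  obtain ⟨b, hb⟩ := hres ((x - v) / s) (by
    rw [norm_div, hs, div_self (norm_pos_iff.2 hxv).ne'])
  have hw : v + algebraMap F K b * s ∈ V := by
    refine V.add_mem hv ?_
    have : algebraMap F K b * s = (b * a ^ (k / e)) • π ^ i := by
      rw [Algebra.smul_def, map_mul, mul_assoc]
    rw [this]
    exact V.smul_mem _ (Submodule.subset_span ⟨⟨i, hie⟩, rfl⟩)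
  have h1 : dist x v ≤ dist x (v + algebraMap F K b * s) := by
    rw [← hdist]
    exact Metric.infDist_le_dist_of_mem hw
  have h2 : x - (v + algebraMap F K b * s) = ((x - v) / s - algebraMap F K b) * s := by
    field_simp
    ring
  rw [dist_eq_norm, dist_eq_norm, h2, norm_mul, hs] at h1
  have h3 := mul_lt_mul_of_pos_right hb (norm_pos_iff.2 hxv)
  rw [one_mul] at h3
  exact absurd h1 (not_le.2 h3)

section Core

variable (p : ℕ) [Fact p.Prime] {F Ω : Type} [NormedField F] [IsUltrametricDist F]
  [NormedField Ω] [IsUltrametricDist Ω] [NormedAlgebra ℚ_[p] F] [NormedAlgebra ℚ_[p] Ω]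
  [NormedAlgebra F Ω] [IsScalarTower ℚ_[p] F Ω] [FiniteDimensional ℚ_[p] Ω]
  [FiniteDimensional F Ω] [IsGalois F Ω] {M : ℕ} [NeZero M]

include p in
theorem exists_norm_eq_uniformizer [Finite (ResField F)]
    (hiso : ∀ (g : Ω ≃ₐ[F] Ω) (x : Ω), ‖g x‖ = ‖x‖)
    {χ : (Ω ≃ₐ[F] Ω) →* Multiplicative (ZMod M)} {σ : Ω ≃ₐ[F] Ω} (hσ : FrobExponent σ 1)
    (hχ : χ σ = 1) {a : F} (ha : IsNormUniformizer a) :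
    ∃ t : charField χ, ‖Algebra.norm F t‖ = ‖a‖ := by
  let K := charField χ
  let _ : NormedAlgebra ℚ_[p] K :=
    { norm_smul_le := fun r x => norm_smul_le r (x : Ω) }
  have : FiniteDimensional ℚ_[p] K := FiniteDimensional.of_injective
    ((K.val.restrictScalars ℚ_[p]).toLinearMap) K.val.injective
  have : IsUltrametricDist K := ⟨fun x y z => dist_triangle_max (x : Ω) y z⟩
  have : ProperSpace K := FiniteDimensional.proper ℚ_[p] K
  have ha0 : a ≠ 0 := norm_pos_iff.1 ha.pos
  obtain ⟨π, hπ⟩ := exists_isNormUniformizer K (c := algebraMap F K a)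
    ((map_ne_zero _).2 ha0) (by rw [norm_algebraMap']; exact ha.lt_one)
  obtain ⟨e, he⟩ := hπ.exists_zpow (algebraMap F K a) ((map_ne_zero _).2 ha0)
  rw [norm_algebraMap'] at he
  have he0 : 0 < e := by
    have h1 := ha.lt_one
    rw [he] at h1
    by_contra h
    exact absurd h1 (not_lt.2 (one_le_zpow_of_nonpos₀ hπ.pos hπ.lt_one.le (not_lt.1 h)))
  obtain ⟨e, rfl⟩ := Int.eq_ofNat_of_zero_le he0.le
  rw [zpow_natCast] at he
  have he0 : 0 < e := by exact_mod_cast he0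
  have hres : ∀ x : K, ‖x‖ = 1 → ∃ b : F, ‖x - algebraMap F K b‖ < 1 := fun x hx => by
    have h1 := hσ (x : Ω) hx.le
    rw [mem_charField.1 x.2 σ hχ, pow_one] at h1
    exact exists_norm_sub_algebraMap_lt (F := F) hx.le h1
  have hfin : Module.finrank F K ≤ e := by
    have h1 := finrank_range_le_card (R := F) fun i : Fin e => π ^ (i : ℕ)
    rwa [Set.finrank, span_pow_eq_top p hπ he0 he hres, finrank_top, Fintype.card_fin] at h1
  have hN := norm_algebraNorm_charField hiso χ π
  have hn : 0 < Module.finrank F K := Module.finrank_pos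
  have hN0 : Algebra.norm F π ≠ 0 := norm_pos_iff.1 (by rw [hN]; exact pow_pos hπ.pos _)
  obtain ⟨k, hk⟩ := ha.exists_zpow _ hN0
  have h2 : ((Module.finrank F K : ℕ) : ℤ) = e * k := by
    refine zpow_right_injective₀ hπ.pos hπ.lt_one.ne ?_
    change ‖π‖ ^ ((Module.finrank F K : ℕ) : ℤ) = ‖π‖ ^ ((e : ℤ) * k)
    rw [zpow_natCast, zpow_mul, zpow_natCast, ← he, ← hk, hN]
    rfl
  have hk0 : 0 < k := by
    refine (mul_pos_iff_of_pos_left (a := (e : ℤ)) (by exact_mod_cast he0)).1 ?_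
    rw [← h2]
    exact_mod_cast hn
  have hk1 : k = 1 := by
    have h3 : (e : ℤ) * k ≤ e * 1 := by
      rw [← h2, mul_one]
      exact_mod_cast hfin
    have := le_of_mul_le_mul_left h3 (by exact_mod_cast he0)
    omega
  exact ⟨π, by rw [hk, hk1, zpow_one]⟩

variable {ψ : (Ω ≃ₐ[F] Ω) →* Multiplicative (ZMod M)} {σ : Ω ≃ₐ[F] Ω}

omit [IsUltrametricDist F] [IsUltrametricDist Ω] in
theorem exists_zpow_of_unramified_charCup_eq_one
    (hiso : ∀ (g : Ω ≃ₐ[F] Ω) (x : Ω), ‖g x‖ = ‖x‖)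
    (hσ : ψ σ = Multiplicative.ofAdd (1 : ZMod M))
    (hval : ∀ x ∈ charField ψ, ∃ b : F, ‖b‖ = ‖x‖) {a : F} (ha : IsNormUniformizer a) (y : Fˣ)
    (hy : charCup (Units.map (algebraMap F Ω : F →* Ω)) ψ y = 1) :
    ∃ k : ℤ, ‖(y : F)‖ = ‖a‖ ^ ((M : ℤ) * k) := by
  obtain ⟨t, ht⟩ := (charCup_eq_one_iff ψ y).1 hy
  have hN := norm_algebraNorm_charField hiso ψ t
  have hfin : Module.finrank F (charField ψ) = M := by
    rw [← IsGalois.card_aut_eq_finrank, ← Nat.card_eq_of_bijective _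
      (bijective_restrict_pow (χ := ψ) (e := 1) (d := M) (σ := σ) (j := charVal ψ)
        (one_mul M) (fun g => (one_mul _).symm) (fun g => ZMod.val_lt _)
        (by rw [hσ, Nat.cast_one]; rfl)), Nat.card_fin]
  obtain ⟨b, hb⟩ := hval t t.2
  have hb0 : b ≠ 0 := by
    rintro rfl
    rw [norm_zero] at hb
    rw [← hb, hfin, zero_pow (NeZero.ne M), norm_eq_zero, ht] at hN
    exact y.ne_zero hN
  obtain ⟨k, hk⟩ := ha.exists_zpow b hb0
  refine ⟨k, ?_⟩
  rw [← ht, hN, hfin, ← hb, hk, mul_comm, zpow_mul, zpow_natCast]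

end Core

theorem FrobExponent.pow {F Ω : Type} [NormedField F] [IsUltrametricDist F] [NormedField Ω]
    [IsUltrametricDist Ω] [NormedAlgebra F Ω] {g : Ω ≃ₐ[F] Ω} (hg : ∀ x, ‖g x‖ = ‖x‖)
    (h : FrobExponent g 1) (i : ℕ) : FrobExponent (g ^ i) i := by
  induction i with
  | zero => exact FrobExponent.one
  | succ i ih =>
    rw [pow_succ', add_comm]
    exact h.mul hg ih

theorem MonoidHom.pow_eq_one_of_zmod {G : Type*} [Group G] {M : ℕ}
    (χ : G →* Multiplicative (ZMod M)) : χ ^ M = 1 := by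
  ext g
  change (χ g ^ M).toAdd = 0
  rw [toAdd_pow, nsmul_eq_mul, CharP.cast_eq_zero, zero_mul]

section Pairing

variable {X B A : Type*} [CommGroup X] [CommGroup B] [CommGroup A] (H : X →* B →* A) {M : ℕ}
  {ψ : X}

theorem MonoidHom.range_eq_zpowers_of_pairing
    (hcard : ∀ χ, Nat.card (H χ).range ≠ 0 ∧ Nat.card (H χ).range ≤ M) {z : B}
    (hz : ∀ k : ℤ, H ψ (z ^ k) = 1 → (M : ℤ) ∣ k) {χ : X} (hχ : H χ z = H ψ z) :
    (H χ).range = Subgroup.zpowers (H ψ z) := by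
  rw [← hχ]
  refine MonoidHom.range_eq_zpowers_of_card_le _ (hcard χ).1 (hcard χ).2 z fun k hk => ?_
  rw [hχ, ← map_pow, ← zpow_natCast] at hk
  exact_mod_cast hz k hk

theorem MonoidHom.exists_pairing_eq
    (hcard : ∀ χ, Nat.card (H χ).range ≠ 0 ∧ Nat.card (H χ).range ≤ M) {z : B}
    (hz : ∀ k : ℤ, H ψ (z ^ k) = 1 → (M : ℤ) ∣ k) {χ : X} {k : ℕ}
    (hχ : H (χ * (ψ ^ k)⁻¹) z = 1) (y : B) : ∃ u, H χ y = H ψ u := by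
  have hmul : ∀ (χ₁ χ₂ : X) (y : B), H (χ₁ * χ₂) y = H χ₁ y * H χ₂ y := fun χ₁ χ₂ y => by
    rw [map_mul, MonoidHom.mul_apply]
  have hr := MonoidHom.range_eq_zpowers_of_pairing H hcard hz (χ := χ * (ψ ^ k)⁻¹ * ψ)
    (by rw [hmul, hχ, one_mul])
  rw [← MonoidHom.range_eq_zpowers_of_pairing H hcard hz rfl] at hr
  obtain ⟨u, hu⟩ : H (χ * (ψ ^ k)⁻¹ * ψ) y ∈ (H ψ).range := hr ▸ ⟨y, rfl⟩
  refine ⟨u * y⁻¹ * y ^ k, ?_⟩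
  rw [map_mul, map_mul, map_inv, map_pow, hu, hmul, mul_inv_cancel_right, hmul, map_inv, map_pow,
    MonoidHom.inv_apply, MonoidHom.pow_apply, inv_mul_cancel_right]

theorem MonoidHom.pairing_eq_one
    (hcard : ∀ χ, Nat.card (H χ).range ≠ 0 ∧ Nat.card (H χ).range ≤ M) (hψ : ψ ^ M = 1) {z u : B}
    (hz : ∀ k : ℤ, H ψ (z ^ k) = 1 → (M : ℤ) ∣ k)
    (hu : ∀ k : ℤ, H ψ (u * z ^ k) = 1 → (M : ℤ) ∣ k) : H ψ u = 1 := by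
  obtain ⟨k, hk⟩ : H ψ u ∈ Subgroup.zpowers (H ψ z) := by
    rw [← MonoidHom.range_eq_zpowers_of_pairing H hcard hz rfl]
    exact ⟨u, rfl⟩
  have hk : H ψ z ^ k = H ψ u := hk
  obtain ⟨j, hj⟩ := hu (-k) (by rw [map_mul, map_zpow, ← hk, zpow_neg, mul_inv_cancel])
  have htors : H ψ z ^ M = 1 := by rw [← MonoidHom.pow_apply, ← map_pow, hψ, map_one]; rfl
  rw [← hk, ← neg_neg k, hj, zpow_neg, zpow_mul, zpow_natCast, htors, one_zpow, inv_one]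

end Pairing

section Core

variable (p : ℕ) [Fact p.Prime] {F Ω : Type} [NormedField F] [IsUltrametricDist F]
  [NormedField Ω] [IsUltrametricDist Ω] [NormedAlgebra ℚ_[p] F] [NormedAlgebra ℚ_[p] Ω]
  [NormedAlgebra F Ω] [IsScalarTower ℚ_[p] F Ω] [FiniteDimensional ℚ_[p] Ω]
  [FiniteDimensional F Ω] [IsGalois F Ω] {M : ℕ} [NeZero M]

include p in
/-- Every cup product of a character of order dividing `M` with an element of the base field is
the cup product of the unramified character of level `M` with some element. -/
theorem exists_unramified_charCup_eq [ProperSpace F]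
    (hiso : ∀ (g : Ω ≃ₐ[F] Ω) (x : Ω), ‖g x‖ = ‖x‖) {ζ : Ω}
    (hζ : IsPrimitiveRoot ζ (Nat.card (ResField F) ^ M - 1)) :
    ∃ ψ : (Ω ≃ₐ[F] Ω) →* Multiplicative (ZMod M),
      (∀ g i, FrobExponent g i → ψ g = Multiplicative.ofAdd (i : ZMod M)) ∧
      (∀ u : Fˣ, ‖(u : F)‖ = 1 → charCup (Units.map (algebraMap F Ω : F →* Ω)) ψ u = 1) ∧
      ∀ (χ : (Ω ≃ₐ[F] Ω) →* Multiplicative (ZMod M)) (y : Fˣ), ∃ u : Fˣ,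
        charCup (Units.map (algebraMap F Ω : F →* Ω)) χ y =
          charCup (Units.map (algebraMap F Ω : F →* Ω)) ψ u := by
  have : ProperSpace Ω := FiniteDimensional.proper ℚ_[p] Ω
  obtain ⟨ψ, hψ⟩ := exists_unramified_character hζ hiso
  obtain ⟨σ, hσ⟩ := exists_frobExponent_one (F := F) hiso
  have hψσ : ψ σ = Multiplicative.ofAdd (1 : ZMod M) := by rw [hψ σ 1 hσ, Nat.cast_one]
  have hm := natCast_card_pow_sub_one_ne_zero (F := F) (Ω := Ω) (M := M)
  have hζψ : ζ ∈ charField ψ := mem_charField.2 fun g hg => by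
    obtain ⟨i, hi⟩ := exists_frobExponent g (hiso g)
    rw [hψ g i hi, ofAdd_eq_one, ZMod.natCast_eq_zero_iff] at hg
    rw [hi.apply_eq hζ, hζ.pow_card_pow_mod, Nat.mod_eq_zero_of_dvd hg, pow_zero, pow_one]
  have hdist : ∀ i < M, ∀ j < M, ‖(σ ^ i) ζ - (σ ^ j) ζ‖ < 1 → i = j := by
    intro i hi j hj hij
    rw [(hσ.pow (hiso σ) i).apply_eq hζ, (hσ.pow (hiso σ) j).apply_eq hζ] at hij
    refine hζ.pow_card_pow_injective hi hj (eq_of_norm_sub_lt_of_pow_eq_one hm ?_ ?_ hij) <;>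
      rw [← pow_mul, mul_comm, pow_mul, hζ.pow_eq_one, one_pow]
  have hζ1 : ‖ζ‖ ≤ 1 := by
    refine (pow_le_one_iff_of_nonneg (norm_nonneg ζ)
      (show Nat.card (ResField F) ^ M - 1 ≠ 0 from fun h0 => hm (by rw [h0, Nat.cast_zero]))).1 ?_
    rw [← norm_pow, hζ.pow_eq_one, norm_one]
  have hval : ∀ x ∈ charField ψ, ∃ b : F, ‖b‖ = ‖x‖ := fun x hx =>
    exists_norm_eq_of_mem_unramified hiso hψσ hζψ hdist hζ1 hx
  obtain ⟨a, ha⟩ := exists_isNormUniformizer F (c := (p : F))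
    (by
      rw [← map_natCast (algebraMap ℚ_[p] F)]
      exact (map_ne_zero _).2 (Nat.cast_ne_zero.2 (Fact.out : p.Prime).ne_zero))
    (by
      rw [← map_natCast (algebraMap ℚ_[p] F), norm_algebraMap']
      exact Padic.norm_p_lt_one)
  set ι : Fˣ →* Ωˣ := Units.map (algebraMap F Ω : F →* Ω) with hιdef
  have hcard := card_range_charCup_le (F := F) (Ω := Ω) p (M := M)
  have hpow : ∀ z : Fˣ, ‖(z : F)‖ = ‖a‖ → ∀ u : Fˣ, ‖(u : F)‖ = 1 → ∀ k : ℤ,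
      charCup ι ψ (u * z ^ k) = 1 → (M : ℤ) ∣ k := by
    intro z hz u hu k h
    obtain ⟨j, hj⟩ := exists_zpow_of_unramified_charCup_eq_one hiso hψσ hval ha _ h
    rw [Units.val_mul, Units.val_zpow_eq_zpow_val, norm_mul, hu, one_mul, norm_zpow, hz] at hj
    exact ⟨j, zpow_right_injective₀ ha.pos ha.lt_one.ne hj⟩
  have hpow1 : ∀ z : Fˣ, ‖(z : F)‖ = ‖a‖ → ∀ k : ℤ, charCup ι ψ (z ^ k) = 1 → (M : ℤ) ∣ k :=
    fun z hz k hk => hpow z hz 1 (by rw [Units.val_one, norm_one]) k (by rwa [one_mul])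
  refine ⟨ψ, hψ, fun u hu => ?_, fun χ y => ?_⟩
  · let z : Fˣ := Units.mk0 a (norm_pos_iff.1 ha.pos)
    exact MonoidHom.pairing_eq_one (charCupHom ι (smul_units_map_algebraMap (F := F) (Ω := Ω)))
      hcard ψ.pow_eq_one_of_zmod (hpow1 z rfl) (hpow z rfl u hu)
  · have hχ' : (χ * (ψ ^ (χ σ).toAdd.val)⁻¹) σ = 1 := by
      change χ σ * (ψ σ ^ (χ σ).toAdd.val)⁻¹ = 1
      rw [mul_inv_eq_one, hψσ, ← ofAdd_nsmul, nsmul_eq_mul, mul_one, ZMod.natCast_zmod_val]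
      rfl
    obtain ⟨t, ht⟩ := exists_norm_eq_uniformizer p hiso hσ hχ' ha
    let z : Fˣ := Units.mk0 (Algebra.norm F t) (norm_pos_iff.1 (by rw [ht]; exact ha.pos))
    have hz : charCup ι (χ * (ψ ^ (χ σ).toAdd.val)⁻¹) z = 1 :=
      (charCup_eq_one_iff _ z).2 ⟨t, (Units.val_mk0 _).symm⟩
    exact MonoidHom.exists_pairing_eq (charCupHom ι (smul_units_map_algebraMap (F := F) (Ω := Ω)))
      hcard (hpow1 z ht) hz y

end Core

section Conjugation

variable {F Ω : Type} [Field F] [Field Ω] [Algebra F Ω] (τ : Ω ≃+* Ω) (γ : F ≃+* F)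
  (hτ : ∀ a, τ (algebraMap F Ω a) = algebraMap F Ω (γ a))

/-- Conjugation on the Galois group by a semilinear automorphism. -/
def galConj : (Ω ≃ₐ[F] Ω) →* (Ω ≃ₐ[F] Ω) where
  toFun g := AlgEquiv.ofRingEquiv (f := (τ.trans (g : Ω ≃+* Ω)).trans τ.symm) fun a => by
    change τ.symm (g (τ (algebraMap F Ω a))) = _
    rw [hτ, g.commutes, ← hτ, τ.symm_apply_apply]
  map_one' := by
    ext a
    exact τ.symm_apply_apply a
  map_mul' g h := by
    ext a
    change τ.symm (g (h (τ a))) = τ.symm (g (τ (τ.symm (h (τ a)))))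
    rw [τ.apply_symm_apply]

theorem apply_galConj_apply (g : Ω ≃ₐ[F] Ω) (a : Ω) : τ (galConj τ γ hτ g a) = g (τ a) :=
  τ.apply_symm_apply _

/-- The action of a semilinear automorphism on 2-cochains. -/
def cochainConj : ((Ω ≃ₐ[F] Ω) → (Ω ≃ₐ[F] Ω) → Ωˣ) →* ((Ω ≃ₐ[F] Ω) → (Ω ≃ₐ[F] Ω) → Ωˣ) where
  toFun f g h := Units.map (τ : Ω →* Ω) (f (galConj τ γ hτ g) (galConj τ γ hτ h))
  map_one' := by
    funext g h
    simp
  map_mul' f f' := by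
    funext g h
    simp

theorem twoCoboundary_range_le_comap_cochainConj :
    (twoCoboundary (Ω ≃ₐ[F] Ω) Ωˣ).range ≤
      (twoCoboundary (Ω ≃ₐ[F] Ω) Ωˣ).range.comap (cochainConj τ γ hτ) := by
  rintro _ ⟨b, rfl⟩
  refine ⟨fun g => Units.map (τ : Ω →* Ω) (b (galConj τ γ hτ g)), ?_⟩
  funext g h
  have h1 : g • Units.map (τ : Ω →* Ω) (b (galConj τ γ hτ h)) =
      Units.map (τ : Ω →* Ω) (galConj τ γ hτ g • b (galConj τ γ hτ h)) :=
    Units.ext (apply_galConj_apply τ γ hτ g _).symm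
  change Units.map (τ : Ω →* Ω) (b (galConj τ γ hτ g)) *
    g • Units.map (τ : Ω →* Ω) (b (galConj τ γ hτ h)) /
      Units.map (τ : Ω →* Ω) (b (galConj τ γ hτ (g * h))) =
    Units.map (τ : Ω →* Ω) (b (galConj τ γ hτ g) *
      galConj τ γ hτ g • b (galConj τ γ hτ h) / b (galConj τ γ hτ g * galConj τ γ hτ h))
  rw [h1, map_div, map_mul, map_mul]

theorem charCup_galConj {M : ℕ} (χ : (Ω ≃ₐ[F] Ω) →* Multiplicative (ZMod M)) (y : Fˣ) :
    QuotientGroup.map _ _ (cochainConj τ γ hτ) (twoCoboundary_range_le_comap_cochainConj τ γ hτ)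
        (charCup (Units.map (algebraMap F Ω : F →* Ω)) χ y) =
      charCup (Units.map (algebraMap F Ω : F →* Ω)) (χ.comp (galConj τ γ hτ))
        (Units.map (γ : F →* F) y) := by
  refine congrArg (QuotientGroup.mk' _) ?_
  funext g h
  change Units.map (τ : Ω →* Ω) (Units.map (algebraMap F Ω : F →* Ω) y ^
      liftCarry M (fun g => (charVal χ g : ℤ)) (galConj τ γ hτ g) (galConj τ γ hτ h)) =
    Units.map (algebraMap F Ω : F →* Ω) (Units.map (γ : F →* F) y) ^
      liftCarry M (fun g => (charVal (χ.comp (galConj τ γ hτ)) g : ℤ)) g h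
  rw [map_zpow]
  congr 1
  · exact Units.ext (hτ y)
  · simp only [liftCarry, charVal, MonoidHom.comp_apply, map_mul]

end Conjugation

section Kummer

variable {F Ω : Type} [Field F] [Field Ω] [Algebra F Ω] {M : ℕ} [NeZero M] {ζ : F}
  (hζ : IsPrimitiveRoot ζ M)
include hζ

theorem IsPrimitiveRoot.pow_eq_pow_iff_natCast_eq (i j : ℕ) :
    ζ ^ i = ζ ^ j ↔ (i : ZMod M) = j := by
  rw [ZMod.natCast_eq_natCast_iff]
  have hu : IsUnit ζ := hζ.isUnit (NeZero.ne M)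
  obtain ⟨u, rfl⟩ := hu
  rw [← Units.val_pow_eq_pow_val, ← Units.val_pow_eq_pow_val, Units.val_inj,
    pow_eq_pow_iff_modEq, ← (IsPrimitiveRoot.coe_units_iff.1 hζ).eq_orderOf]

theorem exists_kummer_character {x : F} (hx : x ≠ 0) {α : Ω} (hα : α ^ M = algebraMap F Ω x) :
    ∃ χ : (Ω ≃ₐ[F] Ω) →* Multiplicative (ZMod M),
      ∀ g, g α = algebraMap F Ω ζ ^ charVal χ g * α := by
  have hζ' := hζ.map_of_injective (algebraMap F Ω).injective
  have hα0 : α ≠ 0 := by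
    rintro rfl
    rw [zero_pow (NeZero.ne M), eq_comm, map_eq_zero] at hα
    exact hx hα
  have hex : ∀ g : Ω ≃ₐ[F] Ω, ∃ k : ℕ, g α = algebraMap F Ω ζ ^ k * α := fun g => by
    obtain ⟨k, -, hk⟩ := hζ'.eq_pow_of_pow_eq_one (ξ := g α / α) (by
      rw [div_pow, ← map_pow, hα, g.commutes, ← hα, div_self (pow_ne_zero _ hα0)])
    exact ⟨k, by rw [hk, div_mul_cancel₀ _ hα0]⟩
  choose k hk using hex
  have hmul : ∀ g h, (k (g * h) : ZMod M) = k g + k h := fun g h => by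
    rw [← Nat.cast_add, ← hζ'.pow_eq_pow_iff_natCast_eq]
    refine mul_right_cancel₀ hα0 ?_
    rw [← hk, AlgEquiv.mul_apply, hk h, map_mul, map_pow, g.commutes, hk g, pow_add]
    ring
  refine ⟨MonoidHom.mk' (fun g => Multiplicative.ofAdd (k g : ZMod M)) fun g h => ?_, fun g => ?_⟩
  · rw [hmul, ofAdd_add]
  · rw [hk]
    congr 1
    rw [hζ'.pow_eq_pow_iff_natCast_eq, charVal_cast]
    rfl

theorem charField_eq_adjoin_of_kummer [FiniteDimensional F Ω] [IsGalois F Ω] {α : Ω} (hα : α ≠ 0)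
    {χ : (Ω ≃ₐ[F] Ω) →* Multiplicative (ZMod M)}
    (hχ : ∀ g, g α = algebraMap F Ω ζ ^ charVal χ g * α) :
    charField χ = IntermediateField.adjoin F {α} := by
  have hζ' := hζ.map_of_injective (algebraMap F Ω).injective
  have key : ∀ g, χ g = 1 ↔ g α = α := fun g => by
    have h1 : algebraMap F Ω ζ ^ charVal χ g = 1 ↔ χ g = 1 := by
      rw [← pow_zero (algebraMap F Ω ζ), hζ'.pow_eq_pow_iff_natCast_eq, charVal_cast,
        Nat.cast_zero, toAdd_eq_zero]
    rw [hχ, mul_eq_right₀ hα, h1]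
  have hker : χ.ker = (IntermediateField.adjoin F {α}).fixingSubgroup := by
    ext g
    rw [MonoidHom.mem_ker, key, IntermediateField.mem_fixingSubgroup_iff]
    refine ⟨fun h y hy => ?_, fun h => h α (IntermediateField.mem_adjoin_simple_self F α)⟩
    have hle : IntermediateField.adjoin F {α} ≤ charField χ := by
      rw [IntermediateField.adjoin_simple_le_iff]
      exact mem_charField.2 fun g hg => (key g).1 hg
    exact mem_charField.1 (hle hy) g ((key g).2 h)
  rw [charField, hker, IsGalois.fixedField_fixingSubgroup]

end Kummer

section Twist

variable (p : ℕ) [Fact p.Prime] {F Ω : Type} [NormedField F] [IsUltrametricDist F]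
  [NormedField Ω] [IsUltrametricDist Ω] [NormedAlgebra ℚ_[p] F] [NormedAlgebra ℚ_[p] Ω]
  [NormedAlgebra F Ω] [IsScalarTower ℚ_[p] F Ω] [FiniteDimensional ℚ_[p] Ω]
  [FiniteDimensional F Ω] [IsGalois F Ω] {M : ℕ} [NeZero M]

theorem FrobExponent.galConj {F Ω : Type} [NormedField F] [IsUltrametricDist F]
    [NormedField Ω] [NormedAlgebra F Ω] {τ : Ω ≃+* Ω} {γ : F ≃+* F}
    (hτ : ∀ a, τ (algebraMap F Ω a) = algebraMap F Ω (γ a)) (hτn : ∀ a, ‖τ a‖ = ‖a‖)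
    {g : Ω ≃ₐ[F] Ω} {i : ℕ} (hg : FrobExponent g i) : FrobExponent (galConj τ γ hτ g) i := by
  intro x hx
  have h := hg (τ x) (by rwa [hτn])
  rwa [← apply_galConj_apply τ γ hτ, ← map_pow, ← map_sub, hτn] at h

include p in
theorem charCup_semilinear [ProperSpace F]
    (hiso : ∀ (g : Ω ≃ₐ[F] Ω) (x : Ω), ‖g x‖ = ‖x‖) {ξ : Ω}
    (hξ : IsPrimitiveRoot ξ (Nat.card (ResField F) ^ M - 1)) {τ : Ω ≃+* Ω} {γ : F ≃+* F}
    (hτ : ∀ a, τ (algebraMap F Ω a) = algebraMap F Ω (γ a)) (hτn : ∀ a, ‖τ a‖ = ‖a‖)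
    (χ : (Ω ≃ₐ[F] Ω) →* Multiplicative (ZMod M)) (y : Fˣ) :
    charCup (Units.map (algebraMap F Ω : F →* Ω)) (χ.comp (galConj τ γ hτ))
        (Units.map (γ : F →* F) y) =
      charCup (Units.map (algebraMap F Ω : F →* Ω)) χ y := by
  have : ProperSpace Ω := FiniteDimensional.proper ℚ_[p] Ω
  obtain ⟨ψ, hψ, hunit, hall⟩ := exists_unramified_charCup_eq p hiso hξ
  obtain ⟨u, hu⟩ := hall χ y
  have hψκ : ψ.comp (galConj τ γ hτ) = ψ := by
    ext1 g
    obtain ⟨i, hi⟩ := exists_frobExponent g (hiso g)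
    rw [MonoidHom.comp_apply, hψ g i hi, hψ _ i (hi.galConj hτ hτn)]
  have hγn : ∀ a, ‖γ a‖ = ‖a‖ := fun a => by
    rw [← norm_algebraMap' Ω, ← hτ, hτn, norm_algebraMap']
  have hγu := hunit (Units.map (γ : F →* F) u * u⁻¹) (by
    rw [Units.val_mul, norm_mul, Units.val_inv_eq_inv_val, norm_inv]
    change ‖γ u‖ * _ = 1
    rw [hγn, mul_inv_cancel₀ (norm_pos_iff.2 u.ne_zero).ne'])
  rw [map_mul, map_inv, mul_inv_eq_one] at hγu
  rw [← charCup_galConj, hu, charCup_galConj, hψκ, hγu]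

include p in
theorem exists_norm_eq_twist [ProperSpace F]
    (hiso : ∀ (g : Ω ≃ₐ[F] Ω) (x : Ω), ‖g x‖ = ‖x‖) {ξ : Ω}
    (hξ : IsPrimitiveRoot ξ (Nat.card (ResField F) ^ M - 1)) {τ : Ω ≃+* Ω} {γ : F ≃+* F}
    (hτ : ∀ a, τ (algebraMap F Ω a) = algebraMap F Ω (γ a)) (hτn : ∀ a, ‖τ a‖ = ‖a‖)
    {ζ : F} (hζ : IsPrimitiveRoot ζ M) {s R : ℕ} {c : ℤ} (hs : IsUnit (s : ZMod M))
    (hγζ : γ ζ = ζ ^ s) (hc : (c : ZMod M) * R = s) {x w : F} (hx : x ≠ 0)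
    (hγx : γ x = x ^ R * w ^ M) {α : Ω} (hα : α ^ M = algebraMap F Ω x) {y : F} (hy : y ≠ 0) :
    ∃ t : IntermediateField.adjoin F {α}, Algebra.norm F t = γ y * (y ^ c)⁻¹ := by
  have hζ' := hζ.map_of_injective (algebraMap F Ω).injective
  have hα0 : α ≠ 0 := by
    rintro rfl
    rw [zero_pow (NeZero.ne M), eq_comm, map_eq_zero] at hα
    exact hx hα
  obtain ⟨χ, hχ⟩ := exists_kummer_character hζ hx hα
  have hγx0 : γ x ≠ 0 := (map_ne_zero γ).2 hx
  have hw0 : w ≠ 0 := by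
    rintro rfl
    rw [zero_pow (NeZero.ne M), mul_zero] at hγx
    exact hγx0 hγx
  obtain ⟨b, hb⟩ : ∃ b : F, τ α = α ^ R * algebraMap F Ω b := by
    have hne : α ^ R * algebraMap F Ω w ≠ 0 :=
      mul_ne_zero (pow_ne_zero _ hα0) ((map_ne_zero _).2 hw0)
    obtain ⟨k, -, hk⟩ := hζ'.eq_pow_of_pow_eq_one (ξ := τ α / (α ^ R * algebraMap F Ω w)) (by
      rw [div_pow, ← map_pow, hα, hτ, hγx, mul_pow, ← pow_mul, mul_comm R, pow_mul, hα, map_mul,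
        map_pow, map_pow, div_self]
      rw [← map_pow, ← map_pow, ← map_mul, ← hγx]
      exact (map_ne_zero _).2 hγx0)
    refine ⟨ζ ^ k * w, ?_⟩
    rw [eq_div_iff hne] at hk
    rw [← hk, map_mul, map_pow]
    ring
  have hb0 : algebraMap F Ω b ≠ 0 := fun h => by
    rw [h, mul_zero] at hb
    exact hα0 ((map_eq_zero τ).1 hb)
  have hχκ : ∀ g, (χ g).toAdd = c * (χ (galConj τ γ hτ g)).toAdd := fun g => by
    have h1 := apply_galConj_apply τ γ hτ g α
    rw [hχ, map_mul, map_pow, hτ, hγζ, hb, map_mul, map_pow, map_pow, g.commutes, hχ, mul_pow,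
      mul_assoc, ← pow_mul, ← pow_mul] at h1
    have h2 := mul_right_cancel₀ (mul_ne_zero (pow_ne_zero R hα0) hb0) h1
    rw [hζ'.pow_eq_pow_iff_natCast_eq, Nat.cast_mul, Nat.cast_mul, charVal_cast,
      charVal_cast] at h2
    refine hs.mul_left_cancel ?_
    rw [mul_left_comm, h2, ← hc]
    ring
  have hχc : χ = (χ.comp (galConj τ γ hτ)) ^ c := by
    ext1 g
    change _ = χ (galConj τ γ hτ g) ^ c
    refine Multiplicative.toAdd.injective ?_
    rw [hχκ, toAdd_zpow, zsmul_eq_mul]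
  have hmain := charCup_semilinear p hiso hξ hτ hτn χ (Units.mk0 y hy)
  have hpow : charCup (Units.map (algebraMap F Ω : F →* Ω)) χ (Units.map (γ : F →* F)
      (Units.mk0 y hy)) =
      charCup (Units.map (algebraMap F Ω : F →* Ω)) χ (Units.mk0 y hy) ^ c := by
    have h1 := map_zpow (charCupHom (M := M) (Units.map (algebraMap F Ω : F →* Ω))
      (smul_units_map_algebraMap (F := F) (Ω := Ω))) (χ.comp (galConj τ γ hτ)) c
    rw [← hχc] at h1
    have h2 := DFunLike.congr_fun h1 (Units.map (γ : F →* F) (Units.mk0 y hy))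
    rw [← hmain]
    exact h2
  have hone : charCup (Units.map (algebraMap F Ω : F →* Ω)) χ
      (Units.map (γ : F →* F) (Units.mk0 y hy) * (Units.mk0 y hy ^ c)⁻¹) = 1 := by
    rw [map_mul, map_inv, map_zpow, hpow, mul_inv_cancel]
  obtain ⟨t, ht⟩ := (charCup_eq_one_iff χ _).1 hone
  have hval : ((Units.map (γ : F →* F) (Units.mk0 y hy) * (Units.mk0 y hy ^ c)⁻¹ : Fˣ) : F) =
      γ y * (y ^ c)⁻¹ := by
    rw [Units.val_mul, Units.val_inv_eq_inv_val, Units.val_zpow_eq_zpow_val]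
    rfl
  rw [hval] at ht
  have hfield := charField_eq_adjoin_of_kummer hζ hα0 hχ
  rw [← hfield]
  exact ⟨t, ht⟩

end Twist

open Polynomial in
theorem exists_normal_extension_with_root {E F L : Type} [Field E] [CharZero E] [Field F]
    [Field L] [Algebra E F] [FiniteDimensional E F] [Algebra F L] (w : L) (hw : IsIntegral F w)
    {N : ℕ} (hN : 0 < N) :
    ∃ (Ω : Type) (_ : Field Ω) (_ : Algebra E Ω) (_ : Algebra F Ω), IsScalarTower E F Ω ∧
      FiniteDimensional E Ω ∧ Normal E Ω ∧ (∃ α : Ω, minpoly F α = minpoly F w) ∧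
      ∃ ξ : Ω, IsPrimitiveRoot ξ N := by
  classical
  let : Algebra E L := ((algebraMap F L).comp (algebraMap E F)).toAlgebra
  have : IsScalarTower E F L := IsScalarTower.of_algebraMap_eq fun _ => rfl
  have hwE : IsIntegral E w := isIntegral_trans w hw
  let b := Module.finBasis E F
  have hbi : ∀ i, IsIntegral E (b i) := fun i => Algebra.IsIntegral.isIntegral _
  let P : E[X] := (∏ i, minpoly E (b i)) * minpoly E w * cyclotomic N E
  have hP1 : (∏ i, minpoly E (b i)) ≠ 0 := Finset.prod_ne_zero_iff.2 fun i _ => minpoly.ne_zero (hbi i)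
  have hP : P ≠ 0 := mul_ne_zero (mul_ne_zero hP1 (minpoly.ne_zero hwE)) (cyclotomic_ne_zero N E)
  have hsplit : (P.map (algebraMap E P.SplittingField)).Splits := SplittingField.splits P
  have hPm : P.map (algebraMap E P.SplittingField) ≠ 0 := Polynomial.map_ne_zero hP
  have hdvd : ∀ Q : E[X], Q ∣ P → (Q.map (algebraMap E P.SplittingField)).Splits := fun Q hQ =>
    hsplit.of_dvd hPm (Polynomial.map_dvd _ hQ)
  have hadj : IntermediateField.adjoin E (Set.range b) = ⊤ := by
    rw [eq_top_iff]
    intro z _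
    have : z ∈ Submodule.span E (Set.range b) := b.span_eq ▸ Submodule.mem_top
    exact Submodule.span_le (p := Subalgebra.toSubmodule
      (IntermediateField.adjoin E (Set.range b)).toSubalgebra).2
      (IntermediateField.subset_adjoin E _) this
  obtain ⟨f⟩ : Nonempty (F →ₐ[E] P.SplittingField) :=
    IntermediateField.nonempty_algHom_of_adjoin_splits (S := Set.range b) (by
      rintro _ ⟨i, rfl⟩
      exact ⟨hbi i, hdvd _ (((Finset.dvd_prod_of_mem _ (Finset.mem_univ i)).mul_right _).mul_right _)⟩)
      hadj
  let : Algebra F P.SplittingField := f.toRingHom.toAlgebra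
  have hT : IsScalarTower E F P.SplittingField :=
    IsScalarTower.of_algebraMap_eq fun a => (f.commutes a).symm
  refine ⟨P.SplittingField, inferInstance, inferInstance, inferInstance, hT, inferInstance,
    Normal.of_isSplittingField P, ?_, ?_⟩
  · have h1 : ((minpoly E w).map (algebraMap E P.SplittingField)).Splits :=
      hdvd _ ((dvd_mul_left _ _).mul_right _)
    have h2 : ((minpoly F w).map (algebraMap F P.SplittingField)).Splits := by
      refine h1.of_dvd (Polynomial.map_ne_zero (minpoly.ne_zero hwE)) ?_
      rw [IsScalarTower.algebraMap_eq E F P.SplittingField, ← Polynomial.map_map]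
      exact Polynomial.map_dvd _ (minpoly.dvd_map_of_isScalarTower E F w)
    obtain ⟨α, hα⟩ := h2.exists_eval_eq_zero (by
      rw [degree_map]
      exact (minpoly.degree_pos hw).ne')
    refine ⟨α, ?_⟩
    rw [eval_map_algebraMap] at hα
    exact (minpoly.eq_of_irreducible_of_monic (minpoly.irreducible hw) hα (minpoly.monic hw)).symm
  · have h1 : ((cyclotomic N E).map (algebraMap E P.SplittingField)).Splits :=
      hdvd _ (dvd_mul_left _ _)
    have : CharZero P.SplittingField := charZero_of_injective_algebraMap
      (algebraMap E P.SplittingField).injective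
    have : NeZero (N : P.SplittingField) := ⟨Nat.cast_ne_zero.2 hN.ne'⟩
    obtain ⟨ξ, hξ⟩ := h1.exists_eval_eq_zero (by
      rw [degree_map]
      exact (degree_cyclotomic_pos N E hN).ne')
    rw [map_cyclotomic] at hξ
    exact ⟨ξ, isRoot_cyclotomic_iff.1 hξ⟩

theorem exists_norm_adjoin_of_minpoly_eq {F L Ω : Type} [Field F] [Field L] [Field Ω]
    [Algebra F L] [Algebra F Ω] {w : L} {α : Ω} (hw : IsIntegral F w)
    (h : minpoly F α = minpoly F w) {b : F}
    (hb : ∃ t : IntermediateField.adjoin F {α}, Algebra.norm F t = b) :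
    ∃ t : IntermediateField.adjoin F {w}, Algebra.norm F t = b := by
  have hα : IsIntegral F α := by
    by_contra hα
    rw [minpoly.eq_zero hα] at h
    exact minpoly.ne_zero hw h.symm
  obtain ⟨t, ht⟩ := hb
  let e : IntermediateField.adjoin F {α} ≃ₐ[F] IntermediateField.adjoin F {w} :=
    (IntermediateField.adjoinRootEquivAdjoin F hα).symm.trans
      ((AdjoinRoot.algEquivOfEq F _ _ h).trans (IntermediateField.adjoinRootEquivAdjoin F hw))
  exact ⟨e t, by rw [← ht]; exact Algebra.norm_eq_of_algEquiv e t⟩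

theorem exists_norm_eq_of_gamma_twist (p : ℕ) [Fact p.Prime] {E F L : Type} [Field E]
    [Field F] [Field L] [Algebra ℚ_[p] E] [Algebra E F] [Algebra ℚ_[p] F] [IsScalarTower ℚ_[p] E F]
    [FiniteDimensional ℚ_[p] E] [FiniteDimensional E F] [Algebra F L] {M : ℕ} [NeZero M] {ζ : F}
    (hζ : IsPrimitiveRoot ζ M) {γ : F ≃ₐ[E] F} {s R : ℕ} {c : ℤ} (hs : IsUnit (s : ZMod M))
    (hγζ : γ ζ = ζ ^ s) (hc : (c : ZMod M) * R = s) {x w : F} (hx : x ≠ 0)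
    (hγx : γ x = x ^ R * w ^ M) {α : L} (hα : α ^ M = algebraMap F L x) {y : F} (hy : y ≠ 0) :
    ∃ t : IntermediateField.adjoin F {α}, Algebra.norm F t = γ y * (y ^ c)⁻¹ := by
  have : FiniteDimensional ℚ_[p] F := FiniteDimensional.trans ℚ_[p] E F
  let : NormedField F := spectralNorm.normedField ℚ_[p] F
  let : NormedAlgebra ℚ_[p] F := spectralNorm.normedAlgebra ℚ_[p] F
  have : IsUltrametricDist F := IsUltrametricDist.isUltrametricDist_of_isNonarchimedean_norm
    isNonarchimedean_spectralNorm
  have : ProperSpace F := FiniteDimensional.proper ℚ_[p] F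
  have : CharZero E := charZero_of_injective_algebraMap (algebraMap ℚ_[p] E).injective
  have : CharZero F := charZero_of_injective_algebraMap (algebraMap ℚ_[p] F).injective
  have hαi : IsIntegral F α := IsIntegral.of_pow (NeZero.pos M) (hα ▸ isIntegral_algebraMap)
  have hN : 0 < Nat.card (ResField F) ^ M - 1 :=
    Nat.sub_pos_of_lt (Nat.one_lt_pow (NeZero.ne M) Finite.one_lt_card)
  obtain ⟨Ω, _, _, _, hT, hfin, hnorm, ⟨β, hβ⟩, ξ, hξ⟩ :=
    exists_normal_extension_with_root (E := E) (F := F) α hαi hN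
  refine exists_norm_adjoin_of_minpoly_eq hαi hβ ?_
  have hβM : β ^ M = algebraMap F Ω x := by
    have h1 : minpoly F β ∣ Polynomial.X ^ M - Polynomial.C x := by
      rw [hβ]
      exact minpoly.dvd _ _ (by simp [hα])
    have h2 := Polynomial.aeval_eq_zero_of_dvd_aeval_eq_zero h1 (minpoly.aeval F β)
    simpa [sub_eq_zero] using h2
  let : Algebra ℚ_[p] Ω := ((algebraMap E Ω).comp (algebraMap ℚ_[p] E)).toAlgebra
  have : IsScalarTower ℚ_[p] E Ω := IsScalarTower.of_algebraMap_eq fun _ => rfl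
  have : IsScalarTower ℚ_[p] F Ω := IsScalarTower.to₁₃₄ ℚ_[p] E F Ω
  have : FiniteDimensional ℚ_[p] Ω := FiniteDimensional.trans ℚ_[p] E Ω
  have : FiniteDimensional F Ω := FiniteDimensional.right E F Ω
  have : Normal F Ω := Normal.tower_top_of_normal E F Ω
  have : IsGalois F Ω := { }
  let : NormedField Ω := spectralNorm.normedField ℚ_[p] Ω
  let : NormedAlgebra ℚ_[p] Ω := spectralNorm.normedAlgebra ℚ_[p] Ω
  have : IsUltrametricDist Ω := IsUltrametricDist.isUltrametricDist_of_isNonarchimedean_norm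
    isNonarchimedean_spectralNorm
  let : NormedAlgebra F Ω := spectralNorm.normedAlgebra' ℚ_[p] F Ω
  refine exists_norm_eq_twist p (Ω := Ω) (τ := (γ.liftNormal Ω).toRingEquiv)
    (γ := γ.toRingEquiv) (fun g z => ?_) hξ (fun a => γ.liftNormal_commutes Ω a) (fun a => ?_)
    hζ hs hγζ hc hx hγx hβM hy
  · exact (spectralNorm_eq_of_equiv (g.restrictScalars ℚ_[p]) z).symm
  · exact (spectralNorm_eq_of_equiv ((γ.liftNormal Ω).restrictScalars ℚ_[p]) a).symm

/-- For `r ≥ 0`, `x ∈ F^r`, `y ∈ F^×` and `c` an integer with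
`c·(1+p)^r ≡ 1+p (mod p^n)`, the element `γ(y)·y^{-c}` is a norm from `F(x^{1/p^n})`,
where `γ ∈ Gal(F/E)` satisfies `γ(ζ_{p^n}) = ζ_{p^n}^{1+p}`. -/
theorem gamma_twist_is_norm (p n : ℕ) [Fact p.Prime] (hp : Odd p) (hn : 1 ≤ n)
    (E F : Type) [Field E] [Field F] [Algebra ℚ_[p] E] [Algebra E F]
    [Algebra ℚ_[p] F] [IsScalarTower ℚ_[p] E F] [FiniteDimensional ℚ_[p] E]
    (ζ : F) (hζ : IsPrimitiveRoot ζ (p ^ n))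
    (hF : IntermediateField.adjoin E {ζ} = ⊤)
    (v : AddValuation F (WithTop ℤ))
    (hv1 : v (1 - ζ) = (1 : WithTop ℤ))
    (hvp : v ((p : F)) = (((p : ℤ) ^ (n - 1) * ((p : ℤ) - 1) : ℤ) : WithTop ℤ))
    (hunram : ∀ x : E, x ≠ 0 →
      ∃ k : ℤ, v (algebraMap E F x) = ((((p : ℤ) ^ (n - 1) * ((p : ℤ) - 1)) * k : ℤ) : WithTop ℤ))
    (r : ℕ) (x : F) (hx : memFr p n E ζ (r : ℤ) x)
    (y : F) (hy : y ≠ 0)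
    (c : ℤ) (hc : (c : ZMod (p ^ n)) * (1 + (p : ZMod (p ^ n))) ^ r = 1 + (p : ZMod (p ^ n)))
    (γ : F ≃ₐ[E] F) (hγ : γ ζ = ζ ^ (1 + p))
    (w : AlgebraicClosure F) (hw : w ^ (p ^ n) = algebraMap F (AlgebraicClosure F) x) :
    isNormFrom w (γ y * (y ^ c)⁻¹) := by
  have hp0 : p ≠ 0 := (Fact.out : p.Prime).ne_zero
  have : NeZero (p ^ n) := ⟨pow_ne_zero n hp0⟩
  have : FiniteDimensional E F := by
    have h : FiniteDimensional E (IntermediateField.adjoin E {ζ}) :=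
      IntermediateField.adjoin.finiteDimensional (IsIntegral.of_pow (NeZero.pos (p ^ n))
        (hζ.pow_eq_one ▸ isIntegral_one))
    rw [hF] at h
    exact Module.Finite.equiv IntermediateField.topEquiv.toLinearEquiv
  have hs : IsUnit ((1 + p : ℕ) : ZMod (p ^ n)) := by
    rw [ZMod.isUnit_iff_coprime]
    exact Nat.Coprime.pow_right n (by simp)
  obtain ⟨u, hu⟩ := hs
  obtain ⟨hx0, hx⟩ := hx
  obtain ⟨z, hz⟩ := hx γ u (by
    rw [hγ, hu, ZMod.val_natCast]
    exact pow_eq_pow_mod _ hζ.pow_eq_one)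
  refine exists_norm_eq_of_gamma_twist p hζ (R := ((u ^ (r : ℤ) : (ZMod (p ^ n))ˣ) : ZMod (p ^ n)).val)
    (w := z) (hu ▸ u.isUnit) hγ ?_ hx0 ?_ hw hy
  · rw [ZMod.natCast_val, ZMod.cast_id, zpow_natCast, Units.val_pow_eq_pow_val, hu]
    push_cast
    exact hc
  · rw [← hz, mul_left_comm, mul_inv_cancel₀ (pow_ne_zero _ hx0), mul_one]
end

section
/- Set λ = 1 − ζ_{p^n} and ζ_p = ζ_{p^n}^{p^{n−1}}. Let t ≥ 1 be an integer, x ∈ O_F, δ ∈ Gal(F/E), and let ω be an integer with δ(ζ_p) = ζ_p^{ω}. Then v_F( δ(1 + x·λ^t) − (1 + ω^t·x·λ^t) ) ≥ t + 1. -/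
open Polynomial in
theorem IsPrimitiveRoot.exists_sum_one_sub_pow {E F : Type*} [Field E] [Field F] [Algebra E F]
    {ζ : F} {m : ℕ} (hm : 0 < m) (hζ : IsPrimitiveRoot ζ m)
    (hF : IntermediateField.adjoin E {ζ} = ⊤) (x : F) :
    ∃ a : ℕ → E, x = ∑ i ∈ Finset.range m.totient, algebraMap E F (a i) * (1 - ζ) ^ i := by
  have hmonic : (cyclotomic m E).Monic := cyclotomic.monic m E
  have hint : IsIntegral E ζ := hζ.isIntegral hm |>.tower_top
  have hmem : x ∈ Algebra.adjoin E {ζ} := by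
    rw [← IntermediateField.adjoin_simple_toSubalgebra_of_isAlgebraic hint.isAlgebraic, hF]
    exact Algebra.mem_top
  rw [Algebra.adjoin_singleton_eq_range_aeval] at hmem
  obtain ⟨q, hq⟩ := hmem
  have hroot : aeval ζ (cyclotomic m E) = 0 := by
    rw [aeval_def, eval₂_eq_eval_map, map_cyclotomic]
    exact hζ.isRoot_cyclotomic hm
  set r := q %ₘ cyclotomic m E with hr
  have hrx : aeval ζ r = x := by
    rw [hr, aeval_modByMonic_eq_self_of_root hroot]
    exact hq
  have hdeg : (r.comp (1 - X)).natDegree < m.totient := by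
    have hle : (1 - X : E[X]).natDegree ≤ 1 := by compute_degree
    have hlt : r.natDegree < m.totient := by
      rw [← natDegree_cyclotomic m E]
      refine natDegree_modByMonic_lt q hmonic fun h => ?_
      have := natDegree_cyclotomic m E
      rw [h, natDegree_one] at this
      exact (Nat.totient_pos.2 hm).ne this
    calc (r.comp (1 - X)).natDegree ≤ r.natDegree * (1 - X : E[X]).natDegree := natDegree_comp_le
      _ ≤ r.natDegree * 1 := by gcongr
      _ < m.totient := by simpa using hlt
  refine ⟨(r.comp (1 - X)).coeff, ?_⟩
  have heval : aeval (1 - ζ) (r.comp (1 - X)) = x := by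
    rw [aeval_comp]
    simpa using hrx
  rw [← heval, aeval_eq_sum_range' hdeg]
  simp only [Algebra.smul_def]

namespace AddValuation

theorem map_sum_le_of_injOn {R ι : Type*} [Ring R] (v : AddValuation R (WithTop ℤ))
    {s : Finset ι} {f : ι → R}
    (hf : ∀ i ∈ s, ∀ j ∈ s, v (f i) ≠ ⊤ → v (f i) = v (f j) → i = j) {i : ι} (hi : i ∈ s) :
    v (∑ j ∈ s, f j) ≤ v (f i) := by
  classical
  obtain ⟨j, hj, hmin⟩ := s.exists_min_image (fun j => v (f j)) ⟨i, hi⟩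
  refine le_trans ?_ (hmin i hi)
  by_cases htop : v (f j) = ⊤
  · simp [htop]
  rw [← Finset.add_sum_erase s f hj]
  refine (v.map_add_eq_of_lt_left (v.map_lt_sum htop fun k hk => ?_)).le
  rw [Finset.mem_erase] at hk
  exact lt_of_le_of_ne (hmin k hk.2) fun h => hk.1 (hf j hj k hk.2 htop h).symm

theorem nonneg_of_nonneg_sum_mul_pow {E F : Type*} [Field E] [Field F] [Algebra E F]
    (v : AddValuation F (WithTop ℤ)) {N : ℕ} {l : F} (hl : v l = 1)
    (hE : ∀ x : E, x ≠ 0 → ∃ k : ℤ, v (algebraMap E F x) = ((N * k : ℤ) : WithTop ℤ))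
    {a : ℕ → E} (ha : 0 ≤ v (∑ i ∈ Finset.range N, algebraMap E F (a i) * l ^ i))
    {i : ℕ} (hi : i < N) : 0 ≤ v (algebraMap E F (a i)) := by
  have hterm : ∀ i, a i ≠ 0 → ∃ k : ℤ, v (algebraMap E F (a i)) = ((N * k : ℤ) : WithTop ℤ) ∧
      v (algebraMap E F (a i) * l ^ i) = ((N * k + i : ℤ) : WithTop ℤ) := by
    intro i hi
    obtain ⟨k, hk⟩ := hE _ hi
    refine ⟨k, hk, ?_⟩
    rw [map_mul, map_pow, hk, hl, nsmul_one]
    rfl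
  have hne : ∀ i, v (algebraMap E F (a i) * l ^ i) ≠ ⊤ → a i ≠ 0 := by
    rintro i h h0
    simp [h0] at h
  by_cases h0 : a i = 0
  · simp [h0]
  obtain ⟨k, hk, hki⟩ := hterm i h0
  have hle := ha.trans (v.map_sum_le_of_injOn ?_ (Finset.mem_range.2 hi))
  · rw [hki] at hle
    rw [hk]
    norm_cast at hle ⊢
    have hk0 : 0 ≤ k := by
      by_contra! hneg
      nlinarith
    positivity
  · intro i hi j hj htop hij
    obtain ⟨k, -, hk⟩ := hterm i (hne i htop)
    obtain ⟨k', -, hk'⟩ := hterm j (hne j (hij ▸ htop))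
    rw [hk, hk', WithTop.coe_inj] at hij
    have h := congrArg (· % (N : ℤ)) hij
    simp only [Int.mul_add_emod_self_left] at h
    rw [Finset.mem_range] at hi hj
    rw [Int.emod_eq_of_lt (by positivity) (by exact_mod_cast hi),
      Int.emod_eq_of_lt (by positivity) (by exact_mod_cast hj)] at h
    exact_mod_cast h

theorem natCast_le_map_pow {R : Type*} [Ring R] (v : AddValuation R (WithTop ℤ)) {a : R}
    (ha : 1 ≤ v a) (t : ℕ) : (t : WithTop ℤ) ≤ v (a ^ t) := by
  rw [map_pow, ← nsmul_one]
  exact nsmul_le_nsmul_right ha t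

theorem natCast_add_one_le_map_pow_sub_pow {R : Type*} [CommRing R]
    (v : AddValuation R (WithTop ℤ)) {a b : R} (ha : 1 ≤ v a) (hb : 1 ≤ v b)
    (hab : 2 ≤ v (a - b)) (t : ℕ) : (t + 1 : WithTop ℤ) ≤ v (a ^ t - b ^ t) := by
  induction t with
  | zero => simp
  | succ t ih =>
    have h : a ^ (t + 1) - b ^ (t + 1) = a ^ t * (a - b) + (a ^ t - b ^ t) * b := by ring
    rw [h]
    refine v.map_le_add ?_ ?_
    · rw [map_mul]
      refine le_trans (le_of_eq ?_) (add_le_add (v.natCast_le_map_pow ha t) hab)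
      push_cast
      rw [add_assoc, one_add_one_eq_two]
    · rw [map_mul, Nat.cast_add, Nat.cast_one]
      exact add_le_add ih hb

theorem intCast_nonneg {R : Type*} [Ring R] (v : AddValuation R (WithTop ℤ)) (k : ℤ) :
    0 ≤ v (k : R) := by
  have hnat : ∀ m : ℕ, 0 ≤ v (m : R) := by
    intro m
    induction m with
    | zero => simp
    | succ m ih =>
      rw [Nat.cast_succ]
      exact v.map_le_add ih (by simp)
  obtain ⟨m, rfl | rfl⟩ := k.eq_nat_or_neg
  · simpa using hnat m
  · simpa using hnat m

theorem one_le_map_one_sub_pow {R : Type*} [CommRing R] (v : AddValuation R (WithTop ℤ)) {ζ : R}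
    (hζ : 1 ≤ v (1 - ζ)) (a : ℕ) : 1 ≤ v (1 - ζ ^ a) := by
  have hζ0 : 0 ≤ v ζ := by
    rw [← sub_sub_cancel 1 ζ]
    exact v.map_le_sub (by simp) (zero_le_one.trans hζ)
  induction a with
  | zero => simp
  | succ a ih =>
    have h : 1 - ζ ^ (a + 1) = (1 - ζ) + ζ * (1 - ζ ^ a) := by ring
    rw [h]
    refine v.map_le_add hζ ?_
    rw [map_mul]
    simpa using add_le_add hζ0 ih

theorem two_le_map_one_sub_pow_sub {R : Type*} [CommRing R] (v : AddValuation R (WithTop ℤ))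
    {ζ : R} (hζ : 1 ≤ v (1 - ζ)) (a : ℕ) : 2 ≤ v (1 - ζ ^ a - a * (1 - ζ)) := by
  induction a with
  | zero => simp
  | succ a ih =>
    have h : 1 - ζ ^ (a + 1) - (a + 1 : ℕ) * (1 - ζ) =
        (1 - ζ ^ a - a * (1 - ζ)) - (1 - ζ ^ a) * (1 - ζ) := by push_cast; ring
    rw [h]
    refine v.map_le_sub ih ?_
    rw [map_mul, ← one_add_one_eq_two]
    exact add_le_add (v.one_le_map_one_sub_pow hζ a) hζ

end AddValuation


/-- With `λ = 1 - ζ_{p^n}` and `ζ_p = ζ_{p^n}^{p^{n-1}}`, for `t ≥ 1`,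
`x ∈ O_F`, `δ ∈ Gal(F/E)` and `ω` an integer with `δ(ζ_p) = ζ_p^ω`, one has
`v_F(δ(1 + x·λ^t) - (1 + ω^t·x·λ^t)) ≥ t + 1`. -/
theorem delta_action_on_units (p n : ℕ) [Fact p.Prime] (hp : Odd p) (hn : 1 ≤ n)
    (E F : Type) [Field E] [Field F] [Algebra ℚ_[p] E] [Algebra E F]
    [Algebra ℚ_[p] F] [IsScalarTower ℚ_[p] E F] [FiniteDimensional ℚ_[p] E]
    (ζ : F) (hζ : IsPrimitiveRoot ζ (p ^ n))
    (hF : IntermediateField.adjoin E {ζ} = ⊤)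
    (v : AddValuation F (WithTop ℤ))
    (hv1 : v (1 - ζ) = (1 : WithTop ℤ))
    (hvp : v ((p : F)) = (((p : ℤ) ^ (n - 1) * ((p : ℤ) - 1) : ℤ) : WithTop ℤ))
    (hunram : ∀ x : E, x ≠ 0 →
      ∃ k : ℤ, v (algebraMap E F x) = ((((p : ℤ) ^ (n - 1) * ((p : ℤ) - 1)) * k : ℤ) : WithTop ℤ))
    (t : ℕ) (ht : 1 ≤ t) (x : F) (hx : (0 : WithTop ℤ) ≤ v x)
    (δ : F ≃ₐ[E] F) (ω : ℤ)
    (hω : δ (ζ ^ p ^ (n - 1)) = (ζ ^ p ^ (n - 1)) ^ ω) :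
    (((t : ℤ) + 1 : ℤ) : WithTop ℤ) ≤
      v (δ (1 + x * (1 - ζ) ^ t) - (1 + ((ω ^ t : ℤ) : F) * x * (1 - ζ) ^ t)) := by
  have hp' : p.Prime := Fact.out
  have hm : 0 < p ^ n := pow_pos hp'.pos n
  have htot : (((p ^ n).totient : ℕ) : ℤ) = (p : ℤ) ^ (n - 1) * ((p : ℤ) - 1) := by
    rw [Nat.totient_prime_pow hp' hn]
    push_cast [Nat.cast_sub hp'.one_le]
    rfl
  rw [← htot] at hvp
  simp only [← htot] at hunram
  have hp1 : 1 ≤ v (p : F) := by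
    rw [hvp]
    exact_mod_cast Nat.totient_pos.2 hm
  have hδζ : IsPrimitiveRoot (δ ζ) (p ^ n) := hζ.map_of_injective δ.injective
  have : NeZero (p ^ n) := ⟨hm.ne'⟩
  obtain ⟨a, -, ha⟩ := hζ.eq_pow_of_pow_eq_one hδζ.pow_eq_one
  have hζp : IsPrimitiveRoot (ζ ^ p ^ (n - 1)) p :=
    hζ.pow hm (by rw [← pow_succ, Nat.sub_add_cancel hn])
  have hdvd : (p : ℤ) ∣ a - ω := by
    rw [← hζp.zpow_eq_one_iff_dvd, zpow_sub₀ (hζp.ne_zero hp'.ne_zero), ← hω, map_pow, ← ha,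
      zpow_natCast, pow_right_comm]
    exact div_self (pow_ne_zero _ (pow_ne_zero _ (hζ.ne_zero hm.ne')))
  have hζ1 : 1 ≤ v (1 - ζ) := hv1.ge
  have hδl : δ (1 - ζ) = 1 - ζ ^ a := by rw [map_sub, map_one, ha]
  have hδl1 : 1 ≤ v (δ (1 - ζ)) := hδl ▸ v.one_le_map_one_sub_pow hζ1 a
  have hωl : 1 ≤ v (ω * (1 - ζ)) := by
    rw [AddValuation.map_mul]
    simpa using add_le_add (v.intCast_nonneg ω) hζ1
  have hdiff : 2 ≤ v (δ (1 - ζ) - ω * (1 - ζ)) := by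
    obtain ⟨k, hk⟩ := hdvd
    have hk' : (a : F) = ω + p * k := by
      have := congrArg (Int.cast : ℤ → F) hk
      push_cast at this
      linear_combination this
    have h : δ (1 - ζ) - ω * (1 - ζ) =
        (1 - ζ ^ a - a * (1 - ζ)) + k * (p * (1 - ζ)) := by
      rw [hδl, hk']
      ring
    rw [h]
    refine v.map_le_add (v.two_le_map_one_sub_pow_sub hζ1 a) ?_
    rw [AddValuation.map_mul, AddValuation.map_mul, ← one_add_one_eq_two]
    simpa using add_le_add (v.intCast_nonneg k) (add_le_add hp1 hζ1)
  have hδx : 1 ≤ v (δ x - x) := by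
    obtain ⟨c, hc⟩ := hζ.exists_sum_one_sub_pow hm hF x
    have hcv := fun i hi => v.nonneg_of_nonneg_sum_mul_pow hv1 hunram (hc ▸ hx) (i := i) hi
    rw [hc, map_sum, ← Finset.sum_sub_distrib]
    refine v.map_le_sum fun i hi => ?_
    rw [map_mul, AlgEquiv.commutes, map_pow, ← mul_sub, AddValuation.map_mul]
    rw [← zero_add 1]
    refine add_le_add (hcv i (Finset.mem_range.1 hi)) ?_
    rcases Nat.eq_zero_or_pos i with rfl | hi0
    · simp
    have hi1 : (1 : WithTop ℤ) ≤ i := by exact_mod_cast hi0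
    exact v.map_le_sub (hi1.trans (v.natCast_le_map_pow hδl1 i))
      (hi1.trans (v.natCast_le_map_pow hζ1 i))
  have hmain : δ (1 + x * (1 - ζ) ^ t) - (1 + ((ω ^ t : ℤ) : F) * x * (1 - ζ) ^ t) =
      δ (1 - ζ) ^ t * (δ x - x) + x * (δ (1 - ζ) ^ t - (ω * (1 - ζ)) ^ t) := by
    rw [map_add, map_mul, map_pow, map_one, mul_pow]
    push_cast
    ring
  have ht1 : (((t : ℤ) + 1 : ℤ) : WithTop ℤ) = (t : WithTop ℤ) + 1 := rfl
  rw [hmain, ht1]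
  refine v.map_le_add ?_ ?_
  · rw [AddValuation.map_mul]
    exact add_le_add (v.natCast_le_map_pow hδl1 t) hδx
  · rw [AddValuation.map_mul]
    simpa using add_le_add hx (v.natCast_add_one_le_map_pow_sub_pow hδl1 hωl hdiff t)
end

section
/- Assume n ≥ 2. Let x ∈ O_F^× with x ≠ 1 and v_F(x−1) = t ≥ 1. If p ∤ t, then v_F(γ(x) − x) = t + p − 1. If p ∣ t, then v_F(γ(x) − x) > t + p − 1. -/
namespace AddValuation

variable {F : Type*} [Field F] (v : AddValuation F (WithTop ℤ))

theorem zero_le_map_natCast (m : ℕ) : 0 ≤ v (m : F) := by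
  induction m with
  | zero => simp
  | succ k ih =>
    rw [Nat.cast_succ]
    exact v.map_le_add ih v.map_one.ge

theorem zero_le_map_intCast (m : ℤ) : 0 ≤ v (m : F) := by
  obtain ⟨k, rfl | rfl⟩ := m.eq_nat_or_neg
  · simpa using v.zero_le_map_natCast k
  · simpa using v.zero_le_map_natCast k

theorem zero_lt_map_natCast_of_dvd {p i : ℕ} (hp : 0 < v (p : F)) (hi : p ∣ i) :
    0 < v (i : F) := by
  obtain ⟨k, rfl⟩ := hi
  rw [Nat.cast_mul, v.map_mul]
  exact add_pos_of_pos_of_nonneg hp (v.zero_le_map_natCast k)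

theorem map_natCast_eq_zero_of_coprime {p i : ℕ} (hp : 0 < v (p : F)) (hi : p.Coprime i) :
    v (i : F) = 0 := by
  refine le_antisymm (not_lt.mp fun h => ?_) (v.zero_le_map_natCast i)
  have hone : (p : F) * (p.gcdA i : ℤ) + (i : F) * (p.gcdB i : ℤ) = 1 := by
    have := Nat.gcd_eq_gcd_ab p i
    rw [hi.gcd_eq_one] at this
    exact_mod_cast congrArg (Int.cast : ℤ → F) this.symm
  have hlt : 0 < v ((p : F) * (p.gcdA i : ℤ) + (i : F) * (p.gcdB i : ℤ)) := by
    apply v.map_lt_add <;> rw [v.map_mul]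
    · exact add_pos_of_pos_of_nonneg hp (v.zero_le_map_intCast _)
    · exact add_pos_of_pos_of_nonneg h (v.zero_le_map_intCast _)
  rw [hone, v.map_one] at hlt
  exact lt_irrefl _ hlt

theorem exists_one_add_pow_sub_one_eq {u : F} (hu : 0 < v u) (i : ℕ) :
    ∃ c : F, 0 ≤ v c ∧ (1 + u) ^ i - 1 = u * (i + u * c) := by
  induction i with
  | zero => exact ⟨0, by simp, by simp⟩
  | succ k ih =>
    obtain ⟨c, hc, h⟩ := ih
    refine ⟨k + (1 + u) * c, v.map_le_add (v.zero_le_map_natCast k) ?_, ?_⟩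
    · rw [v.map_mul]
      exact add_nonneg (v.map_le_add v.map_one.ge hu.le) hc
    · push_cast
      linear_combination (1 + u) * h

theorem map_one_add_pow_sub_one_of_coprime {p i : ℕ} (hp : 0 < v (p : F)) {u : F}
    (hu : 0 < v u) (hi : p.Coprime i) : v ((1 + u) ^ i - 1) = v u := by
  obtain ⟨c, hc, h⟩ := v.exists_one_add_pow_sub_one_eq hu i
  have hi0 := v.map_natCast_eq_zero_of_coprime hp hi
  rw [h, v.map_mul, v.map_add_eq_of_lt_left, hi0, add_zero]
  rw [hi0, v.map_mul]
  exact add_pos_of_pos_of_nonneg hu hc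

theorem lt_map_one_add_pow_sub_one_of_dvd {p i : ℕ} (hp : 0 < v (p : F)) {u : F}
    (hu : 0 < v u) (hu0 : u ≠ 0) (hi : p ∣ i) : v u < v ((1 + u) ^ i - 1) := by
  obtain ⟨c, hc, h⟩ := v.exists_one_add_pow_sub_one_eq hu i
  have hpos : 0 < v ((i : F) + u * c) := by
    refine v.map_lt_add (v.zero_lt_map_natCast_of_dvd hp hi) ?_
    rw [v.map_mul]
    exact add_pos_of_pos_of_nonneg hu hc
  rw [h, v.map_mul]
  obtain ⟨a, ha⟩ := WithTop.ne_top_iff_exists.mp (v.ne_top_iff.mpr hu0)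
  rw [← ha]
  simpa using (WithTop.add_lt_add_iff_left (WithTop.coe_ne_top (a := a))).mpr hpos

theorem map_one_add_pow_prime_sub_one {p : ℕ} (hp : p.Prime) {l : F} (hl : v l = ((1 : ℤ) : WithTop ℤ))
    (hvp : ((p : ℤ) : WithTop ℤ) ≤ v (p : F)) :
    v ((1 + l) ^ p - 1) = ((p : ℤ) : WithTop ℤ) := by
  have hlp : v (l ^ p) = ((p : ℤ) : WithTop ℤ) := by
    rw [v.map_pow, hl, ← WithTop.coe_nsmul]
    simp
  have hl0 : 0 ≤ v l := by rw [hl]; exact_mod_cast zero_le_one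
  rw [add_pow_prime_eq hp]
  set r := ∑ k ∈ Finset.Ioo 0 p, (1 : F) ^ (k - 1) * l ^ (p - k - 1) * ((p.choose k / p : ℕ) : F)
    with hr
  have hr0 : 0 ≤ v r := by
    refine v.map_le_sum fun k _ => ?_
    rw [v.map_mul, v.map_mul, v.map_pow, v.map_pow, v.map_one, nsmul_zero, zero_add]
    exact add_nonneg (nsmul_nonneg hl0 _) (v.zero_le_map_natCast _)
  have hsum : (1 : F) ^ p + l ^ p + p * 1 * l * r - 1 = l ^ p + p * l * r := by ring
  rw [hsum, v.map_add_eq_of_lt_left, hlp]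
  rw [hlp, v.map_mul, v.map_mul, hl]
  calc ((p : ℤ) : WithTop ℤ) < ((p : ℤ) : WithTop ℤ) + ((1 : ℤ) : WithTop ℤ) + 0 := by
        rw [add_zero]
        exact_mod_cast p.lt_succ_self
    _ ≤ _ := add_le_add (add_le_add hvp le_rfl) hr0

/-- In a sum whose nonzero terms have pairwise distinct valuations, one term attains the valuation
of the sum and all the others have strictly larger valuation. -/
theorem exists_map_eq_map_sum_of_distinct {ι : Type*} {s : Finset ι} {f : ι → F}
    (hf : ∀ i ∈ s, ∀ j ∈ s, i ≠ j → f i ≠ 0 → v (f i) ≠ v (f j)) (h0 : ∑ i ∈ s, f i ≠ 0) :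
    ∃ i ∈ s, v (f i) = v (∑ j ∈ s, f j) ∧ ∀ j ∈ s, j ≠ i → v (f i) < v (f j) := by
  classical
  obtain ⟨i, hi, hmin⟩ := s.exists_min_image (fun i => v (f i))
    (Finset.nonempty_of_sum_ne_zero h0)
  have hi0 : f i ≠ 0 := fun h => h0 <| Finset.sum_eq_zero fun j hj => by
    have := hmin j hj
    rw [h, v.map_zero, top_le_iff] at this
    exact v.top_iff.mp this
  have hlt : ∀ j ∈ s, j ≠ i → v (f i) < v (f j) := fun j hj hji =>
    lt_of_le_of_ne (hmin j hj) (hf i hi j hj hji.symm hi0)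
  refine ⟨i, hi, ?_, hlt⟩
  rw [← Finset.add_sum_erase s f hi, v.map_add_eq_of_lt_left]
  refine v.map_lt_sum (v.ne_top_iff.mpr hi0) fun j hj => ?_
  exact hlt j (Finset.mem_of_mem_erase hj) (Finset.ne_of_mem_erase hj)

end AddValuation

open Polynomial in
theorem IsPrimitiveRoot.exists_eq_sum_sub_one_pow {E F : Type*} [Field E] [Field F] [Algebra E F]
    {m : ℕ} (hm : 0 < m) {ζ : F} (hζ : IsPrimitiveRoot ζ m)
    (hF : IntermediateField.adjoin E {ζ} = ⊤) (y : F) :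
    ∃ a : ℕ → E, y = ∑ i ∈ Finset.range m.totient, algebraMap E F (a i) * (ζ - 1) ^ i := by
  have hint : IsIntegral E ζ := (hζ.isIntegral hm).tower_top
  have hy : y ∈ Algebra.adjoin E {ζ} := by
    rw [← IntermediateField.adjoin_simple_toSubalgebra_of_isAlgebraic hint.isAlgebraic, hF]
    trivial
  rw [Algebra.adjoin_singleton_eq_range_aeval] at hy
  obtain ⟨P, hP⟩ := hy
  set M : E[X] := (cyclotomic m E).comp (X + C 1)
  have hM : M.Monic := (cyclotomic.monic m E).comp_X_add_C 1
  have hMdeg : M.natDegree = m.totient := by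
    rw [natDegree_comp, natDegree_X_add_C, mul_one, natDegree_cyclotomic]
  have hroot : aeval (ζ - 1) M = 0 := by
    have : aeval ζ (cyclotomic m E) = 0 := by
      rw [aeval_def, eval₂_eq_eval_map, map_cyclotomic]
      exact hζ.isRoot_cyclotomic hm
    simpa [M, aeval_comp] using this
  set Q := P.comp (X + C 1) %ₘ M
  have hQ : aeval (ζ - 1) Q = y := by
    rw [aeval_modByMonic_eq_self_of_root hroot, aeval_comp, ← hP]
    simp
  have hQdeg : Q.natDegree < m.totient := by
    rw [← hMdeg]
    refine natDegree_modByMonic_lt _ hM fun h => ?_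
    rw [h, natDegree_one] at hMdeg
    exact (Nat.totient_pos.mpr hm).ne hMdeg
  refine ⟨Q.coeff, ?_⟩
  rw [← hQ, aeval_eq_sum_range' hQdeg]
  simp only [Algebra.smul_def]

/-- Assume `n ≥ 2`.  If `x ∈ O_F^×`, `x ≠ 1` and `v_F(x - 1) = t ≥ 1`,
then `v_F(γ(x) - x) = t + p - 1` when `p ∤ t`, and `v_F(γ(x) - x) > t + p - 1` when `p ∣ t`,
where `γ ∈ Gal(F/E)` satisfies `γ(ζ_{p^n}) = ζ_{p^n}^{1+p}`. -/
theorem gamma_moves_units (p n : ℕ) [Fact p.Prime] (hp : Odd p) (hn : 2 ≤ n)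
    (E F : Type) [Field E] [Field F] [Algebra ℚ_[p] E] [Algebra E F]
    [Algebra ℚ_[p] F] [IsScalarTower ℚ_[p] E F] [FiniteDimensional ℚ_[p] E]
    (ζ : F) (hζ : IsPrimitiveRoot ζ (p ^ n))
    (hF : IntermediateField.adjoin E {ζ} = ⊤)
    (v : AddValuation F (WithTop ℤ))
    (hv1 : v (1 - ζ) = (1 : WithTop ℤ))
    (hvp : v ((p : F)) = (((p : ℤ) ^ (n - 1) * ((p : ℤ) - 1) : ℤ) : WithTop ℤ))
    (hunram : ∀ x : E, x ≠ 0 →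
      ∃ k : ℤ, v (algebraMap E F x) = ((((p : ℤ) ^ (n - 1) * ((p : ℤ) - 1)) * k : ℤ) : WithTop ℤ))
    (γ : F ≃ₐ[E] F) (hγ : γ ζ = ζ ^ (1 + p))
    (x : F) (hxu : v x = (0 : WithTop ℤ)) (hx1 : x ≠ 1)
    (t : ℕ) (ht : 1 ≤ t) (hvx : v (x - 1) = ((t : ℤ) : WithTop ℤ)) :
    (¬ (p ∣ t) → v (γ x - x) = (((t : ℤ) + (p : ℤ) - 1 : ℤ) : WithTop ℤ)) ∧
      ((p ∣ t) → (((t : ℤ) + (p : ℤ) - 1 : ℤ) : WithTop ℤ) < v (γ x - x)) := by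
  have hpp : p.Prime := Fact.out
  set l : F := ζ - 1 with hl_def
  have hζl : ζ = 1 + l := by rw [hl_def]; ring
  have hl : v l = ((1 : ℤ) : WithTop ℤ) := by
    rw [hl_def, v.map_sub_swap, hv1]
    rfl
  have hl0 : l ≠ 0 := v.ne_top_iff.mp (by rw [hl]; exact WithTop.coe_ne_top)
  have htwo : (2 : ℤ) ≤ p := by exact_mod_cast hpp.two_le
  obtain ⟨d, rfl⟩ := Nat.exists_eq_add_of_le' hn
  set e : ℕ := p ^ (d + 1) * (p - 1) with he_def
  have he : ((p : ℤ) ^ (d + 2 - 1) * ((p : ℤ) - 1)) = (e : ℤ) := by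
    rw [he_def]
    push_cast [hpp.one_le]
    rfl
  rw [he] at hvp
  simp only [he] at hunram
  have hpe : p ∣ e := Dvd.dvd.mul_right (dvd_pow_self p (by omega)) _
  have hple : p ≤ e := Nat.le_of_dvd
    (Nat.mul_pos (pow_pos hpp.pos _) (Nat.sub_pos_of_lt hpp.one_lt)) hpe
  have hvp' : ((p : ℤ) : WithTop ℤ) ≤ v (p : F) := by rw [hvp]; exact_mod_cast hple
  have hvp0 : 0 < v (p : F) := lt_of_lt_of_le (by exact_mod_cast hpp.pos) hvp'
  have hζp := v.map_one_add_pow_prime_sub_one hpp hl hvp'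
  rw [← hζl] at hζp
  have hvζ : v ζ = 0 := by
    rw [hζl, v.map_add_eq_of_lt_left, v.map_one]
    rw [v.map_one, hl]
    exact_mod_cast zero_lt_one
  set u : F := ζ * (ζ ^ p - 1) / l with hu_def
  have hul : l * u = ζ * (ζ ^ p - 1) := by rw [hu_def]; field_simp
  have hγl : γ l = l * (1 + u) := by
    rw [mul_add, hul, hl_def, map_sub, hγ, map_one]
    ring
  have hvlu : v l + v u = ((p : ℤ) : WithTop ℤ) := by
    rw [← v.map_mul, hul, v.map_mul, hvζ, zero_add, hζp]
  have hu0 : u ≠ 0 := by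
    rintro h
    rw [h, v.map_zero, add_top] at hvlu
    exact WithTop.top_ne_coe hvlu
  have hvu : v u = (((p : ℤ) - 1 : ℤ) : WithTop ℤ) := by
    obtain ⟨a, ha⟩ := WithTop.ne_top_iff_exists.mp (v.ne_top_iff.mpr hu0)
    rw [hl, ← ha, ← WithTop.coe_add, WithTop.coe_inj] at hvlu
    rw [← ha, WithTop.coe_inj]
    omega
  have hupos : 0 < v u := by
    rw [hvu]
    exact_mod_cast (by omega : (0 : ℤ) < p - 1)
  obtain ⟨a, ha⟩ := hζ.exists_eq_sum_sub_one_pow (pow_pos hpp.pos _) hF (x - 1)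
  rw [Nat.totient_prime_pow_succ hpp, ← he_def, ← hl_def] at ha
  set f : ℕ → F := fun i => algebraMap E F (a i) * l ^ i with hf_def
  have hvf : ∀ i, f i ≠ 0 → ∃ k : ℤ, v (f i) = ((e * k + i : ℤ) : WithTop ℤ) := by
    intro i hi
    have hai : a i ≠ 0 := by
      rintro h
      simp [hf_def, h] at hi
    obtain ⟨k, hk⟩ := hunram _ hai
    refine ⟨k, ?_⟩
    rw [hf_def, v.map_mul, hk, v.map_pow, hl, ← WithTop.coe_nsmul, ← WithTop.coe_add]
    simp
  have hdist : ∀ i ∈ Finset.range e, ∀ j ∈ Finset.range e, i ≠ j → f i ≠ 0 →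
      v (f i) ≠ v (f j) := by
    intro i hi j hj hij hi0 h
    have hj0 : f j ≠ 0 := v.ne_top_iff.mp (h ▸ v.ne_top_iff.mpr hi0)
    obtain ⟨k, hk⟩ := hvf i hi0
    obtain ⟨k', hk'⟩ := hvf j hj0
    rw [hk, hk', WithTop.coe_inj] at h
    have hmod : (i : ℤ) % e = j % e := by
      have := congrArg (· % (e : ℤ)) h
      simpa using this
    rw [Finset.mem_range] at hi hj
    rw [← Int.natCast_mod, ← Int.natCast_mod, Nat.mod_eq_of_lt hi, Nat.mod_eq_of_lt hj] at hmod
    exact hij (by exact_mod_cast hmod)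
  have hsum0 : ∑ i ∈ Finset.range e, f i ≠ 0 := ha ▸ sub_ne_zero.mpr hx1
  obtain ⟨i, hi, hvi, hlt⟩ := v.exists_map_eq_map_sum_of_distinct hdist hsum0
  rw [← ha, hvx] at hvi
  have hdvd : p ∣ i ↔ p ∣ t := by
    obtain ⟨k, hk⟩ := hvf i (v.ne_top_iff.mp (by rw [hvi]; exact WithTop.coe_ne_top))
    rw [hvi, WithTop.coe_inj] at hk
    have hpek : (p : ℤ) ∣ e * k := Dvd.dvd.mul_right (by exact_mod_cast hpe) _
    rw [← Int.natCast_dvd_natCast, ← Int.natCast_dvd_natCast (n := t), hk]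
    exact (dvd_add_right hpek).symm
  have hγf : ∀ j, γ (f j) - f j = f j * ((1 + u) ^ j - 1) := by
    intro j
    simp only [hf_def, map_mul, map_pow, AlgEquiv.commutes, hγl, mul_pow]
    ring
  have hγx : γ x - x = f i * ((1 + u) ^ i - 1) +
      ∑ j ∈ (Finset.range e).erase i, f j * ((1 + u) ^ j - 1) := by
    have : γ x - x = γ (x - 1) - (x - 1) := by rw [map_sub, map_one]; ring
    rw [this, ha, map_sum, ← Finset.sum_sub_distrib, Finset.sum_congr rfl fun j _ => hγf j]
    exact (Finset.add_sum_erase _ _ hi).symm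
  have hs : (((t : ℤ) + (p : ℤ) - 1 : ℤ) : WithTop ℤ) =
      ((t : ℤ) : WithTop ℤ) + (((p : ℤ) - 1 : ℤ) : WithTop ℤ) := by
    rw [← WithTop.coe_add, add_sub_assoc]
  have hrest : (((t : ℤ) + (p : ℤ) - 1 : ℤ) : WithTop ℤ) <
      v (∑ j ∈ (Finset.range e).erase i, f j * ((1 + u) ^ j - 1)) := by
    refine v.map_lt_sum WithTop.coe_ne_top fun j hj => ?_
    have hj := hlt j (Finset.mem_of_mem_erase hj) (Finset.ne_of_mem_erase hj)
    rw [hvi] at hj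
    have hle : v u ≤ v ((1 + u) ^ j - 1) := by
      by_cases h : p ∣ j
      · exact (v.lt_map_one_add_pow_sub_one_of_dvd hvp0 hupos hu0 h).le
      · exact (v.map_one_add_pow_sub_one_of_coprime hvp0 hupos
          ((Nat.Prime.coprime_iff_not_dvd hpp).mpr h)).ge
    rw [hvu] at hle
    rw [v.map_mul, hs]
    exact WithTop.add_lt_add_of_lt_of_le WithTop.coe_ne_top hj hle
  rw [hγx]
  constructor
  · intro h
    have hterm : v (f i * ((1 + u) ^ i - 1)) = (((t : ℤ) + (p : ℤ) - 1 : ℤ) : WithTop ℤ) := by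
      rw [v.map_mul, hvi, v.map_one_add_pow_sub_one_of_coprime hvp0 hupos
        ((Nat.Prime.coprime_iff_not_dvd hpp).mpr (mt hdvd.mp h)), hvu, hs]
    rw [v.map_add_eq_of_lt_left (hterm ▸ hrest), hterm]
  · intro h
    refine v.map_lt_add ?_ hrest
    have := v.lt_map_one_add_pow_sub_one_of_dvd hvp0 hupos hu0 (hdvd.mpr h)
    rw [hvu] at this
    rw [v.map_mul, hvi, hs]
    exact (WithTop.add_lt_add_iff_left WithTop.coe_ne_top).mpr this
end

section
/- Assume n ≥ 2. Then for every prime element π of F (i.e., π ∈ O_F with v_F(π) = 1), one has v_F(γ(π)/π − 1) = p − 1; equivalently, v_F(γ(π) − π) = p. -/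
open Polynomial in
/-- If the cyclotomic field `F` is generated by `ζ`, every element is a polynomial in `1 - ζ` of
degree less than `φ(p ^ n) = p ^ (n - 1) * (p - 1)`. -/
theorem exists_eq_sum_range_one_sub_primitiveRoot {p n : ℕ} (hp : p.Prime) (hn : 0 < n)
    {E F : Type*} [Field E] [Field F] [Algebra E F] {ζ : F} (hζ : IsPrimitiveRoot ζ (p ^ n))
    (hF : IntermediateField.adjoin E {ζ} = ⊤) (x : F) :
    ∃ a : ℕ → E, x = ∑ i ∈ Finset.range (p ^ (n - 1) * (p - 1)),
      algebraMap E F (a i) * (1 - ζ) ^ i := by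
  have hpos : 0 < p ^ n := pow_pos hp.pos n
  have hint : IsIntegral E ζ := hζ.isIntegral hpos |>.tower_top
  have hx : x ∈ (IntermediateField.adjoin E {ζ}).toSubalgebra := by
    rw [hF]; trivial
  rw [IntermediateField.adjoin_simple_toSubalgebra_of_isAlgebraic hint.isAlgebraic,
    Algebra.adjoin_singleton_eq_range_aeval] at hx
  obtain ⟨f, rfl⟩ := hx
  set L : E[X] := 1 - X with hL
  have hLdeg : L.natDegree = 1 := by
    have : L = C (-1) * X + C 1 := by rw [hL]; simp; ring
    rw [this]; exact natDegree_linear (by simp)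
  have hev : aeval (1 - ζ) L = ζ := by simp [hL]
  set Q := (cyclotomic (p ^ n) E).comp L with hQ
  have hQdeg : Q.natDegree = p ^ (n - 1) * (p - 1) := by
    rw [hQ, natDegree_comp, hLdeg, natDegree_cyclotomic, Nat.totient_prime_pow hp hn, mul_one]
  have hroot : aeval (1 - ζ) Q = 0 := by
    rw [hQ, aeval_comp, hev, aeval_def, ← eval_map, map_cyclotomic]
    exact hζ.isRoot_cyclotomic hpos
  have hQpos : Q.natDegree ≠ 0 := by
    rw [hQdeg]
    exact (Nat.mul_pos (pow_pos hp.pos _) (Nat.sub_pos_of_lt hp.one_lt)).ne'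
  have hlt : (f.comp L % Q).natDegree < p ^ (n - 1) * (p - 1) :=
    hQdeg ▸ natDegree_mod_lt _ hQpos
  refine ⟨(f.comp L % Q).coeff, ?_⟩
  have h1 : aeval (1 - ζ) (f.comp L % Q) = aeval ζ f := by
    have h2 := congrArg (aeval (1 - ζ)) (EuclideanDomain.div_add_mod (f.comp L) Q)
    rw [map_add, map_mul, hroot, zero_mul, zero_add, aeval_comp, hev] at h2
    exact h2
  rw [aeval_eq_sum_range' hlt] at h1
  simpa [Algebra.smul_def] using h1.symm

namespace AddValuation

theorem natCast_nonneg {K : Type*} [Field K] (v : AddValuation K (WithTop ℤ)) (m : ℕ) :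
    0 ≤ v (m : K) := by
  induction m with
  | zero => simp
  | succ k ih =>
    rw [Nat.cast_succ]
    exact v.map_le_add ih (by simp)

/-- The value of a sum whose nonzero terms have distinct values is at most that of each term. -/
theorem map_sum_le_of_distinct {K ι : Type*} [Field K] (v : AddValuation K (WithTop ℤ))
    (s : Finset ι) (f : ι → K)
    (h : ∀ i ∈ s, ∀ j ∈ s, f i ≠ 0 → v (f i) = v (f j) → i = j) :
    ∀ j ∈ s, v (∑ i ∈ s, f i) ≤ v (f j) := by
  classical
  intro j hj
  obtain ⟨m, hm, hmin⟩ := s.exists_min_image (fun i => v (f i)) ⟨j, hj⟩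
  refine le_trans ?_ (hmin j hj)
  by_cases h0 : f m = 0
  · simp [h0]
  have hlt : v (f m) < v (∑ i ∈ s.erase m, f i) := by
    refine v.map_lt_sum (v.ne_top_iff.2 h0) fun i hi => ?_
    obtain ⟨him, his⟩ := Finset.mem_erase.1 hi
    exact lt_of_le_of_ne (hmin i his) fun he => him (h m hm i his h0 he).symm
  rw [← Finset.add_sum_erase s f hm, v.map_add_eq_of_lt_left hlt]

theorem map_eq_zero_of_pow_eq_one {K : Type*} [Field K] (v : AddValuation K (WithTop ℤ))
    {x : K} {m : ℕ} (hm : m ≠ 0) (hx : x ^ m = 1) : v x = 0 := by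
  have h0 : x ≠ 0 := by
    rintro rfl
    simp [hm] at hx
  have h1 : m • v x = 0 := by rw [← v.map_pow, hx, v.map_one]
  obtain ⟨k, hk⟩ := WithTop.ne_top_iff_exists.1 (v.ne_top_iff.2 h0)
  rw [← hk] at h1 ⊢
  have h2 : ((m • k : ℤ) : WithTop ℤ) = ((0 : ℤ) : WithTop ℤ) := by
    rw [WithTop.coe_nsmul]; exact h1
  have h3 := WithTop.coe_injective h2
  have h4 : k = 0 := by simpa [hm] using h3
  rw [h4]; rfl

/-- If `v (1 - ζ) = 1`, `ζ` is a unit and `p < v p`, then `v (1 - ζ ^ p) = p`. -/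
theorem map_one_sub_pow_prime {K : Type*} [Field K] (v : AddValuation K (WithTop ℤ)) {p : ℕ}
    (hp : p.Prime) {ζ : K} (hζ : v ζ = 0) (h1 : v (1 - ζ) = (1 : WithTop ℤ))
    (hvp : ((p : ℤ) : WithTop ℤ) < v (p : K)) : v (1 - ζ ^ p) = ((p : ℤ) : WithTop ℤ) := by
  have key := add_pow_prime_eq hp ζ (1 - ζ)
  set S := ∑ k ∈ Finset.Ioo 0 p, ζ ^ (k - 1) * (1 - ζ) ^ (p - k - 1) * ↑(p.choose k / p) with hS
  have hS0 : 0 ≤ v S := by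
    refine v.map_le_sum fun k _ => ?_
    rw [v.map_mul, v.map_mul, v.map_pow, v.map_pow, hζ, h1]
    refine add_nonneg (add_nonneg (by simp) (nsmul_nonneg zero_le_one _)) (v.natCast_nonneg _)
  have hpow : v ((1 - ζ) ^ p) = ((p : ℤ) : WithTop ℤ) := by
    rw [v.map_pow, h1, nsmul_one]; rfl
  have heq : 1 - ζ ^ p = (1 - ζ) ^ p + p * ζ * (1 - ζ) * S := by
    rw [add_sub_cancel, one_pow] at key
    linear_combination key
  rw [heq, v.map_add_eq_of_lt_left, hpow]
  rw [hpow, v.map_mul, v.map_mul, v.map_mul, hζ, h1, add_zero, add_assoc]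
  exact lt_of_lt_of_le hvp (le_add_of_nonneg_right (add_nonneg zero_le_one hS0))

theorem le_map_one_add_pow_sub_one {K : Type*} [Field K] (v : AddValuation K (WithTop ℤ))
    {u : K} (hu : 0 ≤ v u) (i : ℕ) : v u ≤ v ((1 + u) ^ i - 1) := by
  have h1u : 0 ≤ v (1 + u) := v.map_le_add (by simp) hu
  rw [← mul_geom_sum, v.map_mul, add_sub_cancel_left]
  refine le_add_of_nonneg_right (v.map_le_sum fun k _ => ?_)
  rw [v.map_pow]
  exact nsmul_nonneg h1u k

end AddValuation

/-- Assume `n ≥ 2`.  For every prime element `π` of `F`,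
`v_F(γ(π)/π - 1) = p - 1`, equivalently `v_F(γ(π) - π) = p`, where `γ ∈ Gal(F/E)`
satisfies `γ(ζ_{p^n}) = ζ_{p^n}^{1+p}`. -/
theorem gamma_on_prime_element (p n : ℕ) [Fact p.Prime] (hp : Odd p) (hn : 2 ≤ n)
    (E F : Type) [Field E] [Field F] [Algebra ℚ_[p] E] [Algebra E F]
    [Algebra ℚ_[p] F] [IsScalarTower ℚ_[p] E F] [FiniteDimensional ℚ_[p] E]
    (ζ : F) (hζ : IsPrimitiveRoot ζ (p ^ n))
    (hF : IntermediateField.adjoin E {ζ} = ⊤)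
    (v : AddValuation F (WithTop ℤ))
    (hv1 : v (1 - ζ) = (1 : WithTop ℤ))
    (hvp : v ((p : F)) = (((p : ℤ) ^ (n - 1) * ((p : ℤ) - 1) : ℤ) : WithTop ℤ))
    (hunram : ∀ x : E, x ≠ 0 →
      ∃ k : ℤ, v (algebraMap E F x) = ((((p : ℤ) ^ (n - 1) * ((p : ℤ) - 1)) * k : ℤ) : WithTop ℤ))
    (γ : F ≃ₐ[E] F) (hγ : γ ζ = ζ ^ (1 + p))
    (π : F) (hπ : v π = (1 : WithTop ℤ)) :
    v (γ π / π - 1) = (((p : ℤ) - 1 : ℤ) : WithTop ℤ) ∧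
      v (γ π - π) = (((p : ℤ) : ℤ) : WithTop ℤ) := by
  have hpp : p.Prime := Fact.out
  have hp3 : 3 ≤ p := by
    have := hpp.two_le
    obtain ⟨k, hk⟩ := hp
    omega
  set e : ℤ := (p : ℤ) ^ (n - 1) * ((p : ℤ) - 1) with he
  have hecast : ((p ^ (n - 1) * (p - 1) : ℕ) : ℤ) = e := by
    rw [he, Nat.cast_mul, Nat.cast_pow, Nat.cast_sub hpp.one_le, Nat.cast_one]
  have hep : (p : ℤ) < e := by
    have h3 : (3 : ℤ) ≤ p := by exact_mod_cast hp3
    have h1 : (p : ℤ) ≤ (p : ℤ) ^ (n - 1) := le_self_pow₀ (by linarith) (by omega)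
    nlinarith
  have hζ0 : v ζ = 0 := v.map_eq_zero_of_pow_eq_one (pow_pos hpp.pos n).ne' hζ.pow_eq_one
  have hζp : v (1 - ζ ^ p) = ((p : ℤ) : WithTop ℤ) :=
    v.map_one_sub_pow_prime hpp hζ0 hv1 (by rw [hvp]; exact WithTop.coe_lt_coe.2 hep)
  have hl0 : 1 - ζ ≠ 0 := v.ne_top_iff.1 (by rw [hv1]; exact WithTop.coe_ne_top)
  have hπ0 : π ≠ 0 := v.ne_top_iff.1 (by rw [hπ]; exact WithTop.coe_ne_top)
  have hcancel : ∀ {x y : F}, v y = (1 : WithTop ℤ) → v (y * x) = ((p : ℤ) : WithTop ℤ) →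
      v x = (((p : ℤ) - 1 : ℤ) : WithTop ℤ) := by
    intro x y hy hxy
    have hx : v x ≠ ⊤ := by
      intro hx
      rw [v.map_mul, hx, add_top] at hxy
      exact WithTop.coe_ne_top hxy.symm
    obtain ⟨k, hk⟩ := WithTop.ne_top_iff_exists.1 hx
    rw [v.map_mul, hy, ← hk] at hxy
    have h : 1 + k = (p : ℤ) := WithTop.coe_injective hxy
    rw [← hk, ← h, add_sub_cancel_left]
  set u := γ (1 - ζ) / (1 - ζ) - 1 with hu
  have hγl : γ (1 - ζ) = (1 - ζ) * (1 + u) := by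
    rw [hu]; field_simp; ring
  have hlu : (1 - ζ) * u = ζ * (1 - ζ ^ p) := by
    have h : γ (1 - ζ) = 1 - ζ ^ (1 + p) := by rw [map_sub, map_one, hγ]
    rw [hγl, pow_add, pow_one] at h
    linear_combination h
  have hvu : v u = (((p : ℤ) - 1 : ℤ) : WithTop ℤ) :=
    hcancel hv1 (by rw [hlu, v.map_mul, hζ0, zero_add, hζp])
  have hvu0 : 0 ≤ v u := by
    rw [hvu]
    exact WithTop.coe_le_coe.2 (by have := hpp.one_le; omega)
  obtain ⟨a, ha⟩ := exists_eq_sum_range_one_sub_primitiveRoot hpp (by omega) hζ hF π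
  set s := Finset.range (p ^ (n - 1) * (p - 1)) with hs
  set A : ℕ → F := fun i => algebraMap E F (a i) * (1 - ζ) ^ i with hA
  have hval : ∀ i, A i ≠ 0 → ∃ k : ℤ, v (A i) = ((e * k + i : ℤ) : WithTop ℤ) := by
    intro i hi
    have hai : a i ≠ 0 := by
      rintro h
      exact hi (by simp [hA, h])
    obtain ⟨k, hk⟩ := hunram (a i) hai
    refine ⟨k, ?_⟩
    rw [hA, v.map_mul, hk, v.map_pow, hv1, nsmul_one]
    rfl
  have hmod : ∀ i ∈ s, ∀ j ∈ s, ∀ k l : ℤ, e * k + i = e * l + j → i = j := by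
    intro i hi j hj k l h
    have hi' : (i : ℤ) < e := by rw [← hecast]; exact_mod_cast Finset.mem_range.1 hi
    have hj' : (j : ℤ) < e := by rw [← hecast]; exact_mod_cast Finset.mem_range.1 hj
    have h2 := congrArg (· % e) h
    simp only [Int.mul_add_emod_self_left] at h2
    rw [Int.emod_eq_of_lt (by positivity) hi', Int.emod_eq_of_lt (by positivity) hj'] at h2
    exact_mod_cast h2
  have h1s : 1 ∈ s := by
    rw [hs, Finset.mem_range]
    have : (1 : ℤ) < (p ^ (n - 1) * (p - 1) : ℕ) := by
      rw [hecast]; have := hpp.one_le; omega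
    exact_mod_cast this
  have hge : ∀ i ∈ s, (1 : WithTop ℤ) ≤ v (A i) := by
    rw [← hπ, ha]
    refine v.map_sum_le_of_distinct s A fun i hi j hj hi0 hij => ?_
    have hj0 : A j ≠ 0 := v.ne_top_iff.1 (hij ▸ v.ne_top_iff.2 hi0)
    obtain ⟨k, hk⟩ := hval i hi0
    obtain ⟨l, hl⟩ := hval j hj0
    rw [hk, hl] at hij
    exact hmod i hi j hj k l (WithTop.coe_injective hij)
  have hgt : ∀ i ∈ s.erase 1, (1 : WithTop ℤ) < v (A i) := by
    intro i hi
    obtain ⟨hi1, his⟩ := Finset.mem_erase.1 hi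
    refine lt_of_le_of_ne (hge i his) fun h => hi1 ?_
    obtain ⟨k, hk⟩ := hval i (v.ne_top_iff.1 (h ▸ WithTop.coe_ne_top))
    rw [hk] at h
    have h' : (1 : ℤ) = e * k + i := WithTop.coe_injective h
    refine hmod i his 1 h1s k 0 ?_
    rw [← h']; simp
  have hA1 : v (A 1) = (1 : WithTop ℤ) := by
    have hlt : v π < v (A 1 - π) := by
      rw [v.map_sub_swap, hπ, sub_eq_of_eq_add' ((ha.trans (Finset.add_sum_erase s A h1s).symm))]
      exact v.map_lt_sum WithTop.coe_ne_top hgt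
    rw [v.map_eq_of_lt_sub hlt, hπ]
  have hγA : ∀ i, γ (A i) - A i = A i * ((1 + u) ^ i - 1) := by
    intro i
    simp only [hA, map_mul, map_pow, AlgEquiv.commutes, hγl, mul_pow]
    ring
  have hmain : v (γ π - π) = ((p : ℤ) : WithTop ℤ) := by
    have hsum : γ π - π = A 1 * u + ∑ i ∈ s.erase 1, A i * ((1 + u) ^ i - 1) := by
      rw [ha, map_sum, ← Finset.sum_sub_distrib, ← Finset.add_sum_erase s _ h1s, hγA 1]
      congr 1
      · ring
      · exact Finset.sum_congr rfl fun i _ => hγA i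
    have h1 : v (A 1 * u) = ((p : ℤ) : WithTop ℤ) := by
      rw [v.map_mul, hA1, hvu]
      exact congrArg _ (add_sub_cancel 1 (p : ℤ))
    rw [hsum, v.map_add_eq_of_lt_left, h1]
    refine v.map_lt_sum (h1 ▸ WithTop.coe_ne_top) fun i hi => ?_
    rw [v.map_mul (A 1) u, hA1, v.map_mul (A i)]
    refine lt_of_lt_of_le ?_ (add_le_add_right (v.le_map_one_add_pow_sub_one hvu0 i) _)
    exact WithTop.add_lt_add_right (hvu ▸ WithTop.coe_ne_top) (hgt i hi)
  refine ⟨hcancel hπ ?_, hmain⟩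
  rw [mul_sub, mul_div_cancel₀ _ hπ0, mul_one, hmain]
end

section
/- Let a, b, and j be nonnegative integers with 1 ≤ j ≤ n−1 and a < p^{n−j}. If u ∈ O_F^× satisfies v_F(u − 1) ≥ a + b, then v_F(u^{p^j} − 1) ≥ p^j·a + b. -/
namespace AddValuation

variable {R Γ : Type*} [CommRing R] [LinearOrderedAddCommMonoidWithTop Γ]

/-- The subring of elements of nonnegative additive valuation. -/
def nonnegSubring (v : AddValuation R Γ) : Subring R where
  carrier := {x | 0 ≤ v x}
  mul_mem' hx hy := by
    rw [Set.mem_ofPred_eq, v.map_mul]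
    exact add_nonneg hx hy
  one_mem' := v.map_one.ge
  add_mem' hx hy := v.map_le_add hx hy
  zero_mem' := by simp
  neg_mem' hx := by rwa [Set.mem_ofPred_eq, v.map_neg]

theorem min_le_map_one_add_pow_prime_sub_one (v : AddValuation R Γ) {p : ℕ} (hp : p.Prime)
    {x : R} (hx : 0 ≤ v x) :
    min (p • v x) (v p + v x) ≤ v ((1 + x) ^ p - 1) := by
  obtain ⟨r, hr⟩ := exists_add_pow_prime_eq hp (1 : v.nonnegSubring) ⟨x, hx⟩
  have h := congrArg Subtype.val hr
  push_cast at h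
  have h' : (1 + x) ^ p - 1 = x ^ p + p * x * r := by
    rw [h]; ring
  rw [h']
  refine v.map_le_add ?_ ?_
  · rw [v.map_pow]
    exact min_le_left _ _
  · rw [v.map_mul, v.map_mul]
    exact (min_le_right _ _).trans (le_add_of_nonneg_right r.2)

end AddValuation


/-- For nonnegative integers `a, b, j` with `1 ≤ j ≤ n-1` and
`a < p^{n-j}`: if `u ∈ O_F^×` satisfies `v_F(u - 1) ≥ a + b`, then
`v_F(u^{p^j} - 1) ≥ p^j·a + b`. -/
theorem pow_raises_level (p n : ℕ) [Fact p.Prime] (hp : Odd p) (hn : 1 ≤ n)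
    (E F : Type) [Field E] [Field F] [Algebra ℚ_[p] E] [Algebra E F]
    [Algebra ℚ_[p] F] [IsScalarTower ℚ_[p] E F] [FiniteDimensional ℚ_[p] E]
    (ζ : F) (hζ : IsPrimitiveRoot ζ (p ^ n))
    (hF : IntermediateField.adjoin E {ζ} = ⊤)
    (v : AddValuation F (WithTop ℤ))
    (hv1 : v (1 - ζ) = (1 : WithTop ℤ))
    (hvp : v ((p : F)) = (((p : ℤ) ^ (n - 1) * ((p : ℤ) - 1) : ℤ) : WithTop ℤ))
    (hunram : ∀ x : E, x ≠ 0 →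
      ∃ k : ℤ, v (algebraMap E F x) = ((((p : ℤ) ^ (n - 1) * ((p : ℤ) - 1)) * k : ℤ) : WithTop ℤ))
    (a b j : ℕ) (hj1 : 1 ≤ j) (hjn : j ≤ n - 1) (ha : a < p ^ (n - j))
    (u : F) (hu : v u = (0 : WithTop ℤ))
    (huv : (((a : ℤ) + (b : ℤ) : ℤ) : WithTop ℤ) ≤ v (u - 1)) :
    ((((p : ℤ) ^ j * (a : ℤ) + (b : ℤ) : ℤ)) : WithTop ℤ) ≤ v (u ^ (p ^ j) - 1) := by
  have hpp : p.Prime := Fact.out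
  have hp1 : (1 : ℤ) ≤ p := by exact_mod_cast hpp.one_le
  have key : ∀ i ≤ j, (((p : ℤ) ^ i * (a : ℤ) + (b : ℤ) : ℤ) : WithTop ℤ) ≤
      v (u ^ (p ^ i) - 1) := by
    intro i
    induction i with
    | zero => simpa using huv
    | succ i ih =>
      intro hi
      have hm := ih (by omega)
      set m : ℤ := (p : ℤ) ^ i * (a : ℤ) + (b : ℤ)
      have hm0 : 0 ≤ m := by positivity
      have hle : (p : ℤ) ^ i * a ≤ (p : ℤ) ^ (n - 1) := by
        have : p ^ i * a ≤ p ^ (n - 1) :=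
          calc p ^ i * a ≤ p ^ i * p ^ (n - j) := Nat.mul_le_mul_left _ ha.le
            _ = p ^ (i + (n - j)) := (pow_add _ _ _).symm
            _ ≤ p ^ (n - 1) := Nat.pow_le_pow_right hpp.pos (by omega)
        exact_mod_cast this
      have hstep := v.min_le_map_one_add_pow_prime_sub_one hpp
        (le_trans (by exact_mod_cast hm0) hm)
      rw [add_sub_cancel, ← pow_mul, ← pow_succ] at hstep
      refine le_trans (le_min ?_ ?_) hstep
      · refine le_trans ?_ (nsmul_le_nsmul_right hm p)
        rw [← WithTop.coe_nsmul, WithTop.coe_le_coe, nsmul_eq_mul]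
        have hb : (0 : ℤ) ≤ (p - 1) * b := mul_nonneg (by omega) (by positivity)
        simp only [m, pow_succ]
        linarith
      · rw [hvp]
        refine le_trans ?_ (add_le_add_right hm _)
        rw [← WithTop.coe_add, WithTop.coe_le_coe]
        have := mul_le_mul_of_nonneg_right hle (sub_nonneg.2 hp1)
        simp only [m, pow_succ]
        linarith
  exact key j le_rfl
end

section
/- Let p be a prime and n ≥ 1 an integer. In the polynomial ring ℤ_p[Y] over the p-adic integers, the polynomial (Y+1)^{p^{n−1}} − 1 lies in the ideal generated by the elements p^{n−1−k}·Y^{p^k} for 0 ≤ k ≤ n−1 (that is, the ideal (p^{n−1}Y, p^{n−2}Y^p, p^{n−3}Y^{p^2}, …, Y^{p^{n−1}})). -/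
/-- For `0 < j ≤ p ^ m`, the binomial coefficient `(p ^ m).choose j` is divisible by
`p ^ (m - v)`, where `v` is the `p`-adic valuation of `j`. -/
theorem Nat.Prime.pow_sub_factorization_dvd_choose_prime_pow {p m j : ℕ} (hp : p.Prime)
    (hj : j ≤ p ^ m) (hj0 : j ≠ 0) : p ^ (m - j.factorization p) ∣ (p ^ m).choose j := by
  rw [← Nat.factorization_choose_prime_pow hp hj hj0]
  exact Nat.ordProj_dvd _ _

/-- An ideal containing `p ^ (m - k) * x ^ (p ^ k)` for all `k ≤ m` contains
`(x + 1) ^ (p ^ m) - 1`. -/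
theorem Ideal.add_one_pow_prime_pow_sub_one_mem {R : Type*} [CommRing R] {p : ℕ} (hp : p.Prime)
    (m : ℕ) (x : R) (I : Ideal R) (hI : ∀ k ≤ m, (p : R) ^ (m - k) * x ^ (p ^ k) ∈ I) :
    (x + 1) ^ (p ^ m) - 1 ∈ I := by
  rw [add_pow, Finset.sum_range_succ']
  simp only [one_pow, mul_one, pow_zero, Nat.choose_zero_right, Nat.cast_one, add_sub_cancel_right]
  refine Ideal.sum_mem _ fun i hi => ?_
  have hj : i + 1 ≤ p ^ m := Finset.mem_range.mp hi
  have hv : p ^ (i + 1).factorization p ≤ i + 1 :=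
    Nat.le_of_dvd i.succ_pos (Nat.ordProj_dvd _ _)
  have hk : (i + 1).factorization p ≤ m :=
    (Nat.pow_le_pow_iff_right hp.one_lt).mp (hv.trans hj)
  refine Ideal.mem_of_dvd _ ?_ (hI _ hk)
  rw [mul_comm (x ^ _)]
  refine mul_dvd_mul ?_ (pow_dvd_pow _ hv)
  simpa using Nat.cast_dvd_cast (α := R)
    (hp.pow_sub_factorization_dvd_choose_prime_pow hj i.succ_ne_zero)

/-- In `ℤ_p[Y]`, the polynomial `(Y+1)^{p^{n-1}} - 1` lies in the ideal
`(p^{n-1}·Y, p^{n-2}·Y^p, …, Y^{p^{n-1}})`. -/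
theorem pow_sub_one_mem_span (p : ℕ) [Fact p.Prime] (n : ℕ) (hn : 1 ≤ n) :
    ((Polynomial.X + 1) ^ (p ^ (n - 1)) - 1 : Polynomial ℤ_[p]) ∈
      Ideal.span {g : Polynomial ℤ_[p] |
        ∃ k < n, g = Polynomial.C ((p : ℤ_[p]) ^ (n - 1 - k)) * Polynomial.X ^ (p ^ k)} := by
  refine Ideal.add_one_pow_prime_pow_sub_one_mem Fact.out _ _ _ fun k hk => ?_
  refine Ideal.subset_span ⟨k, by lia, ?_⟩
  rw [Polynomial.C_pow, Polynomial.C_eq_natCast]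
end

section
/- Let p be a prime, t ≥ 1 and m ≥ 0 integers. Let I be the ideal of ℤ_p[Y] generated by p^{m+1}, p^m·Y, and the elements p^{m−k}·Y^{p^{k−1}t} for 1 ≤ k ≤ m. Then the quotient ring ℤ_p[Y]/I is finite of cardinality p^h, where h = t·(p^{m−1} + p^{m−2} + ⋯ + p + 1) + 1 = t·(p^m − 1)/(p − 1) + 1. -/
open Polynomial in
/-- An ideal of `ℤ_p[Y]` cut out by divisibility of the `j`-th coefficient by `p ^ e j`, with `e`
vanishing from `N` on, has index `p ^ ∑ j < N, e j`. -/
theorem card_quotient_of_mem_iff_pow_dvd_coeff {p : ℕ} [Fact p.Prime] (e : ℕ → ℕ) (N : ℕ)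
    (hN : ∀ j, N ≤ j → e j = 0) (I : Ideal ℤ_[p][X])
    (hI : ∀ f, f ∈ I ↔ ∀ j, (p : ℤ_[p]) ^ e j ∣ f.coeff j) :
    Nat.card (ℤ_[p][X] ⧸ I) = p ^ ∑ j ∈ Finset.range N, e j := by
  let φ : ℤ_[p][X] →+ (∀ j : Fin N, ZMod (p ^ e j)) :=
    { toFun := fun f j => PadicInt.toZModPow (e j) (f.coeff j)
      map_zero' := by ext j; simp
      map_add' := fun f g => by ext j; simp }
  have hker : φ.ker = I.toAddSubgroup := by
    ext f
    have h : f ∈ φ.ker ↔ ∀ j : Fin N, (p : ℤ_[p]) ^ e j ∣ f.coeff j := by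
      rw [AddMonoidHom.mem_ker, funext_iff]
      refine forall_congr' fun j => ?_
      rw [← Ideal.mem_span_singleton, ← PadicInt.ker_toZModPow, RingHom.mem_ker]
      rfl
    rw [h, Submodule.mem_toAddSubgroup, hI]
    refine ⟨fun h j => ?_, fun h j => h j⟩
    by_cases hj : j < N
    · exact h ⟨j, hj⟩
    · simp [hN j (not_lt.mp hj)]
  have hsurj : Function.Surjective φ := by
    intro v
    choose a ha using fun j : Fin N => ZMod.ringHom_surjective (PadicInt.toZModPow (e j)) (v j)
    refine ⟨∑ j : Fin N, monomial j (a j), ?_⟩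
    ext j
    change PadicInt.toZModPow (e j) ((∑ i : Fin N, monomial (i : ℕ) (a i)).coeff j) = v j
    rw [finsetSum_coeff, Finset.sum_eq_single j, coeff_monomial_same, ha]
    · intro i _ hij
      exact coeff_monomial_of_ne _ fun h => hij (Fin.ext h.symm)
    · simp
  have hindex := AddSubgroup.index_ker φ
  rw [hker, AddMonoidHom.range_eq_top.mpr hsurj, AddSubgroup.card_top, Nat.card_pi] at hindex
  simp only [Nat.card_zmod] at hindex
  rw [Finset.prod_pow_eq_pow_sum, Fin.sum_univ_eq_sum_range] at hindex
  exact hindex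

/-- The `p`-adic valuation required of the `j`-th coefficient of an element of the ideal
`(p^{m+1}, p^m·Y, p^{m-k}·Y^{p^{k-1}t} for 1 ≤ k ≤ m)`. -/
def coeffExponent (p t m j : ℕ) : ℕ :=
  (if j = 0 then 1 else 0) + ((Finset.range m).filter fun k => j < p ^ k * t).card

theorem coeffExponent_antitone (p t m : ℕ) : Antitone (coeffExponent p t m) := by
  intro i j hij
  refine Nat.add_le_add (by split_ifs <;> omega) (Finset.card_le_card fun k => ?_)
  simp only [Finset.mem_filter]
  exact fun h => ⟨h.1, hij.trans_lt h.2⟩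

theorem coeffExponent_le (p t m j : ℕ) :
    coeffExponent p t m j ≤ (if j = 0 then 1 else 0) + m :=
  Nat.add_le_add_left ((Finset.card_filter_le _ _).trans_eq (Finset.card_range m)) _

theorem coeffExponent_zero {p t : ℕ} (m : ℕ) (hp : 0 < p) (ht : 0 < t) :
    coeffExponent p t m 0 = m + 1 := by
  rw [coeffExponent, Finset.filter_true_of_mem fun k _ => by positivity]
  simp [add_comm]

theorem coeffExponent_pow_mul_le {p t k : ℕ} (m : ℕ) (hp : 0 < p) (ht : 0 < t) (hk : 1 ≤ k) :
    coeffExponent p t m (p ^ (k - 1) * t) ≤ m - k := by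
  rw [coeffExponent, if_neg (by positivity), zero_add, ← Nat.card_Ico k m]
  refine Finset.card_le_card fun i hi => ?_
  simp only [Finset.mem_filter, Finset.mem_range, Finset.mem_Ico] at hi ⊢
  refine ⟨?_, hi.1⟩
  by_contra! h
  exact absurd hi.2 (not_lt.mpr (Nat.mul_le_mul_right t (Nat.pow_le_pow_right hp (by omega))))

theorem pow_mul_le_of_coeffExponent_lt {p t m j : ℕ} (hp : 0 < p)
    (h : coeffExponent p t m j < m) : p ^ (m - coeffExponent p t m j - 1) * t ≤ j := by
  by_contra! hj
  have hsub : Finset.Ico (m - coeffExponent p t m j - 1) m ⊆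
      (Finset.range m).filter fun k => j < p ^ k * t := fun i hi => by
    simp only [Finset.mem_filter, Finset.mem_range, Finset.mem_Ico] at hi ⊢
    exact ⟨hi.2, hj.trans_le (Nat.mul_le_mul_right t (Nat.pow_le_pow_right hp hi.1))⟩
  have hcard := Finset.card_le_card hsub
  have hle : ((Finset.range m).filter fun k => j < p ^ k * t).card ≤ coeffExponent p t m j :=
    Nat.le_add_left _ _
  rw [Nat.card_Ico] at hcard
  omega

theorem coeffExponent_eq_zero {p t m j : ℕ} (hp : 0 < p) (ht : 0 < t) (hj : p ^ m * t ≤ j) :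
    coeffExponent p t m j = 0 := by
  have hpos : 0 < p ^ m * t := by positivity
  rw [coeffExponent, if_neg (by omega), zero_add, Finset.card_eq_zero, Finset.filter_eq_empty_iff]
  intro k hk
  rw [not_lt]
  exact (Nat.mul_le_mul_right t (Nat.pow_le_pow_right hp (Finset.mem_range.mp hk).le)).trans hj

theorem sum_coeffExponent {p t : ℕ} (m : ℕ) (hp : 0 < p) (ht : 0 < t) :
    ∑ j ∈ Finset.range (p ^ m * t), coeffExponent p t m j =
      t * (∑ i ∈ Finset.range m, p ^ i) + 1 := by
  have hpos : 0 < p ^ m * t := by positivity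
  simp only [coeffExponent, Finset.sum_add_distrib, Finset.card_filter]
  rw [Finset.sum_ite_eq', if_pos (Finset.mem_range.mpr hpos), Finset.sum_comm, Finset.mul_sum,
    add_comm]
  congr 1
  refine Finset.sum_congr rfl fun k hk => ?_
  have hle : p ^ k * t ≤ p ^ m * t :=
    Nat.mul_le_mul_right t (Nat.pow_le_pow_right hp (Finset.mem_range.mp hk).le)
  have hfilter : ((Finset.range (p ^ m * t)).filter fun j => j < p ^ k * t) = Finset.range (p ^ k * t) := by
    ext j
    simp only [Finset.mem_filter, Finset.mem_range]
    omega
  rw [← Finset.card_filter, hfilter, Finset.card_range, mul_comm]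

open Polynomial in
/-- For antitone `e`, an ideal spanned by elements satisfying `a ^ e j ∣ f.coeff j` for all `j`
consists of such elements. -/
theorem pow_dvd_coeff_of_mem_span {R : Type*} [CommRing R] {a : R} {e : ℕ → ℕ} (he : Antitone e)
    {S : Set R[X]} (hS : ∀ f ∈ S, ∀ j, a ^ e j ∣ f.coeff j) {f : R[X]} (hf : f ∈ Ideal.span S)
    (j : ℕ) : a ^ e j ∣ f.coeff j := by
  induction hf using Submodule.span_induction generalizing j with
  | mem f hf => exact hS f hf j
  | zero => simp
  | add f g _ _ hf hg => rw [coeff_add]; exact dvd_add (hf j) (hg j)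
  | smul g f _ hf =>
    rw [smul_eq_mul, coeff_mul]
    refine Finset.dvd_sum fun x hx => Dvd.dvd.mul_left ((pow_dvd_pow a (he ?_)).trans (hf x.2)) _
    exact Finset.HasAntidiagonal.mem_antidiagonal.mp hx ▸ Nat.le_add_left _ _

open Polynomial in
theorem mem_span_iff_pow_coeffExponent_dvd_coeff {R : Type*} [CommRing R] (a : R) {p t : ℕ}
    (m : ℕ) (hp : 0 < p) (ht : 0 < t) (f : R[X]) :
    f ∈ Ideal.span ({C (a ^ (m + 1)), C (a ^ m) * X} ∪
        {g : R[X] | ∃ k, 1 ≤ k ∧ k ≤ m ∧ g = C (a ^ (m - k)) * X ^ (p ^ (k - 1) * t)}) ↔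
      ∀ j, a ^ coeffExponent p t m j ∣ f.coeff j := by
  constructor
  · refine fun hf => pow_dvd_coeff_of_mem_span (coeffExponent_antitone p t m) ?_ hf
    have hmonomial : ∀ b n : ℕ, coeffExponent p t m n ≤ b →
        ∀ j, a ^ coeffExponent p t m j ∣ (C (a ^ b) * X ^ n : R[X]).coeff j := by
      intro b n hb j
      rw [coeff_C_mul_X_pow]
      split_ifs with h
      · exact pow_dvd_pow a (h ▸ hb)
      · exact dvd_zero _
    rintro g ((rfl | rfl) | ⟨k, hk, -, rfl⟩)
    · simpa using hmonomial (m + 1) 0 (coeffExponent_zero m hp ht).le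
    · simpa using hmonomial m 1 (by simpa using coeffExponent_le p t m 1)
    · exact hmonomial _ _ (coeffExponent_pow_mul_le m hp ht hk)
  · intro h
    rw [f.as_sum_range_C_mul_X_pow]
    refine Ideal.sum_mem _ fun j _ => ?_
    have hdvd : C (a ^ coeffExponent p t m j) * X ^ j ∣ C (f.coeff j) * X ^ j :=
      mul_dvd_mul_right (map_dvd C (h j)) _
    refine Ideal.mem_of_dvd _ hdvd ?_
    rcases Nat.eq_zero_or_pos j with rfl | hj
    · rw [coeffExponent_zero m hp ht, pow_zero, mul_one]
      exact Ideal.subset_span (Or.inl (Or.inl rfl))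
    have hle : coeffExponent p t m j ≤ m := by
      simpa [hj.ne'] using coeffExponent_le p t m j
    rcases hle.eq_or_lt with heq | hlt
    · rw [heq]
      exact Ideal.mem_of_dvd _ (mul_dvd_mul_left _ (dvd_pow_self X hj.ne'))
        (Ideal.subset_span (Or.inl (Or.inr rfl)))
    · refine Ideal.mem_of_dvd _
        (mul_dvd_mul_left _ (pow_dvd_pow X (pow_mul_le_of_coeffExponent_lt hp hlt)))
        (Ideal.subset_span (Or.inr ⟨m - coeffExponent p t m j, by omega, by omega, ?_⟩))
      rw [Nat.sub_sub_self hle]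


/-- For a prime `p`, `t ≥ 1` and `m ≥ 0`, the quotient of `ℤ_p[Y]` by the
ideal `I = (p^{m+1}, p^m·Y, p^{m-k}·Y^{p^{k-1}t} for 1 ≤ k ≤ m)` is finite of cardinality
`p^h` with `h = t·(p^{m-1} + ⋯ + p + 1) + 1`. -/
theorem card_quotient_eq (p : ℕ) [Fact p.Prime] (t m : ℕ) (ht : 1 ≤ t) :
    Nat.card (Polynomial ℤ_[p] ⧸ Ideal.span
      ({Polynomial.C ((p : ℤ_[p]) ^ (m + 1)),
        Polynomial.C ((p : ℤ_[p]) ^ m) * Polynomial.X} ∪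
       {g : Polynomial ℤ_[p] | ∃ k, 1 ≤ k ∧ k ≤ m ∧
          g = Polynomial.C ((p : ℤ_[p]) ^ (m - k)) * Polynomial.X ^ (p ^ (k - 1) * t)})) =
      p ^ (t * (∑ i ∈ Finset.range m, p ^ i) + 1) := by
  have hp := (Fact.out : p.Prime).pos
  rw [← sum_coeffExponent m hp ht]
  exact card_quotient_of_mem_iff_pow_dvd_coeff _ _ (fun j => coeffExponent_eq_zero hp ht) _
    (mem_span_iff_pow_coeffExponent_dvd_coeff _ m hp ht)
end
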